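/- arXiv:2605.15039 — 2 statements merged into one kernel-verified Lean document; each statement's English description precedes it below -/
import Mathlib

section
/- Every 4-connected W₆-minor-free graph G is one of the following: a graph on at most six vertices, a graph on seven vertices with maximum degree at most 5, or a graph isomorphic to C²₈. -/
open SimpleGraph

/-- `H` is a minor of `G`: there is a family of nonempty, pairwise disjoint,
connected branch sets in `G`, one for each vertex of `H`, such that adjacent
vertices of `H` have branch sets joined by an edge of `G`. -/
def SimpleGraph.IsMinorOf {W V : Type*} (H : SimpleGraph W) (G : SimpleGraph V) : Prop :=
  ∃ φ : W → Set V,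
    (∀ w, (φ w).Nonempty) ∧
    (∀ w, (G.induce (φ w)).Connected) ∧
    (Pairwise fun w₁ w₂ => Disjoint (φ w₁) (φ w₂)) ∧
    (∀ ⦃w₁ w₂⦄, H.Adj w₁ w₂ → ∃ a ∈ φ w₁, ∃ b ∈ φ w₂, G.Adj a b)

/-- The wheel `Wₙ`: a hub (`none`) joined to every vertex of a cycle of length `n`. -/
def wheel (n : ℕ) : SimpleGraph (Option (ZMod n)) :=
  SimpleGraph.fromRel fun a b =>
    (a = none ∧ b ≠ none) ∨ (∃ i j : ZMod n, a = some i ∧ b = some j ∧ j = i + 1)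

/-- The square `C²ₙ` of the `n`-cycle. -/
def cycleSq (n : ℕ) : SimpleGraph (ZMod n) :=
  SimpleGraph.fromRel fun i j => j = i + 1 ∨ j = i + 2

/-- A graph is 4-connected if it has at least five vertices and deleting any set
of at most three vertices leaves it connected. -/
def FourConnected {V : Type*} (G : SimpleGraph V) : Prop :=
  5 ≤ Nat.card V ∧ ∀ S : Set V, S.ncard ≤ 3 → (G.induce Sᶜ).Connected

namespace WheelMinor

section Basic

variable {V : Type*} {G : SimpleGraph V}

theorem induce_connected_iff {X : Set V} : (G.induce X).Connected ↔ X.Nonempty ∧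
    ∀ Y ⊆ X, Y.Nonempty → (∀ a ∈ Y, ∀ b ∈ X, G.Adj a b → b ∈ Y) → X ⊆ Y := by
  constructor
  · intro h
    obtain ⟨hp, hn⟩ := connected_iff _ |>.1 h
    refine ⟨Set.nonempty_coe_sort.1 hn, ?_⟩
    rintro Y hYX ⟨a, ha⟩ hcl b hb
    obtain ⟨w⟩ := hp ⟨a, hYX ha⟩ ⟨b, hb⟩
    have key : ∀ (u v : X), (G.induce X).Walk u v → u.1 ∈ Y → v.1 ∈ Y := by
      intro u v w
      induction w with
      | nil => exact id
      | cons hadj _ ih => exact fun hu => ih (hcl _ hu _ (Subtype.prop _) hadj)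
    exact key _ _ w ha
  · rintro ⟨⟨a, ha⟩, h⟩
    rw [connected_iff_exists_forall_reachable]
    refine ⟨⟨a, ha⟩, ?_⟩
    have := h {v | ∃ hv : v ∈ X, (G.induce X).Reachable ⟨a, ha⟩ ⟨v, hv⟩}
      (fun v hv => hv.1) ⟨a, ha, Reachable.refl _⟩ ?_
    · rintro ⟨b, hb⟩
      exact (this hb).2
    · rintro u ⟨hu, hr⟩ v hv huv
      exact ⟨hv, hr.trans (Adj.reachable (by simpa using huv))⟩

theorem induce_singleton_connected (v : V) : (G.induce {v}).Connected := by
  rw [induce_connected_iff]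
  refine ⟨⟨v, rfl⟩, ?_⟩
  rintro Y hY ⟨a, ha⟩ - b rfl
  obtain rfl : a = b := hY ha
  exact ha

theorem induce_insert_connected {X : Set V} (hX : (G.induce X).Connected) {v u : V} (hu : u ∈ X)
    (h : G.Adj v u) : (G.induce (insert v X)).Connected := by
  rw [induce_connected_iff] at *
  refine ⟨⟨v, by simp⟩, ?_⟩
  intro Y hY hne hcl
  have hXY : X ⊆ Y := by
    refine (hX.2 (Y ∩ X) Set.inter_subset_right ?_ ?_).trans Set.inter_subset_left
    · obtain ⟨a, ha⟩ := hne
      rcases hY ha with rfl | h'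
      · exact ⟨u, hcl _ ha _ (Or.inr hu) h, hu⟩
      · exact ⟨a, ha, h'⟩
    · rintro a ⟨ha, -⟩ b hb hab
      exact ⟨hcl a ha b (Or.inr hb) hab, hb⟩
  exact Set.insert_subset (hcl u (hXY hu) v (Or.inl rfl) h.symm) hXY

theorem wheel_isMinorOf {hub : Set V} {rim : Fin 6 → Set V}
    (hubc : (G.induce hub).Connected) (rimc : ∀ i, (G.induce (rim i)).Connected)
    (hd : ∀ i, Disjoint hub (rim i)) (rd : Pairwise fun i j => Disjoint (rim i) (rim j))
    (he : ∀ i, ∃ a ∈ hub, ∃ b ∈ rim i, G.Adj a b)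
    (re : ∀ i, ∃ a ∈ rim i, ∃ b ∈ rim (i + 1), G.Adj a b) : (wheel 6).IsMinorOf G := by
  have sw : ∀ {X Y : Set V}, (∃ a ∈ X, ∃ b ∈ Y, G.Adj a b) → ∃ a ∈ Y, ∃ b ∈ X, G.Adj a b :=
    fun ⟨a, ha, b, hb, h⟩ => ⟨b, hb, a, ha, h.symm⟩
  refine ⟨fun o => o.elim hub rim, ?_, ?_, ?_, ?_⟩
  · rintro (_ | i)
    · exact (induce_connected_iff.1 hubc).1
    · exact (induce_connected_iff.1 (rimc i)).1
  · rintro (_ | i)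
    · exact hubc
    · exact rimc i
  · rintro (_ | i) (_ | j) hij
    · exact (hij rfl).elim
    · exact hd j
    · exact (hd i).symm
    · exact rd fun h => hij (congrArg some h)
  · rintro (_ | i) (_ | j) hij
    · exact (hij.ne rfl).elim
    · exact he j
    · exact sw (he i)
    · rw [wheel, fromRel_adj] at hij
      obtain ⟨-, (h | ⟨a, b, h1, h2, h3⟩) | (h | ⟨a, b, h1, h2, h3⟩)⟩ := hij
      · simp at h
      · cases h1; cases h2; subst h3; exact re _
      · simp at h
      · cases h1; cases h2; subst h3; exact sw (re _)

end Basic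

section Certificate

/-- A code for the unordered pair `{i, j}`. -/
def pairCode (i j : ℕ) : ℕ := if i ≤ j then Nat.pair i j else Nat.pair j i

theorem pairCode_eq {i j a b : ℕ} (h : pairCode i j = pairCode a b) :
    (i = a ∧ j = b) ∨ (i = b ∧ j = a) := by
  unfold pairCode at h
  split_ifs at h <;> rw [Nat.pair_eq_pair] at h <;> omega

/-- The pair `{i, j}` belongs to the set of pairs encoded by the bits of `m`. -/
def hasPair (m i j : ℕ) : Bool := m.testBit (pairCode i j)

/-- Add the pair `{i, j}` to the set of pairs encoded by `m`. -/
def addPair (m i j : ℕ) : ℕ := m ||| 2 ^ pairCode i j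

/-- The code of a list of pairs. -/
def maskOf : List (ℕ × ℕ) → ℕ
  | [] => 0
  | p :: l => addPair (maskOf l) p.1 p.2

theorem hasPair_addPair {m i j a b : ℕ} (h : hasPair (addPair m i j) a b = true) :
    hasPair m a b = true ∨ (i = a ∧ j = b) ∨ (i = b ∧ j = a) := by
  unfold hasPair addPair at h
  rw [Nat.testBit_or, Nat.testBit_two_pow, Bool.or_eq_true, decide_eq_true_iff] at h
  exact h.imp id pairCode_eq

/-- Every element of the list but the last is joined to a later one by a pair in `m`. -/
def chained (m : ℕ) : List ℕ → Bool
  | [] => false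
  | [_] => true
  | a :: b :: l => (b :: l).any (hasPair m a) && chained m (b :: l)

/-- Some pair in `m` joins the two lists. -/
def touching (m : ℕ) (k l : List ℕ) : Bool := k.any fun a => l.any (hasPair m a)

/-- The given lists form the branch sets of a wheel with six spokes in the graph with edges `m`
on the vertices `0, …, n - 1`. -/
def isWheelModel (n m : ℕ) (hub : List ℕ) (rim : List (List ℕ)) : Bool :=
  chained m hub && decide (hub ++ rim.flatten).Nodup && (hub ++ rim.flatten).all (Nat.blt · n) &&
  decide (rim.length = 6) && rim.all (chained m) && rim.all (touching m hub) &&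
  decide (∀ i : Fin 6, touching m (rim.getD i []) (rim.getD (i + 1 : Fin 6) []) = true)

/-- A proof tree for the existence of a wheel minor in a partially specified graph: either the
specification is violated, or there is an explicit wheel model, or we branch over a pair. -/
inductive Cert
  | bad
  | model (hub : List ℕ) (rim : List (List ℕ))
  | split (i j : ℕ) (yes no : Cert)

/-- Check a proof tree. The constraint `(v, l, k)` in `few` says that `v` has at most `k`
non-neighbours in `l`, the constraint `(v, l)` in `some` that it has at least one. -/
def Cert.check (n : ℕ) (few : List (ℕ × List ℕ × ℕ)) (one : List (ℕ × List ℕ)) :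
    Cert → ℕ → ℕ → Bool
  | bad, p, q => few.any (fun c => Nat.blt c.2.2 (c.2.1.filter (hasPair q c.1)).length) ||
      one.any fun c => c.2.all (hasPair p c.1)
  | model hub rim, p, _ => isWheelModel n p hub rim
  | split i j yes no, p, q =>
      yes.check n few one (addPair p i j) q && no.check n few one p (addPair q i j)

variable {V : Type*} {G : SimpleGraph V} {f : ℕ → V} {n : ℕ}

theorem chained_connected {m : ℕ} (hm : ∀ i j, hasPair m i j = true → G.Adj (f i) (f j)) :
    ∀ l : List ℕ, chained m l = true → (G.induce (f '' {i | i ∈ l})).Connected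
  | [], h => by simp [chained] at h
  | [a], _ => by
    have e : f '' {i | i ∈ [a]} = {f a} := by ext v; simp [eq_comm]
    rw [e]
    exact induce_singleton_connected (f a)
  | a :: b :: l, h => by
    simp only [chained, Bool.and_eq_true] at h
    obtain ⟨h1, h2⟩ := h
    obtain ⟨c, hc, hac⟩ := List.any_eq_true.1 h1
    have := induce_insert_connected (chained_connected hm _ h2) ⟨c, hc, rfl⟩ (hm _ _ hac)
    have e : f '' {i | i ∈ a :: b :: l} = insert (f a) (f '' {i | i ∈ b :: l}) := by
      rw [← Set.image_insert_eq]
      congr 1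
      ext v
      simp
    rwa [e]

theorem isMinorOf_of_isWheelModel {m : ℕ} {hub : List ℕ} {rim : List (List ℕ)}
    (hf : Set.InjOn f (Set.Iio n)) (hm : ∀ i j, hasPair m i j = true → G.Adj (f i) (f j))
    (h : isWheelModel n m hub rim = true) : (wheel 6).IsMinorOf G := by
  simp only [isWheelModel, Bool.and_eq_true, decide_eq_true_eq] at h
  obtain ⟨⟨⟨⟨⟨⟨hc, hnd⟩, hlt⟩, hlen⟩, hrc⟩, hht⟩, hrt⟩ := h
  rw [List.all_eq_true] at hlt hrc hht
  rw [List.nodup_append, List.nodup_flatten] at hnd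
  obtain ⟨-, ⟨-, hpw⟩, hdj⟩ := hnd
  have hget : ∀ i : Fin 6, rim.getD i [] = rim[(i : ℕ)]'(by omega) := fun i => by
    simp [hlen]
  have hmem : ∀ i : Fin 6, rim.getD i [] ∈ rim := fun i => by
    rw [hget]; exact List.getElem_mem _
  have hlt' : ∀ i : Fin 6, ∀ a ∈ rim.getD i [], a < n := fun i a ha =>
    Nat.blt_eq.mp (hlt a (List.mem_append_right _ (List.mem_flatten.2 ⟨_, hmem i, ha⟩)))
  have tch : ∀ {k l : List ℕ}, touching m k l = true →
      ∃ a ∈ f '' {i | i ∈ k}, ∃ b ∈ f '' {i | i ∈ l}, G.Adj a b := by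
    intro k l h
    obtain ⟨a, ha, h⟩ := List.any_eq_true.1 h
    obtain ⟨b, hb, h⟩ := List.any_eq_true.1 h
    exact ⟨_, ⟨a, ha, rfl⟩, _, ⟨b, hb, rfl⟩, hm _ _ h⟩
  refine wheel_isMinorOf (hub := f '' {i | i ∈ hub}) (rim := fun i => f '' {j | j ∈ rim.getD i []})
    (chained_connected hm _ hc) (fun i => chained_connected hm _ (hrc _ (hmem i))) ?_ ?_
    (fun i => tch (hht _ (hmem i))) (fun i => tch (hrt i))
  · intro i
    rw [Set.disjoint_left]
    rintro _ ⟨a, ha, rfl⟩ ⟨b, hb, hab⟩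
    have := hf (hlt' i b hb) (Nat.blt_eq.mp (hlt a (List.mem_append_left _ ha))) hab
    exact hdj a ha b (List.mem_flatten.2 ⟨_, hmem i, hb⟩) this.symm
  · have : ∀ i j : Fin 6, i < j →
        Disjoint (f '' {k | k ∈ rim.getD i []}) (f '' {k | k ∈ rim.getD j []}) := by
      intro i j hij
      rw [Set.disjoint_left]
      rintro _ ⟨a, ha, rfl⟩ ⟨b, hb, hab⟩
      have e := hf (hlt' j b hb) (hlt' i a ha) hab
      have := List.pairwise_iff_getElem.1 hpw i j (by omega) (by omega) hij
      subst e
      simp only [hget] at ha hb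
      exact this ha hb
    intro i j hij
    rcases lt_or_gt_of_ne hij with h | h
    · exact this i j h
    · exact (this j i h).symm

theorem Cert.isMinorOf {few : List (ℕ × List ℕ × ℕ)} {one : List (ℕ × List ℕ)}
    (hf : Set.InjOn f (Set.Iio n))
    (hfew : ∀ c ∈ few, ∀ l : List ℕ, l.Sublist c.2.1 → (∀ j ∈ l, ¬ G.Adj (f c.1) (f j)) →
      l.length ≤ c.2.2)
    (hone : ∀ c ∈ one, ∃ j ∈ c.2, ¬ G.Adj (f c.1) (f j)) :
    ∀ (t : Cert) (p q : ℕ), t.check n few one p q = true →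
      (∀ i j, hasPair p i j = true → G.Adj (f i) (f j)) →
      (∀ i j, hasPair q i j = true → ¬ G.Adj (f i) (f j)) → (wheel 6).IsMinorOf G
  | bad, p, q, h, hp, hq => by
    simp only [check, Bool.or_eq_true, List.any_eq_true] at h
    rcases h with ⟨c, hc, h⟩ | ⟨c, hc, h⟩
    · have := hfew c hc _ List.filter_sublist fun j hj => hq _ _ (List.mem_filter.1 hj).2
      rw [Nat.blt_eq] at h
      omega
    · obtain ⟨j, hj, hn⟩ := hone c hc
      exact (hn (hp _ _ (List.all_eq_true.1 h j hj))).elim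
  | model hub rim, p, q, h, hp, hq => isMinorOf_of_isWheelModel hf hp h
  | split i j yes no, p, q, h, hp, hq => by
    simp only [check, Bool.and_eq_true] at h
    by_cases hij : G.Adj (f i) (f j)
    · refine Cert.isMinorOf hf hfew hone yes _ _ h.1 (fun a b hab => ?_) hq
      rcases hasPair_addPair hab with h | ⟨rfl, rfl⟩ | ⟨rfl, rfl⟩
      exacts [hp _ _ h, hij, hij.symm]
    · refine Cert.isMinorOf hf hfew hone no _ _ h.2 hp (fun a b hab => ?_)
      rcases hasPair_addPair hab with h | ⟨rfl, rfl⟩ | ⟨rfl, rfl⟩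
      exacts [hq _ _ h, hij, fun h => hij h.symm]

theorem of_hasPair_maskOf {r : ℕ → ℕ → Prop} (hr : ∀ i j, r i j → r j i) {l : List (ℕ × ℕ)}
    (h : ∀ p ∈ l, r p.1 p.2) (i j : ℕ) (hij : hasPair (maskOf l) i j = true) : r i j := by
  induction l with
  | nil => simp [hasPair, maskOf] at hij
  | cons p l ih =>
    rcases hasPair_addPair hij with h' | ⟨rfl, rfl⟩ | ⟨rfl, rfl⟩
    · exact ih (fun q hq => h q (List.mem_cons_of_mem _ hq)) h'
    · exact h p List.mem_cons_self
    · exact hr _ _ (h p List.mem_cons_self)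

theorem Cert.isMinorOf_of_lists {few : List (ℕ × List ℕ × ℕ)} {one : List (ℕ × List ℕ)}
    {pos neg : List (ℕ × ℕ)} (t : Cert)
    (ht : t.check n few one (maskOf pos) (maskOf neg) = true) (hf : Set.InjOn f (Set.Iio n))
    (hfew : ∀ c ∈ few, ∀ l : List ℕ, l.Sublist c.2.1 → (∀ j ∈ l, ¬ G.Adj (f c.1) (f j)) →
      l.length ≤ c.2.2)
    (hone : ∀ c ∈ one, ∃ j ∈ c.2, ¬ G.Adj (f c.1) (f j))
    (hpos : ∀ p ∈ pos, G.Adj (f p.1) (f p.2)) (hneg : ∀ p ∈ neg, ¬ G.Adj (f p.1) (f p.2)) :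
    (wheel 6).IsMinorOf G :=
  Cert.isMinorOf hf hfew hone t _ _ ht
    (of_hasPair_maskOf (r := fun i j => G.Adj (f i) (f j)) (fun _ _ h => h.symm) hpos)
    (of_hasPair_maskOf (r := fun i j => ¬ G.Adj (f i) (f j)) (fun _ _ h h' => h h'.symm) hneg)

theorem length_le_one_of_adj {v a b : ℕ} {l : List ℕ} (hl : l.Sublist [a, b])
    (h : ∀ j ∈ l, ¬ G.Adj (f v) (f j)) (hor : G.Adj (f v) (f a) ∨ G.Adj (f v) (f b)) :
    l.length ≤ 1 := by
  by_contra hlen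
  have e := hl.eq_of_length_le (by simp; omega)
  subst e
  rcases hor with h' | h'
  · exact h a (by simp) h'
  · exact h b (by simp) h'

end Certificate

section SmallGraphs

open scoped Classical

variable {V : Type*} [Fintype V] {G : SimpleGraph V} {f : ℕ → V} {n : ℕ}

theorem length_add_degree_le (hf : Set.InjOn f (Set.Iio n)) {v : ℕ} (hv : v < n) {l : List ℕ}
    (hl : l.Sublist ((List.range n).erase v)) (h : ∀ j ∈ l, ¬ G.Adj (f v) (f j)) :
    l.length + G.degree (f v) + 1 ≤ Fintype.card V := by
  have hnd := hl.nodup (List.nodup_range.erase v)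
  have hm : ∀ j ∈ l, j ≠ v ∧ j < n := fun j hj => by
    simpa [List.nodup_range.mem_erase_iff] using hl.subset hj
  have hln : (l.map f).Nodup := hnd.map_on fun a ha b hb hab => hf (hm a ha).2 (hm b hb).2 hab
  have h1 : Disjoint (l.map f).toFinset (insert (f v) (G.neighborFinset (f v))) := by
    rw [Finset.disjoint_left]
    intro w hw hw'
    obtain ⟨j, hj, rfl⟩ := List.mem_map.1 (List.mem_toFinset.1 hw)
    rcases Finset.mem_insert.1 hw' with e | e
    · exact (hm j hj).1 (hf (hm j hj).2 hv e)
    · exact h j hj ((G.mem_neighborFinset _ _).1 e)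
  have h2 := Finset.card_le_univ ((l.map f).toFinset ∪ insert (f v) (G.neighborFinset (f v)))
  rw [Finset.card_union_of_disjoint h1, List.toFinset_card_of_nodup hln, List.length_map,
    Finset.card_insert_of_notMem (by simp), card_neighborFinset_eq_degree] at h2
  omega

/-- A proof tree for seven vertices, one of which dominates the graph. -/
def dominatedCert : Cert :=
  .split 1 2 (.split 3 4 (.split 5 6 (.split 1 4 (.split 2 5 (.split 3 6 (.model [0] [[1], [2],
    [5], [6], [3], [4]]) (.split 1 6 (.split 2 3 (.model [0] [[1], [4], [3], [2], [5], [6]])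
    (.split 3 5 (.split 2 6 (.model [0] [[1], [2], [6], [5], [3], [4]]) (.split 2 4 (.model [0]
    [[1], [2], [4], [3], [5], [6]]) .bad)) .bad)) (.split 4 6 (.split 1 3 (.model [0] [[1], [2],
    [5], [6], [4], [3]]) (.split 2 3 (.split 1 5 (.model [0] [[1], [2], [3], [4], [6], [5]])
    .bad) .bad)) .bad))) (.split 2 6 (.split 3 5 (.model [0] [[1], [2], [6], [5], [3], [4]])
    (.split 1 5 (.split 2 3 (.model [0] [[1], [4], [3], [2], [6], [5]]) (.split 1 3 (.split 2 4
    (.model [0] [[1], [3], [4], [2], [6], [5]]) .bad) .bad)) .bad)) (.split 2 3 (.split 2 4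
    (.split 3 5 (.split 1 6 (.model [0] [[1], [2], [4], [3], [5], [6]]) (.split 4 6 (.model [0]
    [[1], [2], [3], [5], [6], [4]]) .bad)) (.split 1 5 (.split 3 6 (.model [0] [[1], [2], [4],
    [3], [6], [5]]) (.split 4 6 (.model [0] [[1], [2], [3], [4], [6], [5]]) .bad)) .bad)) .bad)
    .bad))) (.split 2 4 (.split 1 5 (.split 3 6 (.model [0] [[1], [2], [4], [3], [6], [5]])
    (.split 1 3 (.split 2 6 (.model [0] [[1], [3], [4], [2], [6], [5]]) (.split 4 6 (.split 2 3
    (.model [0] [[1], [2], [3], [4], [6], [5]]) (.split 2 5 (.model [0] [[1], [2], [5], [6],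
    [4], [3]]) .bad)) .bad)) (.split 1 6 (.split 3 5 (.model [0] [[1], [2], [4], [3], [5], [6]])
    .bad) .bad))) (.split 1 6 (.split 3 5 (.model [0] [[1], [2], [4], [3], [5], [6]]) (.split 1
    3 (.split 2 5 (.model [0] [[1], [3], [4], [2], [5], [6]]) .bad) .bad)) .bad)) (.split 4 5
    (.split 4 6 (.split 1 3 (.split 2 6 (.model [0] [[1], [2], [6], [5], [4], [3]]) (.split 2 5
    (.model [0] [[1], [2], [5], [6], [4], [3]]) .bad)) (.split 1 5 (.split 2 3 (.model [0] [[1],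
    [2], [3], [4], [6], [5]]) (.split 2 6 (.split 3 5 (.model [0] [[1], [2], [6], [4], [3],
    [5]]) .bad) .bad)) .bad)) .bad) .bad))) (.split 1 5 (.split 2 6 (.split 3 5 (.split 4 6
    (.model [0] [[1], [2], [6], [4], [3], [5]]) (.split 3 6 (.split 4 5 (.model [0] [[1], [2],
    [6], [3], [4], [5]]) (.split 1 4 (.split 2 4 (.model [0] [[1], [4], [2], [6], [3], [5]])
    .bad) .bad)) .bad)) (.split 4 5 (.split 3 6 (.model [0] [[1], [2], [6], [3], [4], [5]])
    (.split 1 6 (.split 2 3 (.model [0] [[1], [5], [4], [3], [2], [6]]) .bad) .bad)) .bad))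
    (.split 3 6 (.split 4 6 (.split 1 6 (.split 2 5 (.split 4 5 (.model [0] [[1], [2], [5], [4],
    [3], [6]]) (.split 3 5 (.model [0] [[1], [2], [5], [3], [4], [6]]) .bad)) (.split 4 5
    (.split 2 3 (.model [0] [[1], [2], [3], [6], [4], [5]]) .bad) .bad)) .bad) .bad) .bad))
    (.split 2 5 (.split 3 5 (.split 1 6 (.split 4 6 (.model [0] [[1], [2], [5], [3], [4], [6]])
    (.split 4 5 (.split 3 6 (.model [0] [[1], [2], [5], [4], [3], [6]]) .bad) .bad)) (.split 4 6
    (.split 3 6 (.split 1 4 (.model [0] [[1], [2], [5], [3], [6], [4]]) .bad) .bad) .bad)) .bad)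
    .bad))) (.split 3 5 (.split 4 6 (.split 3 6 (.split 1 4 (.split 2 5 (.model [0] [[1], [2],
    [5], [3], [6], [4]]) (.split 4 5 (.split 2 6 (.model [0] [[1], [2], [6], [3], [5], [4]])
    (.split 2 3 (.split 5 6 (.model [0] [[1], [2], [3], [5], [6], [4]]) (.split 1 5 (.model [0]
    [[1], [2], [3], [6], [4], [5]]) .bad)) .bad)) (.split 2 4 (.split 1 5 (.model [0] [[1], [2],
    [4], [6], [3], [5]]) .bad) .bad))) (.split 2 4 (.split 1 5 (.model [0] [[1], [2], [4], [6],
    [3], [5]]) (.split 4 5 (.split 1 6 (.model [0] [[1], [2], [4], [5], [3], [6]]) .bad) .bad))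
    .bad)) (.split 1 3 (.split 2 3 (.split 4 5 (.split 1 6 (.model [0] [[1], [2], [3], [5], [4],
    [6]]) (.split 2 6 (.model [0] [[1], [2], [6], [4], [5], [3]]) .bad)) (.split 1 4 (.split 5 6
    (.model [0] [[1], [2], [3], [5], [6], [4]]) (.split 2 6 (.split 1 5 (.model [0] [[1], [4],
    [6], [2], [3], [5]]) .bad) .bad)) .bad)) .bad) .bad)) (.split 4 5 (.split 1 4 (.split 3 6
    (.split 2 6 (.model [0] [[1], [2], [6], [3], [5], [4]]) (.split 2 4 (.split 1 6 (.model [0]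
    [[1], [2], [4], [5], [3], [6]]) .bad) .bad)) (.split 2 6 (.split 1 6 (.split 2 3 (.model [0]
    [[1], [4], [5], [3], [2], [6]]) .bad) .bad) .bad)) .bad) .bad)) (.split 3 6 (.split 1 3
    (.split 4 5 (.split 2 3 (.split 4 6 (.split 1 5 (.model [0] [[1], [2], [3], [6], [4], [5]])
    (.split 2 5 (.model [0] [[1], [2], [5], [4], [6], [3]]) .bad)) (.split 1 4 (.split 5 6
    (.model [0] [[1], [2], [3], [6], [5], [4]]) (.split 2 5 (.split 2 6 (.model [0] [[1], [3],
    [6], [2], [5], [4]]) .bad) .bad)) .bad)) .bad) (.split 2 4 (.split 2 5 (.split 4 6 (.split 1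
    5 (.model [0] [[1], [3], [6], [4], [2], [5]]) .bad) .bad) .bad) .bad)) .bad) .bad))) (.split
    1 3 (.split 2 4 (.split 1 5 (.split 2 6 (.split 3 4 (.split 5 6 (.model [0] [[1], [3], [4],
    [2], [6], [5]]) (.split 2 5 (.split 4 6 (.model [0] [[1], [3], [4], [6], [2], [5]]) (.split
    1 6 (.split 3 6 (.model [0] [[1], [5], [2], [4], [3], [6]]) .bad) .bad)) (.split 4 5 (.split
    3 6 (.model [0] [[1], [3], [6], [2], [4], [5]]) (.split 1 6 (.split 3 5 (.model [0] [[1],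
    [3], [5], [4], [2], [6]]) .bad) .bad)) .bad))) (.split 3 6 (.split 4 5 (.model [0] [[1],
    [3], [6], [2], [4], [5]]) (.split 1 4 (.split 3 5 (.model [0] [[1], [4], [2], [6], [3],
    [5]]) (.split 2 5 (.split 4 6 (.model [0] [[1], [3], [6], [4], [2], [5]]) .bad) .bad))
    .bad)) (.split 2 3 (.split 4 6 (.split 3 5 (.split 1 4 (.model [0] [[1], [4], [6], [2], [3],
    [5]]) (.split 1 6 (.model [0] [[1], [5], [3], [2], [4], [6]]) .bad)) .bad) (.split 4 5
    (.split 1 6 (.split 3 5 (.model [0] [[1], [3], [5], [4], [2], [6]]) .bad) .bad) .bad))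
    .bad))) (.split 2 3 (.split 4 6 (.split 5 6 (.model [0] [[1], [3], [2], [4], [6], [5]])
    (.split 2 5 (.split 3 6 (.model [0] [[1], [3], [6], [4], [2], [5]]) .bad) .bad)) (.split 1 6
    (.split 5 6 (.split 4 5 (.model [0] [[1], [3], [2], [4], [5], [6]]) (.split 1 4 (.split 3 6
    (.model [0] [[1], [4], [2], [3], [6], [5]]) .bad) .bad)) .bad) .bad)) .bad)) (.split 1 6
    (.split 2 5 (.split 1 4 (.split 3 5 (.split 3 6 (.model [0] [[1], [4], [2], [5], [3], [6]])
    (.split 4 6 (.model [0] [[1], [3], [5], [2], [4], [6]]) (.split 2 6 (.split 5 6 (.model [0]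
    [[1], [3], [5], [6], [2], [4]]) .bad) .bad))) (.split 5 6 (.split 3 4 (.model [0] [[1], [3],
    [4], [2], [5], [6]]) (.split 3 6 (.model [0] [[1], [3], [6], [5], [2], [4]]) .bad)) .bad))
    .bad) (.split 4 5 (.split 2 3 (.split 5 6 (.model [0] [[1], [3], [2], [4], [5], [6]]) .bad)
    .bad) .bad)) .bad)) (.split 2 5 (.split 2 6 (.split 1 4 (.split 2 3 (.split 4 5 (.split 3 6
    (.model [0] [[1], [3], [6], [2], [5], [4]]) (.split 5 6 (.model [0] [[1], [3], [2], [6],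
    [5], [4]]) (.split 1 6 (.split 4 6 (.model [0] [[1], [3], [2], [5], [4], [6]]) .bad) .bad)))
    (.split 4 6 (.split 3 5 (.model [0] [[1], [3], [5], [2], [6], [4]]) (.split 5 6 (.model [0]
    [[1], [3], [2], [5], [6], [4]]) .bad)) .bad)) .bad) (.split 3 4 (.split 1 5 (.split 4 6
    (.model [0] [[1], [3], [4], [6], [2], [5]]) .bad) .bad) .bad)) .bad) .bad)) (.split 1 4
    (.split 1 5 (.split 1 6 (.split 2 3 (.split 2 5 (.split 3 6 (.split 4 5 (.model [0] [[1],
    [4], [5], [2], [3], [6]]) (.split 4 6 (.model [0] [[1], [4], [6], [3], [2], [5]]) (.split 2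
    4 (.split 3 4 (.model [0] [[1], [5], [2], [4], [3], [6]]) .bad) .bad))) (.split 3 4 (.split
    5 6 (.model [0] [[1], [4], [3], [2], [5], [6]]) (.split 4 6 (.model [0] [[1], [5], [2], [3],
    [4], [6]]) .bad)) .bad)) (.split 2 4 (.split 3 5 (.split 2 6 (.split 3 4 (.model [0] [[1],
    [5], [3], [4], [2], [6]]) (.split 3 6 (.model [0] [[1], [4], [2], [6], [3], [5]]) .bad))
    .bad) (.split 3 6 (.split 4 5 (.model [0] [[1], [5], [4], [2], [3], [6]]) .bad) .bad))
    .bad)) (.split 2 4 (.split 3 5 (.split 2 6 (.split 3 4 (.model [0] [[1], [5], [3], [4], [2],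
    [6]]) .bad) .bad) .bad) .bad)) .bad) .bad) .bad))

theorem isMinorOf_of_dominating (hn : Fintype.card V = 7) (hf : Set.InjOn f (Set.Iio 7))
    (hdeg : ∀ v, 4 ≤ G.degree v) (h0 : ∀ i < 7, i ≠ 0 → G.Adj (f 0) (f i)) :
    (wheel 6).IsMinorOf G := by
  refine dominatedCert.isMinorOf_of_lists (f := f) (n := 7)
    (few := (List.range 7).map fun v => (v, (List.range 7).erase v, 2)) (one := [])
    (pos := [(0, 1), (0, 2), (0, 3), (0, 4), (0, 5), (0, 6)]) (neg := [])
    (by decide +kernel) hf ?_ (by simp) ?_ (by simp)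
  · intro c hc l hl hadj
    obtain ⟨v, hv, rfl⟩ := List.mem_map.1 hc
    have := length_add_degree_le hf (List.mem_range.1 hv) hl hadj
    have := hdeg (f v)
    simp only
    omega
  · simp [h0]

/-- A proof tree for the vertex splits of the square of the 8-cycle. -/
def cycleSqSplitCert : Cert :=
  .split 0 1 (.split 2 8 (.split 7 8 (.split 0 6 (.model [1, 7] [[0], [6], [5], [3], [2], [8]])
    (.split 0 2 (.model [2, 4, 6] [[0], [1], [3], [5], [7], [8]]) .bad)) (.split 6 8 (.split 0 7
    (.model [2, 6, 8] [[0], [1], [3], [4], [5], [7]]) .bad) .bad)) (.split 6 8 (.split 7 8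
    (.split 0 2 (.model [1, 7] [[0], [2], [3], [5], [6], [8]]) .bad) .bad) .bad)) (.split 1 8
    (.split 0 2 (.split 0 6 (.split 7 8 (.model [2, 0, 6] [[1], [3], [4], [5], [7], [8]])
    (.split 2 8 (.model [2, 4] [[0], [6], [5], [3], [1], [8]]) .bad)) .bad) .bad) .bad)

theorem isMinorOf_of_split_cycleSq (hf : Set.InjOn f (Set.Iio 9)) (h08 : G.Adj (f 0) (f 8))
    (hpos : ∀ i < 8, ∀ j < 8, 0 < i → i < j →
      (G.Adj (f i) (f j) ↔ j = i + 1 ∨ j = i + 2 ∨ j = i + 6))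
    (hneg : ∀ i, 3 ≤ i → i ≤ 5 → ¬ G.Adj (f 0) (f i) ∧ ¬ G.Adj (f 8) (f i))
    (hor : ∀ i < 8, 0 < i → i ≤ 2 ∨ 6 ≤ i → G.Adj (f 0) (f i) ∨ G.Adj (f 8) (f i))
    (hcard : Fintype.card V = 9) (hdeg : ∀ v, 4 ≤ G.degree v) : (wheel 6).IsMinorOf G := by
  refine cycleSqSplitCert.isMinorOf_of_lists (f := f) (n := 9)
    (few := (List.range 9).map (fun v => (v, (List.range 9).erase v, 4)) ++
      [1, 2, 6, 7].map fun v => (v, [0, 8], 1)) (one := [])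
    (pos := [(0, 8), (1, 2), (1, 3), (1, 7), (2, 3), (2, 4), (3, 4), (3, 5), (4, 5), (4, 6),
      (5, 6), (5, 7), (6, 7)])
    (neg := [(1, 4), (1, 5), (1, 6), (2, 5), (2, 6), (2, 7), (3, 6), (3, 7), (4, 7), (0, 3),
      (8, 3), (0, 4), (8, 4), (0, 5), (8, 5)])
    (by decide +kernel) hf ?_ (by simp) (by simp [hpos, h08]) (by simp [hpos, hneg])
  intro c hc l hl hadj
  rcases List.mem_append.1 hc with hc | hc
  · obtain ⟨v, hv, rfl⟩ := List.mem_map.1 hc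
    have := length_add_degree_le hf (List.mem_range.1 hv) hl hadj
    have := hdeg (f v)
    simp only
    omega
  · obtain ⟨v, hv, rfl⟩ := List.mem_map.1 hc
    refine length_le_one_of_adj hl hadj ((hor v ?_ ?_ ?_).imp Adj.symm Adj.symm) <;>
    · simp at hv
      omega

/-- Constraints on a graph with vertices `0, …, 7` for which contracting the edge `{0, 1}` gives
a graph of minimum degree at least four in which the new vertex is adjacent to `2, …, m + 1`. -/
def contractFew (m : ℕ) : List (ℕ × List ℕ × ℕ) :=
  (List.range 8).map (fun v => (v, (List.range 8).erase v, 3)) ++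
    ((List.range' 2 m).map (fun v => (v, [0, 1], 1)) ++
      (List.range' 2 m).map fun v => (v, (List.range' 2 6).erase v, 2))

/-- Constraints expressing that the contracted graph has no vertex of degree six among
`2, …, m + 1`. -/
def contractOne (m : ℕ) : List (ℕ × List ℕ) :=
  (List.range' 2 m).map fun v => (v, (List.range' 2 6).erase v)

theorem isMinorOf_of_contract_cert {m : ℕ} {pos neg : List (ℕ × ℕ)} (t : Cert)
    (ht : t.check 8 (contractFew m) (contractOne m) (maskOf pos) (maskOf neg) = true)
    (hm : m ≤ 6) (hcard : Fintype.card V = 8) (hf : Set.InjOn f (Set.Iio 8))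
    (hdeg : ∀ v, 4 ≤ G.degree v)
    (hboth : ∀ v, G.Adj (f 0) v → G.Adj (f 1) v → 5 ≤ G.degree v)
    (hor : ∀ i, 2 ≤ i → i < 2 + m → G.Adj (f 0) (f i) ∨ G.Adj (f 1) (f i))
    (hone : ∀ i, 2 ≤ i → i < 2 + m → ∃ j, 2 ≤ j ∧ j < 8 ∧ j ≠ i ∧ ¬ G.Adj (f i) (f j))
    (hpos : ∀ p ∈ pos, G.Adj (f p.1) (f p.2)) (hneg : ∀ p ∈ neg, ¬ G.Adj (f p.1) (f p.2)) :
    (wheel 6).IsMinorOf G := by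
  refine t.isMinorOf_of_lists ht hf ?_ ?_ hpos hneg
  · intro c hc l hl hadj
    rcases List.mem_append.1 hc with hc | hc
    · obtain ⟨v, hv, rfl⟩ := List.mem_map.1 hc
      have := length_add_degree_le hf (List.mem_range.1 hv) hl hadj
      have := hdeg (f v)
      simp only
      omega
    rcases List.mem_append.1 hc with hc | hc
    · obtain ⟨v, hv, rfl⟩ := List.mem_map.1 hc
      rw [List.mem_range'_1] at hv
      exact length_le_one_of_adj hl hadj ((hor v hv.1 hv.2).imp Adj.symm Adj.symm)
    · obtain ⟨v, hv, rfl⟩ := List.mem_map.1 hc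
      rw [List.mem_range'_1] at hv
      simp only at hl hadj ⊢
      have hv8 : v < 8 := by omega
      have ext : ∀ k : List ℕ, k.Sublist [0, 1] →
          (k ++ l).Sublist ((List.range 8).erase v) := fun k hk => by
        have e : (List.range 8).erase v = [0, 1] ++ (List.range' 2 6).erase v := by
          rw [← List.erase_append_right _ (by simp; omega)]
          rfl
        rw [e]
        exact hk.append hl
      by_cases h0 : G.Adj (f v) (f 0)
      · by_cases h1 : G.Adj (f v) (f 1)
        · have := length_add_degree_le hf hv8 (ext [] (by simp)) (by simpa using hadj)
          have := hboth _ h0.symm h1.symm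
          simp at *
          omega
        · have := length_add_degree_le (G := G) hf hv8 (ext [1] (by simp)) (by simpa [h1] using hadj)
          have := hdeg (f v)
          simp at *
          omega
      · have := length_add_degree_le (G := G) hf hv8 (ext [0] (by simp)) (by simpa [h0] using hadj)
        have := hdeg (f v)
        simp at *
        omega
  · intro c hc
    obtain ⟨v, hv, rfl⟩ := List.mem_map.1 hc
    rw [List.mem_range'_1] at hv
    obtain ⟨j, hj, hj', hne, h⟩ := hone v hv.1 hv.2
    refine ⟨j, ?_, h⟩
    rw [(List.nodup_range' ..).mem_erase_iff, List.mem_range'_1]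
    exact ⟨hne, hj, by omega⟩

/-- A proof tree for the case that `7` is the only vertex not adjacent to the contracted edge,
and is adjacent to all remaining vertices. -/
def contractCertFull : Cert :=
  .split 1 5 (.split 1 6 (.split 3 6 (.split 4 5 (.split 2 5 (.split 2 6 (.model [0, 2] [[1], [5],
    [4], [7], [3], [6]]) (.split 5 6 (.split 2 3 (.model [2, 5] [[0], [1], [6], [3], [7], [4]])
    (.split 2 4 (.split 3 5 .bad (.split 3 4 (.model [4, 5] [[0], [1], [6], [3], [7], [2]])
    .bad)) .bad)) (.split 4 6 (.model [0, 4] [[1], [5], [2], [7], [3], [6]]) .bad))) (.split 2 6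
    (.split 5 6 (.split 2 4 (.model [2, 6] [[0], [1], [5], [4], [7], [3]]) (.split 2 3 (.split 4
    6 .bad (.split 3 4 (.model [3, 6] [[0], [1], [5], [4], [7], [2]]) .bad)) .bad)) (.split 3 5
    (.model [0, 3] [[1], [5], [4], [7], [2], [6]]) .bad)) (.split 2 3 (.split 2 4 (.split 5 6
    (.split 1 2 (.model [1, 2] [[0], [3], [6], [5], [7], [4]]) (.split 1 3 (.model [3, 7] [[0],
    [1], [6], [5], [4], [2]]) (.split 1 4 (.model [4, 7] [[0], [1], [5], [6], [3], [2]]) .bad)))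
    (.split 4 6 (.model [0, 4] [[1], [5], [7], [2], [3], [6]]) .bad)) .bad) .bad))) (.split 3 5
    (.split 3 4 (.split 2 3 .bad (.split 2 5 (.split 2 4 (.model [0, 3] [[1], [5], [2], [4],
    [7], [6]]) (.split 2 6 (.model [0, 2] [[1], [5], [3], [4], [7], [6]]) .bad)) (.split 2 6
    (.split 5 6 (.split 2 4 (.model [0, 3] [[1], [5], [7], [4], [2], [6]]) .bad) .bad) .bad)))
    (.split 4 6 (.split 2 4 (.model [0, 3] [[1], [5], [7], [2], [4], [6]]) .bad) .bad)) (.split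
    5 6 (.split 2 5 (.split 4 6 (.split 3 4 (.split 2 6 .bad (.split 2 4 (.model [4, 6] [[0],
    [1], [5], [2], [7], [3]]) (.split 2 3 (.model [3, 6] [[0], [1], [5], [2], [7], [4]]) .bad)))
    (.split 2 4 (.model [4, 6] [[0], [1], [5], [2], [7], [3]]) .bad)) (.split 3 4 (.split 2 4
    (.split 1 4 (.model [1, 4] [[0], [2], [5], [6], [7], [3]]) (.split 1 2 (.model [2, 7] [[0],
    [1], [5], [6], [3], [4]]) (.split 1 3 (.model [3, 7] [[0], [1], [6], [5], [2], [4]]) .bad)))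
    .bad) .bad)) .bad) .bad))) (.split 4 6 (.split 3 4 (.split 2 6 (.split 3 5 (.split 2 5
    (.model [0, 2] [[1], [5], [3], [4], [7], [6]]) (.split 4 5 (.model [0, 4] [[1], [5], [3],
    [7], [2], [6]]) (.split 5 6 (.model [4, 6] [[0], [1], [5], [3], [7], [2]]) .bad))) (.split 2
    3 (.split 4 5 (.model [0, 4] [[1], [5], [7], [3], [2], [6]]) (.split 2 5 (.model [0, 2]
    [[1], [5], [7], [3], [4], [6]]) .bad)) .bad)) (.split 5 6 (.split 2 4 (.split 2 3 (.model
    [4, 6] [[0], [1], [5], [7], [2], [3]]) (.split 3 5 (.model [4, 6] [[0], [1], [5], [3], [7],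
    [2]]) .bad)) (.split 2 3 (.split 2 5 (.split 1 3 (.model [1, 3] [[0], [2], [5], [6], [7],
    [4]]) (.split 1 4 (.model [4, 7] [[0], [1], [6], [5], [2], [3]]) (.split 1 2 (.model [2, 7]
    [[0], [1], [5], [6], [4], [3]]) .bad))) .bad) .bad)) .bad)) (.split 3 5 (.split 2 3 (.split
    4 5 (.model [0, 4] [[1], [5], [3], [2], [7], [6]]) (.split 2 4 (.split 2 5 (.split 2 6 .bad
    (.split 5 6 (.model [2, 5] [[0], [1], [6], [4], [7], [3]]) .bad)) (.split 5 6 (.split 1 2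
    (.model [1, 2] [[0], [3], [5], [6], [7], [4]]) (.split 1 3 (.model [3, 7] [[0], [1], [5],
    [6], [4], [2]]) (.split 1 4 (.model [4, 7] [[0], [1], [6], [5], [3], [2]]) .bad))) .bad))
    .bad)) .bad) .bad)) (.split 2 6 (.split 5 6 (.split 3 4 (.split 2 3 (.split 2 4 (.model [2,
    6] [[0], [1], [5], [7], [3], [4]]) (.split 4 5 (.split 1 3 (.model [1, 3] [[0], [2], [6],
    [5], [7], [4]]) (.split 1 2 (.model [2, 7] [[0], [1], [6], [5], [4], [3]]) (.split 1 4
    (.model [4, 7] [[0], [1], [5], [6], [2], [3]]) .bad))) .bad)) (.split 3 5 (.split 2 4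
    (.split 1 4 (.model [1, 4] [[0], [2], [6], [5], [7], [3]]) (.split 1 2 (.model [2, 7] [[0],
    [1], [6], [5], [3], [4]]) (.split 1 3 (.model [3, 7] [[0], [1], [5], [6], [2], [4]]) .bad)))
    (.split 2 5 (.model [0, 2] [[1], [5], [3], [4], [7], [6]]) .bad)) .bad)) (.split 2 4 (.split
    2 3 (.split 4 5 (.model [2, 6] [[0], [1], [5], [4], [7], [3]]) .bad) .bad) .bad)) .bad)
    .bad))) (.split 0 6 (.split 1 3 (.split 5 6 (.split 1 2 (.split 3 4 (.model [2, 7] [[0],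
    [4], [3], [1], [5], [6]]) (.split 4 6 (.model [2, 7] [[0], [3], [1], [5], [6], [4]]) (.split
    2 4 (.model [3, 7] [[0], [4], [2], [1], [5], [6]]) .bad))) (.split 1 4 (.split 2 4 (.model
    [3, 7] [[0], [2], [4], [1], [5], [6]]) (.split 2 6 (.model [3, 7] [[0], [2], [6], [5], [1],
    [4]]) (.split 2 3 (.model [4, 7] [[0], [2], [3], [1], [5], [6]]) .bad))) .bad)) (.split 2 6
    (.split 4 5 (.split 3 6 (.model [0, 4] [[1], [3], [6], [2], [7], [5]]) (.split 4 6 (.model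
    [3, 7] [[0], [1], [5], [4], [6], [2]]) .bad)) (.split 2 5 (.split 3 5 (.split 4 6 (.model
    [3, 7] [[0], [1], [5], [2], [6], [4]]) (.split 3 6 (.split 3 4 (.model [3] [[0], [1], [2,
    5], [6], [7], [4]]) .bad) .bad)) .bad) .bad)) (.split 4 6 (.split 3 6 (.split 2 5 (.model
    [0, 2] [[1], [3], [6], [4], [7], [5]]) (.split 3 5 (.split 2 3 (.split 2 4 (.model [2, 3]
    [[0], [1], [5], [7], [4], [6]]) .bad) .bad) .bad)) .bad) .bad))) (.split 1 4 (.split 1 2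
    (.split 3 6 (.split 3 5 (.model [2, 7] [[0], [4], [1], [5], [3], [6]]) (.split 5 6 (.model
    [2, 7] [[0], [3], [6], [5], [1], [4]]) (.split 2 5 (.split 4 5 (.split 2 6 (.model [0, 4]
    [[1], [2], [6], [3], [7], [5]]) (.split 4 6 (.model [0, 2] [[1], [4], [6], [3], [7], [5]])
    .bad)) .bad) .bad))) (.split 3 5 (.split 2 6 (.model [4, 7] [[0], [3], [5], [1], [2], [6]])
    (.split 4 6 (.model [2, 7] [[0], [3], [5], [1], [4], [6]]) .bad)) (.split 2 3 (.split 3 4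
    (.split 5 6 (.model [0, 6] [[1], [2], [3], [4], [7], [5]]) (.split 2 6 (.split 4 6 (.split 4
    5 (.model [1, 2] [[0], [3], [4], [5], [7], [6]]) .bad) .bad) .bad)) .bad) .bad))) .bad)
    .bad)) .bad)) (.split 0 5 (.split 1 6 (.split 1 3 (.split 5 6 (.split 1 4 (.split 2 3
    (.model [4, 7] [[0], [2], [3], [1], [6], [5]]) (.split 2 5 (.model [3, 7] [[0], [2], [5],
    [6], [1], [4]]) (.split 2 4 (.model [3, 7] [[0], [2], [4], [1], [6], [5]]) .bad))) (.split 1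
    2 (.split 2 4 (.model [3, 7] [[0], [4], [2], [1], [6], [5]]) (.split 4 5 (.model [2, 7]
    [[0], [3], [1], [6], [5], [4]]) (.split 3 4 (.model [2, 7] [[0], [4], [3], [1], [6], [5]])
    .bad))) .bad)) (.split 4 5 (.split 2 6 (.split 3 5 (.model [0, 2] [[1], [3], [5], [4], [7],
    [6]]) (.split 2 5 (.model [3, 7] [[0], [1], [6], [2], [5], [4]]) .bad)) (.split 4 6 (.split
    3 6 (.split 2 5 (.model [3, 7] [[0], [1], [6], [4], [5], [2]]) (.split 3 5 (.split 2 3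
    (.model [3, 5] [[0], [1], [6], [4], [7], [2]]) .bad) .bad)) .bad) .bad)) (.split 2 5 (.split
    3 5 (.split 4 6 (.model [0, 4] [[1], [3], [5], [2], [7], [6]]) (.split 3 6 (.split 3 4
    (.split 2 4 (.model [3] [[0], [1], [6], [7], [2, 4], [5]]) .bad) .bad) .bad)) .bad) .bad)))
    (.split 1 4 (.split 1 2 (.split 3 5 (.split 3 6 (.model [2, 7] [[0], [4], [1], [6], [3],
    [5]]) (.split 5 6 (.model [2, 7] [[0], [3], [5], [6], [1], [4]]) (.split 2 6 (.split 4 6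
    (.split 2 5 (.model [0, 4] [[1], [2], [5], [3], [7], [6]]) (.split 4 5 (.model [0, 2] [[1],
    [4], [5], [3], [7], [6]]) .bad)) .bad) .bad))) (.split 5 6 (.split 2 3 (.model [4, 7] [[0],
    [3], [2], [1], [6], [5]]) (.split 3 4 (.model [2, 7] [[0], [3], [4], [1], [6], [5]]) .bad))
    (.split 2 5 (.split 4 5 (.split 3 6 (.model [0, 3] [[1], [2], [5], [4], [7], [6]]) (.split 3
    4 (.split 2 3 (.split 4 6 (.model [1, 2] [[0], [3], [4], [6], [7], [5]]) .bad) .bad) .bad))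
    .bad) .bad))) .bad) .bad)) (.split 1 4 (.split 1 3 (.split 0 6 (.split 1 2 (.split 5 6
    (.split 2 5 (.model [0, 3] [[1], [2], [5], [6], [7], [4]]) (.split 2 6 (.model [0, 3] [[1],
    [2], [6], [5], [7], [4]]) (.split 2 4 (.split 2 3 (.split 4 6 (.model [0, 2] [[1], [3], [7],
    [5], [6], [4]]) (.split 3 6 (.model [0, 2] [[1], [3], [6], [5], [7], [4]]) .bad)) .bad)
    .bad))) (.split 3 6 (.split 2 5 (.model [0, 4] [[1], [2], [5], [7], [6], [3]]) (.split 4 5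
    (.model [0, 2] [[1], [3], [6], [7], [5], [4]]) .bad)) (.split 4 6 (.split 2 6 (.model [0, 5]
    [[1], [2], [6], [4], [7], [3]]) .bad) .bad))) .bad) .bad) .bad) .bad)) .bad)

/-- A proof tree for the case that `7` is the only vertex not adjacent to the contracted edge,
and misses one of the remaining vertices. -/
def contractCertMiss : Cert :=
  .split 4 6 (.split 5 6 (.split 1 6 (.split 3 6 (.split 1 4 (.split 2 5 (.split 0 5 (.split 2 3
    (.model [3, 6] [[0], [1], [4], [7], [2], [5]]) (.split 2 6 (.model [3, 6] [[0], [1], [4],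
    [7], [2], [5]]) (.split 2 4 (.model [5, 6] [[0], [1], [4], [2], [7], [3]]) .bad))) (.split 1
    5 (.split 0 4 (.model [4, 7] [[0], [2], [5], [1], [6], [3]]) (.split 0 6 (.split 2 4 (.model
    [0, 2] [[1], [4], [6], [3], [7], [5]]) (.split 3 4 (.model [5, 6] [[0], [1], [4], [3], [7],
    [2]]) (.split 4 5 (.split 2 3 (.model [2, 5] [[0], [1], [4], [7], [3], [6]]) (.split 3 5
    .bad .bad)) .bad))) .bad)) .bad)) (.split 2 3 (.split 4 5 (.model [3, 6] [[0], [1], [4],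
    [5], [7], [2]]) (.split 3 5 (.split 3 4 .bad (.split 2 4 (.split 0 5 (.model [3, 6] [[0],
    [1], [4], [2], [7], [5]]) (.split 1 5 (.model [3, 6] [[0], [1], [5], [7], [4], [2]]) .bad))
    .bad)) .bad)) (.split 2 6 (.split 2 4 (.split 3 5 (.model [2, 6] [[0], [1], [4], [7], [5],
    [3]]) (.split 4 5 (.model [2, 6] [[0], [1], [4], [5], [7], [3]]) .bad)) .bad) .bad)))
    (.split 0 4 (.split 1 5 (.split 2 4 (.split 1 3 (.model [3, 7] [[0], [1], [5], [6], [4],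
    [2]]) (.split 1 2 (.model [4, 6] [[0], [2], [1], [5], [7], [3]]) .bad)) (.split 2 6 (.split
    4 5 (.model [2, 6] [[0], [1], [5], [4], [7], [3]]) (.split 3 4 (.model [2, 6] [[0], [1],
    [5], [7], [3], [4]]) .bad)) (.split 2 3 (.split 2 5 (.model [3, 6] [[0], [1], [5], [2], [7],
    [4]]) .bad) .bad))) (.split 1 2 (.split 0 5 (.split 1 3 (.model [0, 4] [[1], [2], [7], [5],
    [6], [3]]) .bad) .bad) .bad)) .bad)) (.split 2 6 (.split 2 3 (.split 1 5 (.split 3 4 (.model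
    [2, 6] [[0], [1], [5], [7], [4], [3]]) (.split 3 5 (.split 4 5 (.model [2, 6] [[0], [1],
    [5], [4], [7], [3]]) (.split 2 4 (.split 2 5 .bad (.split 0 4 (.model [2, 6] [[0], [1], [5],
    [3], [7], [4]]) (.split 1 4 (.model [2, 6] [[0], [1], [4], [7], [5], [3]]) .bad))) .bad))
    .bad)) (.split 0 5 (.split 1 4 (.split 3 5 (.model [2, 6] [[0], [1], [4], [7], [3], [5]])
    (.split 3 4 (.model [2, 6] [[0], [1], [4], [3], [7], [5]]) .bad)) (.split 1 2 (.split 0 4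
    (.model [0, 4] [[1], [2], [3], [7], [5], [6]]) .bad) .bad)) .bad)) (.split 3 4 (.split 3 5
    (.split 1 4 (.split 2 4 (.model [3, 4] [[0], [1], [6], [5], [7], [2]]) (.split 2 5 (.split 1
    5 (.model [1, 5] [[0], [2], [6], [4], [7], [3]]) (.split 0 5 (.model [5, 6] [[0], [1], [4],
    [3], [7], [2]]) .bad)) .bad)) (.split 0 4 (.split 1 2 (.model [2, 7] [[0], [1], [6], [5],
    [3], [4]]) (.split 1 5 (.model [4, 6] [[0], [1], [5], [3], [7], [2]]) .bad)) .bad)) .bad)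
    .bad)) .bad)) (.split 0 6 (.split 1 5 (.split 1 4 (.split 3 6 (.split 1 3 (.split 2 4
    (.model [1, 4] [[0], [2], [7], [5], [6], [3]]) (.split 2 5 (.model [1, 5] [[0], [2], [7],
    [4], [6], [3]]) (.split 2 6 (.model [4, 6] [[0], [2], [7], [5], [1], [3]]) .bad))) (.split 1
    2 (.split 2 6 (.model [4, 6] [[0], [2], [1], [5], [7], [3]]) (.split 2 5 (.model [5, 6]
    [[0], [2], [1], [4], [7], [3]]) (.split 2 4 (.model [4, 6] [[0], [2], [1], [5], [7], [3]])
    .bad))) .bad)) (.split 2 6 (.split 3 4 (.split 1 2 (.model [1, 4] [[0], [2], [6], [5], [7],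
    [3]]) (.split 1 3 (.model [4, 6] [[0], [2], [7], [5], [1], [3]]) .bad)) (.split 3 5 (.split
    2 3 (.model [5, 6] [[0], [1], [4], [7], [2], [3]]) .bad) .bad)) .bad)) (.split 1 2 (.split 1
    3 (.split 0 4 (.split 3 6 (.model [3, 7] [[0], [2], [1], [5], [6], [4]]) (.split 2 6 (.model
    [2, 7] [[0], [3], [1], [5], [6], [4]]) .bad)) .bad) .bad) .bad)) (.split 1 4 (.split 1 2
    (.split 1 3 (.split 0 5 (.split 3 6 (.model [3, 7] [[0], [2], [1], [4], [6], [5]]) (.split 2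
    6 (.model [2, 7] [[0], [3], [1], [4], [6], [5]]) .bad)) .bad) .bad) .bad) .bad)) .bad))
    (.split 2 6 (.split 3 6 (.split 4 5 (.split 1 5 (.split 1 6 (.split 2 5 (.model [2, 6] [[0],
    [1], [5], [4], [7], [3]]) (.split 3 5 (.model [3, 6] [[0], [1], [5], [4], [7], [2]]) .bad))
    (.split 0 6 (.split 1 3 (.model [3, 7] [[0], [1], [5], [4], [6], [2]]) (.split 1 2 (.model
    [2, 7] [[0], [1], [5], [4], [6], [3]]) .bad)) .bad)) (.split 0 5 (.split 1 6 (.split 1 4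
    (.split 3 5 (.model [3, 6] [[0], [1], [4], [5], [7], [2]]) (.split 2 5 (.model [2, 6] [[0],
    [1], [4], [5], [7], [3]]) .bad)) (.split 1 3 (.split 1 2 (.model [2, 7] [[0], [1], [3], [6],
    [4], [5]]) .bad) .bad)) (.split 0 6 (.split 1 2 (.split 1 3 (.model [0, 5] [[1], [2], [6],
    [4], [7], [3]]) .bad) .bad) .bad)) .bad)) (.split 2 5 (.split 3 5 (.split 1 6 (.split 1 4
    (.model [2, 6] [[0], [1], [4], [7], [5], [3]]) (.split 0 4 (.split 1 5 (.model [0, 2] [[1],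
    [5], [3], [7], [4], [6]]) (.split 1 3 (.model [0, 2] [[1], [3], [5], [7], [4], [6]]) .bad))
    .bad)) (.split 0 6 (.split 1 5 (.split 1 4 (.split 1 2 (.model [2, 6] [[0], [1], [4], [7],
    [5], [3]]) (.split 1 3 (.model [3, 6] [[0], [1], [4], [7], [5], [2]]) .bad)) (.split 1 3
    (.split 0 4 (.model [0, 2] [[1], [3], [6], [4], [7], [5]]) .bad) .bad)) (.split 1 4 (.split
    1 2 (.model [2, 6] [[0], [1], [4], [7], [5], [3]]) .bad) .bad)) .bad)) .bad) .bad)) .bad)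
    .bad)) (.split 5 6 (.split 2 6 (.split 3 6 (.split 4 5 (.split 1 4 (.split 1 6 (.split 3 4
    (.model [3, 6] [[0], [1], [4], [5], [7], [2]]) (.split 2 4 (.model [2, 6] [[0], [1], [4],
    [5], [7], [3]]) .bad)) (.split 0 6 (.split 1 2 (.model [2, 7] [[0], [1], [4], [5], [6],
    [3]]) (.split 1 3 (.model [3, 7] [[0], [1], [4], [5], [6], [2]]) .bad)) .bad)) (.split 0 4
    (.split 1 6 (.split 1 5 (.split 3 4 (.model [3, 6] [[0], [1], [5], [4], [7], [2]]) (.split 2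
    4 (.model [2, 6] [[0], [1], [5], [4], [7], [3]]) .bad)) (.split 1 3 (.split 1 2 (.model [2,
    7] [[0], [1], [3], [6], [5], [4]]) .bad) .bad)) (.split 0 6 (.split 1 2 (.split 1 3 (.model
    [0, 4] [[1], [2], [6], [5], [7], [3]]) .bad) .bad) .bad)) .bad)) (.split 2 4 (.split 3 4
    (.split 1 6 (.split 1 5 (.model [2, 6] [[0], [1], [5], [7], [4], [3]]) (.split 0 5 (.split 1
    4 (.model [0, 2] [[1], [4], [3], [7], [5], [6]]) (.split 1 3 (.model [0, 2] [[1], [3], [4],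
    [7], [5], [6]]) .bad)) .bad)) (.split 0 6 (.split 1 4 (.split 1 5 (.split 1 3 (.model [3, 6]
    [[0], [1], [5], [7], [4], [2]]) (.split 1 2 (.model [2, 6] [[0], [1], [5], [7], [4], [3]])
    .bad)) (.split 1 2 (.split 0 5 (.model [0, 3] [[1], [2], [6], [5], [7], [4]]) .bad) .bad))
    (.split 1 5 (.split 1 2 (.model [2, 6] [[0], [1], [5], [7], [4], [3]]) .bad) .bad)) .bad))
    .bad) .bad)) .bad) .bad) .bad)

/-- A proof tree for the case that `6` and `7` are not adjacent to the contracted edge. -/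
def contractCertTwo : Cert :=
  .split 6 7 (.split 1 5 (.split 2 6 (.split 3 7 (.split 4 6 (.split 5 7 (.split 1 3 (.split 4 7
    (.split 2 3 (.split 4 5 (.model [0, 4] [[1], [3], [2], [6], [7], [5]]) (.split 2 5 (.model
    [3, 7] [[0], [1], [5], [2], [6], [4]]) (.split 3 5 (.split 5 6 (.split 2 4 (.model [2, 3]
    [[0], [1], [5], [6], [7], [4]]) (.split 3 4 (.model [2, 3] [[0], [1], [5], [6], [7], [4]])
    .bad)) .bad) .bad))) (.split 2 5 (.split 3 6 (.split 2 7 (.model [0, 2] [[1], [3], [6], [4],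
    [7], [5]]) (.split 2 4 (.split 1 4 (.model [1, 4] [[0], [2], [5], [7], [6], [3]]) (.split 1
    2 (.model [2, 6] [[0], [3], [1], [5], [7], [4]]) .bad)) .bad)) (.split 3 4 (.split 5 6
    (.split 3 5 (.split 1 4 (.model [1, 5] [[0], [2], [6], [4], [7], [3]]) (.split 1 2 (.model
    [3, 5] [[0], [1], [2], [6], [7], [4]]) .bad)) .bad) .bad) .bad)) (.split 2 4 (.split 2 7
    (.split 5 6 (.model [3, 7] [[0], [1], [5], [6], [2], [4]]) (.split 4 5 (.model [3, 7] [[0],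
    [1], [5], [4], [6], [2]]) .bad)) .bad) .bad))) (.split 2 7 (.split 3 4 (.split 4 5 (.model
    [3, 7] [[0], [1], [5], [4], [6], [2]]) (.split 2 4 (.split 3 5 (.model [3, 4] [[0], [1],
    [5], [7], [6], [2]]) (.split 2 5 (.model [0, 2] [[1], [3], [4], [6], [7], [5]]) .bad))
    .bad)) (.split 2 4 (.split 4 5 (.split 3 5 (.model [4, 5] [[0], [1], [3], [7], [6], [2]])
    (.split 2 3 (.split 3 6 (.split 2 5 .bad (.split 5 6 (.model [3, 6] [[0], [1], [5], [7],
    [2], [4]]) .bad)) .bad) .bad)) .bad) .bad)) .bad)) (.split 1 4 (.split 1 2 (.split 3 6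
    (.split 4 5 (.model [4, 6] [[0], [2], [1], [5], [7], [3]]) (.split 2 5 (.model [2, 6] [[0],
    [3], [7], [5], [1], [4]]) (.split 5 6 (.model [2, 6] [[0], [3], [7], [5], [1], [4]]) .bad)))
    (.split 5 6 (.split 3 4 (.model [4, 6] [[0], [2], [1], [5], [7], [3]]) (.split 2 3 (.model
    [2, 6] [[0], [3], [7], [5], [1], [4]]) .bad)) .bad)) .bad) .bad)) (.split 4 7 (.split 2 7
    (.split 5 6 (.split 1 3 (.split 4 5 (.model [0, 4] [[1], [3], [7], [2], [6], [5]]) (.split 2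
    5 (.model [0, 2] [[1], [3], [7], [4], [6], [5]]) .bad)) (.split 1 4 (.split 1 2 (.split 4 5
    (.split 3 4 (.model [4] [[0], [1], [5], [6], [7], [3]]) (.split 2 3 (.model [0, 4] [[1],
    [2], [3], [7], [6], [5]]) (.split 3 6 (.model [0, 4] [[1], [2], [7], [3], [6], [5]]) .bad)))
    (.split 2 5 (.split 3 5 (.model [0, 2] [[1], [4], [6], [7], [3], [5]]) .bad) .bad)) .bad)
    .bad)) (.split 2 5 (.split 4 5 (.split 3 5 (.split 3 6 (.split 1 2 (.model [0, 3] [[1], [2],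
    [6], [7], [4], [5]]) (.split 1 3 (.model [0, 2] [[1], [3], [6], [7], [4], [5]]) .bad)) .bad)
    .bad) .bad) .bad)) .bad) .bad)) (.split 5 6 (.split 3 6 (.split 4 7 (.split 2 4 (.split 1 2
    (.split 4 5 (.model [2, 6] [[0], [1], [5], [4], [7], [3]]) (.split 3 4 (.split 2 5 (.model
    [2, 4] [[0], [1], [5], [6], [7], [3]]) (.split 3 5 (.model [0, 3] [[1], [2], [4], [7], [6],
    [5]]) .bad)) .bad)) (.split 1 3 (.split 1 4 (.split 5 7 (.model [4, 7] [[0], [2], [6], [5],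
    [1], [3]]) (.split 2 7 (.split 3 5 (.model [0, 3] [[1], [4], [2], [7], [6], [5]]) (.split 4
    5 (.model [4, 7] [[0], [2], [6], [5], [1], [3]]) .bad)) .bad)) .bad) .bad)) (.split 3 4
    (.split 4 5 (.split 1 3 (.split 2 7 (.model [3, 6] [[0], [1], [5], [4], [7], [2]]) (.split 2
    3 (.model [3] [[0], [1, 5], [4], [7], [6], [2]]) .bad)) (.split 1 2 (.split 1 4 (.split 2 7
    (.model [4, 7] [[0], [2], [1], [5], [6], [3]]) (.split 2 5 (.model [4, 5] [[0], [1], [2],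
    [6], [7], [3]]) .bad)) .bad) .bad)) .bad) .bad)) (.split 3 4 (.split 2 4 (.split 2 7 (.split
    4 5 (.split 5 7 (.split 1 2 (.model [2, 4] [[0], [1], [5], [6], [7], [3]]) (.split 1 3
    (.model [3, 4] [[0], [1], [5], [6], [7], [2]]) .bad)) .bad) .bad) .bad) .bad) .bad)) .bad)
    .bad)) (.split 5 7 (.split 4 7 (.split 2 7 (.split 3 6 (.split 3 4 (.split 1 4 (.split 3 5
    (.model [4, 7] [[0], [1], [5], [3], [6], [2]]) (.split 2 3 (.split 4 5 (.model [3, 4] [[0],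
    [1], [5], [7], [6], [2]]) (.split 2 5 (.model [0, 2] [[1], [4], [3], [6], [7], [5]]) .bad))
    .bad)) (.split 1 2 (.split 1 3 (.split 5 6 (.model [3, 6] [[0], [2], [1], [5], [7], [4]])
    (.split 4 6 (.split 2 5 (.model [0, 2] [[1], [3], [4], [6], [7], [5]]) (.split 3 5 (.model
    [3, 6] [[0], [2], [1], [5], [7], [4]]) .bad)) .bad)) .bad) .bad)) (.split 2 3 (.split 3 5
    (.split 1 2 (.split 4 6 (.model [2, 7] [[0], [1], [5], [3], [6], [4]]) (.split 2 4 (.model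
    [2] [[0], [1, 5], [3], [6], [7], [4]]) .bad)) (.split 1 4 (.split 1 3 (.split 4 6 (.model
    [3, 6] [[0], [2], [7], [5], [1], [4]]) (.split 4 5 (.model [3, 5] [[0], [1], [4], [7], [6],
    [2]]) .bad)) .bad) .bad)) .bad) .bad)) (.split 2 3 (.split 3 4 (.split 4 6 (.split 3 5
    (.split 5 6 (.split 1 4 (.model [3, 4] [[0], [1], [5], [6], [7], [2]]) (.split 1 2 (.model
    [2, 3] [[0], [1], [5], [6], [7], [4]]) .bad)) .bad) .bad) .bad) .bad) .bad)) .bad) .bad)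
    .bad)) (.split 3 6 (.split 4 6 (.split 5 6 (.split 2 7 (.split 2 3 (.split 1 3 (.split 4 7
    (.split 2 5 (.model [3, 6] [[0], [1], [5], [2], [7], [4]]) (.split 2 4 (.split 3 5 (.model
    [2, 3] [[0], [1], [5], [6], [7], [4]]) (.split 4 5 (.model [0, 4] [[1], [3], [2], [7], [6],
    [5]]) .bad)) .bad)) (.split 3 7 (.split 5 7 (.split 3 4 (.model [1, 3] [[0], [2], [7], [5],
    [6], [4]]) (.split 2 4 (.model [3, 6] [[0], [1], [5], [7], [2], [4]]) .bad)) .bad) .bad))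
    (.split 1 4 (.split 1 2 (.split 5 7 (.split 2 4 (.model [2, 7] [[0], [3], [6], [5], [1],
    [4]]) (.split 2 5 (.split 4 7 (.model [2, 7] [[0], [3], [6], [5], [1], [4]]) (.split 3 4
    (.model [2, 3] [[0], [1], [5], [7], [6], [4]]) .bad)) .bad)) (.split 4 7 (.split 3 7 (.split
    4 5 (.model [0, 4] [[1], [2], [3], [7], [6], [5]]) (.split 2 5 (.model [2, 7] [[0], [3],
    [6], [5], [1], [4]]) .bad)) .bad) .bad)) .bad) .bad)) (.split 2 4 (.split 2 5 (.split 3 7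
    (.split 1 4 (.model [4, 6] [[0], [1], [5], [2], [7], [3]]) (.split 1 2 (.split 1 3 (.model
    [2, 7] [[0], [3], [1], [5], [6], [4]]) .bad) .bad)) (.split 3 4 (.split 4 7 (.split 5 7
    (.split 3 5 (.split 1 4 (.model [1, 4] [[0], [2], [5], [7], [6], [3]]) (.split 1 2 (.model
    [2, 4] [[0], [1], [5], [7], [6], [3]]) .bad)) .bad) .bad) .bad) .bad)) .bad) .bad)) (.split
    2 3 (.split 2 4 (.split 4 7 (.split 3 7 (.split 2 5 (.split 5 7 (.split 1 3 (.model [2, 3]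
    [[0], [1], [5], [6], [7], [4]]) (.split 1 4 (.model [2, 4] [[0], [1], [5], [6], [7], [3]])
    .bad)) .bad) .bad) .bad) .bad) .bad) .bad)) .bad) .bad) .bad)) (.split 0 5 (.split 1 2
    (.split 1 3 (.split 1 4 (.split 5 6 (.split 2 7 (.split 4 7 (.split 4 6 (.split 3 5 (.model
    [0, 4] [[1], [2], [7], [6], [5], [3]]) (.split 5 7 (.split 3 6 (.model [0, 4] [[1], [2],
    [7], [5], [6], [3]]) (.split 2 3 (.model [0, 5] [[1], [3], [2], [7], [6], [4]]) .bad))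
    (.split 4 5 (.split 3 7 (.split 2 5 (.model [0, 4] [[1], [2], [5], [6], [7], [3]]) .bad)
    .bad) .bad))) (.split 2 6 (.split 3 6 (.split 5 7 (.model [0, 2] [[1], [3], [6], [5], [7],
    [4]]) (.split 3 7 (.split 4 5 (.model [0, 2] [[1], [3], [7], [6], [5], [4]]) (.split 2 5
    (.model [0, 3] [[1], [2], [5], [6], [7], [4]]) .bad)) .bad)) .bad) .bad)) (.split 3 7
    (.split 5 7 (.split 4 6 (.split 3 4 (.model [0, 5] [[1], [2], [7], [6], [4], [3]]) (.split 2
    4 (.model [0, 5] [[1], [2], [4], [6], [7], [3]]) .bad)) (.split 3 6 (.split 4 5 (.model [0,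
    3] [[1], [2], [7], [6], [5], [4]]) .bad) .bad)) .bad) .bad)) (.split 3 7 (.split 4 7 (.split
    5 7 (.split 2 6 (.split 2 3 (.model [0, 5] [[1], [3], [2], [6], [7], [4]]) (.split 2 4
    (.model [0, 5] [[1], [3], [7], [6], [2], [4]]) .bad)) (.split 4 6 (.split 2 5 (.model [0, 4]
    [[1], [2], [5], [6], [7], [3]]) .bad) .bad)) .bad) .bad) .bad)) (.split 2 6 (.split 4 6
    (.split 5 7 (.split 3 6 (.split 4 5 (.split 3 7 (.model [0, 3] [[1], [2], [6], [7], [5],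
    [4]]) (.split 2 7 (.model [0, 2] [[1], [3], [6], [7], [5], [4]]) .bad)) (.split 3 5 (.split
    2 5 (.split 4 7 (.model [0, 4] [[1], [2], [5], [7], [6], [3]]) (.split 3 7 (.model [0, 3]
    [[1], [2], [5], [7], [6], [4]]) .bad)) .bad) .bad)) .bad) (.split 4 5 (.split 2 5 (.split 3
    7 (.split 4 7 (.model [1, 4] [[0], [3], [7], [6], [2], [5]]) .bad) .bad) .bad) .bad)) .bad)
    .bad)) .bad) .bad) .bad) .bad)) (.split 5 6 (.split 2 6 (.split 3 7 (.split 4 7 (.split 5 7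
    (.split 4 6 (.split 3 6 (.split 2 7 (.split 1 5 (.split 1 3 (.split 1 2 (.model [2, 6] [[0],
    [3], [1], [5], [7], [4]]) (.split 1 4 (.model [3, 6] [[0], [2], [7], [5], [1], [4]]) .bad))
    (.split 1 4 (.split 1 2 (.model [2, 6] [[0], [3], [7], [5], [1], [4]]) .bad) .bad)) (.split
    1 4 (.split 1 2 (.split 0 5 (.model [0, 3] [[1], [2], [6], [5], [7], [4]]) .bad) .bad)
    .bad)) .bad) .bad) .bad) .bad) .bad) .bad) .bad) .bad)

theorem contractCertFull_check : contractCertFull.check 8 (contractFew 5) (contractOne 5)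
    (maskOf [(0, 1), (7, 2), (7, 3), (7, 4), (7, 5), (7, 6), (0, 2), (0, 3), (0, 4)])
    (maskOf [(0, 7), (1, 7)]) = true := by
  decide +kernel

theorem contractCertMiss_check : contractCertMiss.check 8 (contractFew 5) (contractOne 5)
    (maskOf [(0, 1), (7, 2), (7, 3), (7, 4), (7, 5), (0, 2), (0, 3)])
    (maskOf [(7, 6), (0, 7), (1, 7)]) = true := by
  decide +kernel

theorem contractCertTwo_check : contractCertTwo.check 8 (contractFew 4) (contractOne 4)
    (maskOf [(0, 1), (0, 2), (0, 3), (0, 4)])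
    (maskOf [(0, 6), (0, 7), (1, 6), (1, 7)]) = true := by
  decide +kernel

end SmallGraphs

section Separation

open scoped Classical

variable {V : Type*}

/-- `A`, `T`, `B` partition the vertex set, `A` and `B` are nonempty, and no edge joins `A`
and `B`. -/
structure IsSep (G : SimpleGraph V) (A T B : Finset V) : Prop where
  left : A.Nonempty
  right : B.Nonempty
  cover : ∀ v, v ∈ A ∨ v ∈ T ∨ v ∈ B
  notMem_T : ∀ v ∈ A, v ∉ T
  notMem_B : ∀ v ∈ A, v ∉ B
  disj : ∀ v ∈ T, v ∉ B
  not_adj : ∀ a ∈ A, ∀ b ∈ B, ¬ G.Adj a b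

theorem IsSep.symm {G : SimpleGraph V} {A T B : Finset V} (h : IsSep G A T B) :
    IsSep G B T A where
  left := h.right
  right := h.left
  cover v := by have := h.cover v; tauto
  notMem_T v hv hv' := h.disj v hv' hv
  notMem_B v hv hv' := h.notMem_B v hv' hv
  disj v hv hv' := h.notMem_T v hv' hv
  not_adj a ha b hb hab := h.not_adj b hb a ha hab.symm

variable [Fintype V]

/-- 4-connectivity of a finite graph in terms of separations. -/
def Conn4 (G : SimpleGraph V) : Prop :=
  5 ≤ Fintype.card V ∧ ∀ A T B, IsSep G A T B → 4 ≤ T.card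

theorem Conn4.of_fourConnected {G : SimpleGraph V} (h : FourConnected G) : Conn4 G := by
  refine ⟨by simpa using h.1, fun A T B hs => ?_⟩
  by_contra hT
  have hc := h.2 (T : Set V) (by rw [Set.ncard_coe_finset]; omega)
  have := (induce_connected_iff.1 hc).2 A (fun v hv => by simpa using hs.notMem_T v hv)
    (by simpa using hs.left) ?_
  · obtain ⟨b, hb⟩ := hs.right
    have hbA := this (show b ∈ (T : Set V)ᶜ from fun hbT => hs.disj b hbT hb)
    exact hs.notMem_B b hbA hb
  · intro a ha b hb hab
    rcases hs.cover b with h | h | h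
    · exact h
    · exact (hb h).elim
    · exact (hs.not_adj a ha b h hab).elim

variable {G : SimpleGraph V}

/-- A set of vertices with all outside neighbours in `C` and some vertex beyond forces `C` to have
at least four elements. -/
theorem Conn4.four_le (hc : Conn4 G) {A C : Finset V} (hA : A.Nonempty)
    (hN : ∀ a ∈ A, ∀ v, G.Adj a v → v ∈ A ∨ v ∈ C) {b : V} (hbA : b ∉ A) (hbC : b ∉ C) :
    4 ≤ C.card := by
  refine (hc.2 A (C \ A) (Finset.univ \ (A ∪ C)) ⟨hA, ⟨b, by simp [hbA, hbC]⟩, ?_, ?_, ?_, ?_,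
    ?_⟩).trans (Finset.card_le_card Finset.sdiff_subset)
  · intro v; simp; tauto
  · intro v hv; simp [hv]
  · intro v hv; simp [hv]
  · intro v hv; simp at *; tauto
  · intro a ha b hb hab
    have := hN a ha b hab
    simp at hb
    tauto

theorem Conn4.four_le_degree (hc : Conn4 G) (v : V) : 4 ≤ G.degree v := by
  by_cases h : ∃ b, b ≠ v ∧ ¬ G.Adj v b
  · obtain ⟨b, hb, hvb⟩ := h
    have := hc.four_le (A := {v}) (C := G.neighborFinset v) (by simp)
      (by simp +contextual) (b := b) (by simpa using hb) (by simpa using hvb)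
    simpa using this
  · push Not at h
    have e : G.neighborFinset v = Finset.univ.erase v := by
      ext w
      simp only [mem_neighborFinset, Finset.mem_erase, Finset.mem_univ, and_true]
      exact ⟨fun h => h.ne', h w⟩
    rw [← card_neighborFinset_eq_degree, e, Finset.card_erase_of_mem (Finset.mem_univ _),
      Finset.card_univ]
    have := hc.1
    omega

theorem IsSep.exists_adj (hc : Conn4 G) {A T B : Finset V} (h : IsSep G A T B) (hT : T.card = 4)
    {t : V} (ht : t ∈ T) : ∃ a ∈ A, G.Adj t a := by
  by_contra hn
  push Not at hn
  obtain ⟨b, hb⟩ := h.right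
  have := hc.four_le (A := A) (C := T.erase t) h.left ?_ (b := b) (fun h' => h.notMem_B b h' hb)
    (fun h' => h.disj b (Finset.mem_of_mem_erase h') hb)
  · rw [Finset.card_erase_of_mem ht] at this
    omega
  · intro a ha v hav
    rcases h.cover v with h' | h' | h'
    · exact Or.inl h'
    · refine Or.inr (Finset.mem_erase.2 ⟨?_, h'⟩)
      rintro rfl
      exact hn a ha hav.symm
    · exact (h.not_adj a ha v h' hav).elim

end Separation

section Contraction

open scoped Classical

variable {V : Type*}

/-- The projection of the vertex set onto the vertex set of the contraction of `S`. -/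
noncomputable def proj (S : Finset V) (v : V) : Option {v : V // v ∉ S} :=
  if h : v ∈ S then none else some ⟨v, h⟩

/-- The graph obtained by identifying the vertices in `S` to a single vertex `none`. -/
def contract (G : SimpleGraph V) (S : Finset V) : SimpleGraph (Option {v : V // v ∉ S}) where
  Adj a b := a ≠ b ∧ ∃ u v, proj S u = a ∧ proj S v = b ∧ G.Adj u v
  symm := ⟨fun _ _ ⟨h, u, v, hu, hv, huv⟩ => ⟨h.symm, v, u, hv, hu, huv.symm⟩⟩
  loopless := ⟨fun _ h => h.1 rfl⟩

variable {G : SimpleGraph V} {S : Finset V}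

theorem proj_eq_none {v : V} : proj S v = none ↔ v ∈ S := by
  unfold proj; split_ifs <;> simp_all

theorem proj_eq_some {v : V} {w : {v : V // v ∉ S}} : proj S v = some w ↔ v = w := by
  unfold proj
  split_ifs with h
  · simp only [false_iff]
    rintro rfl
    exact w.2 h
  · simp [Subtype.ext_iff]

theorem contract_adj_some {v w : {v : V // v ∉ S}} :
    (contract G S).Adj (some v) (some w) ↔ G.Adj v w := by
  simp only [contract, proj_eq_some]
  constructor
  · rintro ⟨-, u, v, rfl, rfl, h⟩
    exact h
  · intro h
    exact ⟨fun e => h.ne (congrArg Subtype.val (Option.some.inj e)), v, w, rfl, rfl, h⟩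

theorem contract_adj_none {w : {v : V // v ∉ S}} :
    (contract G S).Adj none (some w) ↔ ∃ s ∈ S, G.Adj s w := by
  simp only [contract, proj_eq_some, proj_eq_none]
  constructor
  · rintro ⟨-, u, v, hu, rfl, h⟩
    exact ⟨u, hu, h⟩
  · rintro ⟨s, hs, h⟩
    exact ⟨by simp, s, w, hs, rfl, h⟩

theorem proj_surjective (hS : S.Nonempty) : Function.Surjective (proj S) := by
  rintro (_ | w)
  · obtain ⟨s, hs⟩ := hS
    exact ⟨s, proj_eq_none.2 hs⟩
  · exact ⟨w, proj_eq_some.2 rfl⟩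

theorem isMinorOf_of_contract {W : Type*} {H : SimpleGraph W} (hS : S.Nonempty)
    (hcl : ∀ u ∈ S, ∀ v ∈ S, u ≠ v → G.Adj u v) (h : H.IsMinorOf (contract G S)) :
    H.IsMinorOf G := by
  obtain ⟨φ, hne, hconn, hd, he⟩ := h
  have hsurj := proj_surjective hS
  refine ⟨fun w => proj S ⁻¹' φ w, fun w => (hne w).preimage hsurj, fun w => ?_,
    fun w₁ w₂ h => (hd h).preimage _, fun w₁ w₂ h => ?_⟩
  · rw [induce_connected_iff]
    refine ⟨(hne w).preimage hsurj, fun Y hY hYne hYcl => ?_⟩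
    have hsat : ∀ u ∈ Y, ∀ v, proj S u = proj S v → v ∈ Y := by
      intro u hu v huv
      by_cases e : u = v
      · exact e ▸ hu
      have : proj S v ∈ φ w := huv ▸ hY hu
      rcases hv : proj S v with _ | v'
      · rw [hv] at huv
        exact hYcl u hu v this (hcl u (proj_eq_none.1 huv) v (proj_eq_none.1 hv) e)
      · rw [hv] at huv
        exact (e ((proj_eq_some.1 huv).trans (proj_eq_some.1 hv).symm)).elim
    have key := (induce_connected_iff.1 (hconn w)).2 (proj S '' Y)
      (by rintro _ ⟨y, hy, rfl⟩; exact hY hy) (hYne.image _) ?_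
    · intro v hv
      obtain ⟨u, hu, huv⟩ := key hv
      exact hsat u hu v huv
    · rintro _ ⟨y, hy, rfl⟩ b hb ⟨-, u, v, hu, rfl, huv⟩
      exact ⟨v, hYcl u (hsat y hy u hu.symm) v hb huv, rfl⟩
  · obtain ⟨a, ha, b, hb, -, u, v, rfl, rfl, huv⟩ := he h
    exact ⟨u, ha, v, hb, huv⟩

variable [Fintype V]

theorem card_contract : Fintype.card (Option {v : V // v ∉ S}) + S.card = Fintype.card V + 1 := by
  have h : Fintype.card {v : V // v ∉ S} = Fintype.card V - S.card := by
    simp [Fintype.card_subtype_compl]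
  have := S.card_le_univ
  rw [Fintype.card_option, h]
  omega

theorem Conn4.contract (hc : Conn4 G) (hS : S.Nonempty)
    (hcard : S.card + 4 ≤ Fintype.card V)
    (h : ∀ A T B, IsSep G A T B → S ⊆ T → S.card + 3 ≤ T.card) : Conn4 (contract G S) := by
  refine ⟨by have := card_contract (S := S); omega, fun A T B hs => ?_⟩
  have hsurj := proj_surjective hS
  have pull : ∀ {A : Finset (Option {v : V // v ∉ S})}, A.Nonempty →
      (Finset.univ.filter fun v => proj S v ∈ A).Nonempty := by
    rintro A ⟨a, ha⟩
    obtain ⟨v, rfl⟩ := hsurj a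
    exact ⟨v, by simpa using ha⟩
  have hs' : IsSep G (Finset.univ.filter fun v => proj S v ∈ A)
      (Finset.univ.filter fun v => proj S v ∈ T) (Finset.univ.filter fun v => proj S v ∈ B) := by
    refine ⟨pull hs.left, pull hs.right, fun v => ?_, fun v => ?_, fun v => ?_, fun v => ?_,
      fun a ha b hb hab => ?_⟩
    · simpa using hs.cover (proj S v)
    · simpa using hs.notMem_T (proj S v)
    · simpa using hs.notMem_B (proj S v)
    · simpa using hs.disj (proj S v)
    · simp only [Finset.mem_filter, Finset.mem_univ, true_and] at ha hb
      refine hs.not_adj _ ha _ hb ⟨?_, a, b, rfl, rfl, hab⟩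
      intro e
      exact hs.notMem_B _ ha (e ▸ hb)
  have hle : ∀ v, proj S v ∈ T → v ∈ S ∨ v ∈ T.eraseNone.map (Function.Embedding.subtype _) := by
    intro v hv
    rcases hp : proj S v with _ | w
    · exact Or.inl (proj_eq_none.1 hp)
    · rw [hp] at hv
      exact Or.inr (Finset.mem_map.2 ⟨w, by simpa using hv, (proj_eq_some.1 hp).symm⟩)
  by_cases hT : none ∈ T
  · have h1 := h _ _ _ hs' fun v hv => by simpa [proj_eq_none.2 hv] using hT
    have h2 : (Finset.univ.filter fun v => proj S v ∈ T) ⊆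
        S ∪ T.eraseNone.map (Function.Embedding.subtype _) := fun v hv =>
      Finset.mem_union.2 (hle v (by simpa using hv))
    have h3 := (Finset.card_le_card h2).trans (Finset.card_union_le _ _)
    rw [Finset.card_map, Finset.card_eraseNone_of_mem hT] at h3
    have : 0 < T.card := Finset.card_pos.2 ⟨_, hT⟩
    omega
  · have h1 := hc.2 _ _ _ hs'
    have h2 : (Finset.univ.filter fun v => proj S v ∈ T) ⊆
        T.eraseNone.map (Function.Embedding.subtype _) := fun v hv => by
      rw [Finset.mem_filter] at hv
      refine (hle v hv.2).resolve_left fun hvS => hT ?_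
      rw [← proj_eq_none.2 hvS]
      exact hv.2
    have h3 := Finset.card_le_card h2
    rw [Finset.card_map, Finset.card_eraseNone_of_not_mem hT] at h3
    omega

end Contraction

section Pairs

open scoped Classical

variable {V : Type*} {G : SimpleGraph V}

/-- The neighbourhood of `q` is `{a, b, c, d}`. -/
def Nbr4 (G : SimpleGraph V) (q a b c d : V) : Prop :=
  ∀ v, G.Adj q v ↔ v = a ∨ v = b ∨ v = c ∨ v = d

/-- Every edge lies in a separator with four elements. -/
def Critical (G : SimpleGraph V) : Prop :=
  ∀ x y, G.Adj x y → ∃ A T B, IsSep G A T B ∧ T.card = 4 ∧ x ∈ T ∧ y ∈ T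

/-- The two vertices `s` and `z` have all their other neighbours in the 4-element set `T`. -/
structure IsPair (G : SimpleGraph V) (s z : V) (T : Finset V) : Prop where
  ne : s ≠ z
  card : T.card = 4
  left_notMem : s ∉ T
  right_notMem : z ∉ T
  left_nbr : ∀ v, G.Adj s v → v = z ∨ v ∈ T
  right_nbr : ∀ v, G.Adj z v → v = s ∨ v ∈ T

theorem IsPair.symm {s z : V} {T : Finset V} (h : IsPair G s z T) : IsPair G z s T :=
  ⟨h.ne.symm, h.card, h.right_notMem, h.left_notMem, h.right_nbr, h.left_nbr⟩

variable [Fintype V]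

theorem Conn4.nbr4 (hc : Conn4 G) {q a b c d : V}
    (h : ∀ v, G.Adj q v → v = a ∨ v = b ∨ v = c ∨ v = d) : Nbr4 G q a b c d := by
  have h1 : G.neighborFinset q ⊆ {a, b, c, d} := fun v hv => by simpa using h v (by simpa using hv)
  have h2 := Finset.eq_of_subset_of_card_le h1
    (Finset.card_le_four.trans (by simpa using hc.four_le_degree q))
  intro v
  rw [← mem_neighborFinset, h2]
  simp

theorem IsPair.exists_outside {s z : V} {T : Finset V} (h : IsPair G s z T)
    (hn : 8 ≤ Fintype.card V) : ∃ g, g ≠ s ∧ g ≠ z ∧ g ∉ T := by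
  by_contra! hg
  have h1 : (Finset.univ : Finset V) ⊆ insert s (insert z T) := fun v _ => by
    by_cases h1 : v = s
    · simp [h1]
    by_cases h2 : v = z
    · simp [h2]
    simp [hg v h1 h2]
  have h2 := (Finset.card_le_card h1).trans (Finset.card_insert_le _ _)
  have h3 := Finset.card_insert_le z T
  have := h.card
  rw [Finset.card_univ] at h2
  omega

/-- The side of a separator containing `s`, `z`, `t` and only one element of `T` is trivial. -/
theorem IsPair.side_subset (hc : Conn4 G) {s z t e a : V} {T A T' B : Finset V}
    (h : IsPair G s z T) (hst : s ≠ t) (hse : s ≠ e) (hsa : s ≠ a) (hs : IsSep G A T' B) (hsT : s ∈ T') (hzT : z ∈ T')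
    (hT' : ∀ v ∈ T', v = s ∨ v = z ∨ v = t ∨ v = e) (ha : ∀ v ∈ T, v ∈ A → v = a) :
    ∀ v ∈ A, v = a := by
  by_contra! hv
  obtain ⟨v, hvA, hva⟩ := hv
  have := hc.four_le (A := A \ T) (C := {t, e, a}) (b := s)
    ⟨v, Finset.mem_sdiff.2 ⟨hvA, fun hvT => hva (ha v hvT hvA)⟩⟩ ?_ ?_ ?_
  · have := Finset.card_le_three (a := t) (b := e) (c := a)
    omega
  · intro x hx y hxy
    rw [Finset.mem_sdiff] at hx ⊢
    simp only [Finset.mem_insert, Finset.mem_singleton]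
    rcases hs.cover y with hy | hy | hy
    · by_cases hyT : y ∈ T
      · have := ha y hyT hy
        tauto
      · tauto
    · rcases hT' y hy with rfl | rfl | h' | h'
      · rcases h.left_nbr x hxy.symm with rfl | h'
        exacts [(hs.notMem_T _ hx.1 hzT).elim, (hx.2 h').elim]
      · rcases h.right_nbr x hxy.symm with rfl | h'
        exacts [(hs.notMem_T _ hx.1 hsT).elim, (hx.2 h').elim]
      · tauto
      · tauto
    · exact (hs.not_adj x hx.1 y hy hxy).elim
  · intro h'
    exact hs.notMem_T s (Finset.mem_sdiff.1 h').1 hsT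
  · simp [hst, hse, hsa]

theorem IsPair.exists_partner (hc : Conn4 G) (hcrit : Critical G) (hn : 8 ≤ Fintype.card V)
    {s z t : V} {T : Finset V} (h : IsPair G s z T) (ht : t ∈ T) (hst : G.Adj s t)
    (hsub : ∀ v ∈ T, v ≠ t → G.Adj s v → G.Adj z v) :
    ∃ t₁ ∈ T, t₁ ≠ t ∧ ∃ e, e ∉ T ∧ e ≠ s ∧ e ≠ z ∧ Nbr4 G t₁ s z t e := by
  obtain ⟨A, T', B, hs, hT', hsT, htT⟩ := hcrit s t hst
  have hz : ∀ A B, IsSep G A T' B → z ∉ A := by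
    intro A B hs hzA
    obtain ⟨b, hb, hsb⟩ := hs.symm.exists_adj hc hT' hsT
    rcases h.left_nbr b hsb with rfl | hbT
    · exact hs.notMem_B _ hzA hb
    · have hbt : b ≠ t := fun e => hs.disj t htT (e ▸ hb)
      exact hs.not_adj z hzA b hb (hsub b hbT hbt hsb)
  have hzT : z ∈ T' := by
    have h1 := hz A B hs
    have h2 := hz B A hs.symm
    have := hs.cover z
    tauto
  have hsz := h.ne
  have htz : t ≠ z := fun e => h.right_notMem (e ▸ ht)
  obtain ⟨e, he⟩ : ∃ e, T' \ {s, z, t} = {e} := by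
    rw [← Finset.card_eq_one, Finset.card_sdiff_of_subset, hT', Finset.card_eq_three.2]
    · exact ⟨s, z, t, hsz, hst.ne, htz.symm, rfl⟩
    · intro v hv
      simp only [Finset.mem_insert, Finset.mem_singleton] at hv
      rcases hv with rfl | rfl | rfl <;> assumption
  have hmem : ∀ v, v ∈ T' ↔ v = s ∨ v = z ∨ v = t ∨ v = e := by
    intro v
    have := congrArg (v ∈ ·) he
    simp only [Finset.mem_sdiff, Finset.mem_insert, Finset.mem_singleton, eq_iff_iff] at this
    constructor
    · tauto
    · rintro (rfl | rfl | rfl | h') <;> tauto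
  have heT' : e ∈ T' ∧ e ≠ s ∧ e ≠ z ∧ e ≠ t := by
    have : e ∈ T' \ {s, z, t} := by simp [he]
    simpa using this
  obtain ⟨-, hes, hez, het⟩ := heT'
  have side : ∀ A B, IsSep G A T' B → ∃ a ∈ A, a ∈ T ∧
      ((T.filter (· ∈ A)).card ≤ 1 → ∀ v ∈ A, v = a) := by
    intro A B hs
    obtain ⟨a, ha, hsa⟩ := hs.exists_adj hc hT' hsT
    have haT : a ∈ T := (h.left_nbr a hsa).resolve_left fun e => hs.notMem_T a ha (e ▸ hzT)
    refine ⟨a, ha, haT, fun hle => ?_⟩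
    refine h.side_subset hc (t := t) (e := e) hst.ne hes.symm hsa.ne hs hsT hzT
      (fun v => (hmem v).1) fun v hv hvA => ?_
    exact Finset.card_le_one.1 hle v (by simp [hv, hvA]) a (by simp [haT, ha])
  have fin : ∀ A B, IsSep G A T' B → e ∉ T → (T.filter (· ∈ A)).card ≤ 1 →
      ∃ t₁ ∈ T, t₁ ≠ t ∧ ∃ e, e ∉ T ∧ e ≠ s ∧ e ≠ z ∧ Nbr4 G t₁ s z t e := by
    intro A B hs heT hle
    obtain ⟨a, ha, haT, hA⟩ := side A B hs
    refine ⟨a, haT, fun e => hs.notMem_T a ha (e ▸ htT), e, heT, hes, hez, hc.nbr4 fun v hv => ?_⟩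
    rw [← hmem]
    rcases hs.cover v with h' | h' | h'
    · exact (hv.ne (hA hle v h').symm).elim
    · exact h'
    · exact (hs.not_adj a ha v h' hv).elim
  have hsum : (T.filter (· ∈ A)).card + (T.filter (· ∈ B)).card + (T.filter (· ∈ T')).card
      ≤ 4 := by
    rw [← h.card, ← Finset.card_union_of_disjoint, ← Finset.card_union_of_disjoint]
    · refine Finset.card_le_card fun v hv => ?_
      simp only [Finset.mem_union, Finset.mem_filter] at hv
      tauto
    · rw [Finset.disjoint_left]
      intro v hv hv'
      simp only [Finset.mem_union, Finset.mem_filter] at hv hv'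
      rcases hv with hv | hv
      · exact hs.notMem_T v hv.2 hv'.2
      · exact hs.disj v hv'.2 hv.2
    · rw [Finset.disjoint_left]
      intro v hv hv'
      simp only [Finset.mem_filter] at hv hv'
      exact hs.notMem_B v hv.2 hv'.2
  by_cases heT : e ∈ T
  · have h2 : 2 ≤ (T.filter (· ∈ T')).card := by
      rw [← Finset.card_pair het]
      refine Finset.card_le_card fun v hv => ?_
      simp only [Finset.mem_insert, Finset.mem_singleton] at hv
      rcases hv with rfl | rfl <;> simp [*]
    obtain ⟨a, ha, haT, hA⟩ := side A B hs
    obtain ⟨b, hb, hbT, hB⟩ := side B A hs.symm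
    have ha1 : 0 < (T.filter (· ∈ A)).card := Finset.card_pos.2 ⟨a, by simp [*]⟩
    have hb1 : 0 < (T.filter (· ∈ B)).card := Finset.card_pos.2 ⟨b, by simp [*]⟩
    have hall : (Finset.univ : Finset V) ⊆ insert a (insert b T') := by
      intro v _
      simp only [Finset.mem_insert]
      rcases hs.cover v with h' | h' | h'
      · exact Or.inl (hA (by omega) v h')
      · exact Or.inr (Or.inr h')
      · exact Or.inr (Or.inl (hB (by omega) v h'))
    have h3 := (Finset.card_le_card hall).trans (Finset.card_insert_le _ _)
    have h4 := Finset.card_insert_le b T'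
    rw [Finset.card_univ] at h3
    omega
  · have h1 : 0 < (T.filter (· ∈ T')).card := Finset.card_pos.2 ⟨t, by simp [*]⟩
    by_cases hle : (T.filter (· ∈ A)).card ≤ 1
    · exact fin A B hs heT hle
    · exact fin B A hs.symm heT (by omega)

end Pairs

section PairLemma

open scoped Classical

variable {V : Type*} {G : SimpleGraph V}

theorem iso_cycleSq {f : Fin 8 → V} (hf : Function.Bijective f)
    (h : ∀ i, Nbr4 G (f i) (f (i + 1)) (f (i + 2)) (f (i + 6)) (f (i + 7))) :
    Nonempty (G ≃g cycleSq 8) := by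
  have key : ∀ i j : Fin 8, (j = i + 1 ∨ j = i + 2 ∨ j = i + 6 ∨ j = i + 7) ↔
      (i ≠ j ∧ ((j = i + 1 ∨ j = i + 2) ∨ (i = j + 1 ∨ i = j + 2))) := by decide
  have key' (i j : Fin 8) : G.Adj (f i) (f j) ↔
      (i ≠ j ∧ ((j = i + 1 ∨ j = i + 2) ∨ (i = j + 1 ∨ i = j + 2))) := by
    rw [h i (f j), ← key]
    simp only [hf.1.eq_iff]
  exact ⟨SimpleGraph.Iso.symm ⟨Equiv.ofBijective f hf, fun {i j} => key' i j⟩⟩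

theorem Nbr4.adj {q a b c d : V} (h : Nbr4 G q a b c d) :
    G.Adj q a ∧ G.Adj q b ∧ G.Adj q c ∧ G.Adj q d :=
  ⟨(h a).2 (by simp), (h b).2 (by simp), (h c).2 (by simp), (h d).2 (by simp)⟩

variable [Fintype V]

theorem exists_notMem_list (l : List V) (h : l.length < Fintype.card V) : ∃ v, v ∉ l := by
  by_contra! hl
  have : (Finset.univ : Finset V) ⊆ l.toFinset := fun v _ => by simpa using hl v
  have := (Finset.card_le_card this).trans l.toFinset_card_le
  rw [Finset.card_univ] at this
  omega

theorem mem_list_of_nodup {l : List V} (hl : l.Nodup) (h : Fintype.card V ≤ l.length) (v : V) :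
    v ∈ l := by
  have := Finset.eq_univ_of_card l.toFinset
    (le_antisymm (Finset.card_le_univ _) (by rwa [List.toFinset_card_of_nodup hl]))
  have h' := Finset.mem_univ v
  rw [← this] at h'
  simpa using h'

/-- In a 4-connected graph no small set of vertices is cut off by three vertices. -/
theorem Conn4.false_of_list (hc : Conn4 G) (l : List V) (hl : l ≠ []) {a b c : V}
    (hN : ∀ x ∈ l, ∀ v, G.Adj x v → v ∈ l ∨ v = a ∨ v = b ∨ v = c)
    (hcard : l.length + 3 < Fintype.card V) : False := by
  obtain ⟨g, hg⟩ := exists_notMem_list (l ++ [a, b, c]) (by simpa using hcard)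
  have := hc.four_le (A := l.toFinset) (C := {a, b, c}) (b := g) (by simpa using hl)
    (by simpa using hN) (by simp_all) (by simp_all)
  have := Finset.card_le_three (a := a) (b := b) (c := c)
  omega

/-- Every nonempty set contains a connected component of the subgraph induced on it. -/
theorem exists_connected_closed {X : Finset V} (hX : X.Nonempty) :
    ∃ Y ⊆ X, Y.Nonempty ∧ (G.induce (Y : Set V)).Connected ∧
      ∀ a ∈ Y, ∀ b ∈ X, G.Adj a b → b ∈ Y := by
  obtain ⟨Y, hY, hmin⟩ := Finset.exists_min_image (X.powerset.filter fun Y : Finset V =>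
    Y.Nonempty ∧ ∀ a ∈ Y, ∀ b ∈ X, G.Adj a b → b ∈ Y) Finset.card
    ⟨X, by simp [hX]; tauto⟩
  simp only [Finset.mem_filter, Finset.mem_powerset] at hY hmin
  refine ⟨Y, hY.1, hY.2.1, induce_connected_iff.2 ⟨by simpa using hY.2.1, fun Z hZ hZne hZcl => ?_⟩,
    hY.2.2⟩
  have hZY : Z.toFinset ⊆ Y := fun v hv => hZ (by simpa using hv)
  have := Finset.eq_of_subset_of_card_le hZY (hmin Z.toFinset ⟨hZY.trans hY.1, by simpa using hZne,
    fun a ha b hb hab => ?_⟩)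
  · intro v hv
    have hv' : v ∈ Y := hv
    rw [← this] at hv'
    simpa using hv'
  · have := hY.2.2 a (hZY ha) b hb hab
    simpa using hZcl a (by simpa using ha) b this hab

/-- A pair of adjacent vertices of degree four with exactly two common neighbours. -/
structure TightPair (G : SimpleGraph V) (s z p q r w : V) : Prop where
  nodup : [s, z, p, q, r, w].Nodup
  left : Nbr4 G s z p q r
  right : Nbr4 G z s q r w

omit [Fintype V] in
theorem TightPair.isPair {s z p q r w : V} (h : TightPair G s z p q r w) :
    IsPair G s z {p, q, r, w} := by
  obtain ⟨hd, hl, hr⟩ := h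
  simp only [List.nodup_cons, List.mem_cons, List.not_mem_nil, not_or] at hd
  refine ⟨by tauto, ?_, by simp; tauto, by simp; tauto, fun v hv => ?_, fun v hv => ?_⟩
  · simpa using List.toFinset_card_of_nodup (l := [p, q, r, w]) (by simp; tauto)
  · have := (hl v).1 hv
    simp; tauto
  · have := (hr v).1 hv
    simp; tauto

theorem TightPair.exists_extra (hc : Conn4 G) (hcrit : Critical G) (hn : 8 ≤ Fintype.card V)
    {s z p q r w : V} (h : TightPair G s z p q r w) :
    ∃ e e', [s, z, p, q, r, w, e, e'].Nodup ∧
      ((Nbr4 G q s z p e ∧ Nbr4 G r s z w e') ∨ (Nbr4 G r s z p e ∧ Nbr4 G q s z w e')) := by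
  have hP := h.isPair
  obtain ⟨hd, hl, hr⟩ := h
  obtain ⟨t, ht, htp, e, he, hes, hez, hte⟩ := hP.exists_partner hc hcrit hn (t := p) (by simp)
    ((hl p).2 (by simp)) (fun v hv hvp hsv => by
      rw [hl] at hsv
      rw [hr]
      simp at hv
      grind)
  obtain ⟨t', ht', htw, e', he', hez', hes', hte'⟩ := hP.symm.exists_partner hc hcrit hn (t := w)
    (by simp) ((hr w).2 (by simp)) (fun v hv hvp hsv => by
      rw [hr] at hsv
      rw [hl]
      simp at hv
      grind)
  simp only [Finset.mem_insert, Finset.mem_singleton, not_or] at ht he ht' he'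
  have h1 : t = q ∨ t = r := by
    have := hte.adj.1.symm
    rw [hl] at this
    grind
  have h2 : t' = q ∨ t' = r := by
    have := hte'.adj.1.symm
    rw [hr] at this
    grind
  have h3 : t ≠ t' := by
    rintro rfl
    have := (hte w).1 hte'.adj.2.2.1
    grind
  have hte2 : Nbr4 G t' s z w e' := fun v => by rw [hte' v]; clear * -; tauto
  have h4 : e ≠ e' := by
    rintro rfl
    refine hc.false_of_list [s, z, q, r] (by simp) (a := p) (b := w) (c := e) ?_ (by simp; omega)
    intro x hx v hxv
    have : x = s ∨ x = z ∨ x = t ∨ x = t' := by simp at hx; grind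
    simp only [List.mem_cons, List.not_mem_nil]
    rcases this with rfl | rfl | rfl | rfl
    · rw [hl] at hxv; clear * - hxv; tauto
    · rw [hr] at hxv; clear * - hxv; tauto
    · rw [hte] at hxv; clear * - hxv; tauto
    · rw [hte2] at hxv; clear * - hxv; tauto
  refine ⟨e, e', ?_, ?_⟩
  · clear * - hd he he' h4 hes hez hez' hes'
    simp only [List.nodup_cons, List.mem_cons, List.not_mem_nil, not_or, or_false] at *
    grind
  · rcases h1 with rfl | rfl <;> rcases h2 with rfl | rfl <;> simp_all

end PairLemma

section PairLemma

open scoped Classical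

variable {V : Type*} {G : SimpleGraph V}

theorem Nbr4.congr {q a b c d a' b' c' d' : V} (h : Nbr4 G q a b c d)
    (hp : ∀ v, (v = a ∨ v = b ∨ v = c ∨ v = d) ↔ (v = a' ∨ v = b' ∨ v = c' ∨ v = d')) :
    Nbr4 G q a' b' c' d' := fun v => (h v).trans (hp v)

variable [Fintype V]

theorem TightPair.exists_right (hc : Conn4 G) (hcrit : Critical G) (hn : 8 ≤ Fintype.card V)
    {s z p q r w e e' : V} (h : TightPair G s z p q r w) (hd : [s, z, p, q, r, w, e, e'].Nodup)
    (hq : Nbr4 G q s z p e) : ∃ x, Nbr4 G p q s e x ∧ x ∉ [e, p, z, r, q, s] := by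
  have h' : TightPair G q s e p z r := by
    refine ⟨?_, hq.congr (by clear * -; tauto), h.left.congr (by clear * -; tauto)⟩
    simp only [List.nodup_cons, List.mem_cons, List.not_mem_nil, not_or, or_false] at *
    grind
  obtain ⟨x, y, hxy, ⟨hp, -⟩ | ⟨hz, -⟩⟩ := h'.exists_extra hc hcrit hn
  · refine ⟨x, hp, ?_⟩
    simp only [List.nodup_cons, List.mem_cons, List.not_mem_nil, not_or, or_false] at *
    grind
  · have := (h.right e).1 hz.adj.2.2.1
    simp only [List.nodup_cons, List.mem_cons, List.not_mem_nil, not_or, or_false] at *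
    grind

omit [Fintype V] in
theorem TightPair.symm {s z p q r w : V} (h : TightPair G s z p q r w) :
    TightPair G z s w r q p := by
  refine ⟨?_, h.right.congr (by clear * -; tauto), h.left.congr (by clear * -; tauto)⟩
  have := h.nodup
  simp only [List.nodup_cons, List.mem_cons, List.not_mem_nil, not_or, or_false] at *
  grind

theorem iso_cycleSq_of_list (h8 : Fintype.card V = 8) {a b c d e f g h : V}
    (hd : [a, b, c, d, e, f, g, h].Nodup) (ha : Nbr4 G a b c g h) (hb : Nbr4 G b c d h a)
    (hc : Nbr4 G c d e a b) (hd' : Nbr4 G d e f b c) (he : Nbr4 G e f g c d)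
    (hf : Nbr4 G f g h d e) (hg : Nbr4 G g h a e f) (hh : Nbr4 G h a b f g) :
    Nonempty (G ≃g cycleSq 8) := by
  refine iso_cycleSq (f := ![a, b, c, d, e, f, g, h])
    ((Fintype.bijective_iff_injective_and_card _).2 ⟨fun i j hij => ?_, by simp [h8]⟩) ?_
  · refine List.nodup_iff_injective_get.1 hd ?_
    clear * - hij
    fin_cases i <;> fin_cases j <;> exact hij
  · intro i
    fin_cases i <;> assumption

theorem TightPair.iso_cycleSq (hc : Conn4 G) (h8 : Fintype.card V = 8)
    {s z p q r w e e' x y : V} (h : TightPair G s z p q r w)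
    (hd : [s, z, p, q, r, w, e, e'].Nodup)
    (hq : Nbr4 G q s z p e) (hr : Nbr4 G r s z w e')
    (hp : Nbr4 G p q s e x) (hx : x ∉ [e, p, z, r, q, s])
    (hw : Nbr4 G w r z e' y) (hy : y ∉ [e', w, s, q, r, z]) :
    Nonempty (G ≃g cycleSq 8) := by
  have hs := h.left
  have hz := h.right
  have hall := mem_list_of_nodup hd (by simp [h8])
  have hd' := hd
  simp only [List.nodup_cons, List.mem_cons, List.not_mem_nil, not_or, or_false] at hall hd' hx hy
  have hx' : x = w ∨ x = e' := by
    have := hall x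
    clear * - this hx
    tauto
  have hy' : y = p ∨ y = e := by
    have := hall y
    clear * - this hy
    tauto
  have he1 : ∀ v, G.Adj e v → v = q ∨ v = p ∨ v = w ∨ v = e' := by
    intro v hv
    have h1 := (hs e).1
    have h2 := (hz e).1
    have h3 := (hr e).1
    rcases hall v with rfl | rfl | rfl | rfl | rfl | rfl | rfl | rfl
    · grind [hv.symm]
    · grind [hv.symm]
    · simp
    · simp
    · grind [hv.symm]
    · simp
    · exact (hv.ne rfl).elim
    · simp
  have he2 : ∀ v, G.Adj e' v → v = r ∨ v = w ∨ v = p ∨ v = e := by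
    intro v hv
    have h1 := (hs e').1
    have h2 := (hz e').1
    have h3 := (hq e').1
    rcases hall v with rfl | rfl | rfl | rfl | rfl | rfl | rfl | rfl
    · grind [hv.symm]
    · grind [hv.symm]
    · simp
    · grind [hv.symm]
    · simp
    · simp
    · simp
    · exact (hv.ne rfl).elim
  obtain rfl : x = e' := by
    refine hx'.resolve_left ?_
    rintro rfl
    refine hc.false_of_list [e] (by simp) (a := q) (b := p) (c := e') ?_ (by simp; omega)
    intro a ha v hv
    obtain rfl : a = e := by simpa using ha
    have h2 : v ≠ x := by
      rintro rfl
      have h3 := (hw _).1 hv.symm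
      have h4 := (hw _).1 hp.adj.2.2.2.symm
      grind
    grind
  obtain rfl : y = e := by
    refine hy'.resolve_left ?_
    rintro rfl
    have h4 := (hp _).1 hw.adj.2.2.2.symm
    grind
  have he1 := hc.nbr4 he1
  have he2 := hc.nbr4 he2
  refine iso_cycleSq_of_list h8 (a := q) (b := s) (c := z) (d := r) (e := w) (f := x) (g := y)
    (h := p) ?_ (hq.congr ?_) (hs.congr ?_) (hz.congr ?_) (hr.congr ?_) (hw.congr ?_)
    (he2.congr ?_) (he1.congr ?_) (hp.congr ?_)
  · clear * - hd'
    simp only [List.nodup_cons, List.mem_cons, List.not_mem_nil, not_or, or_false] at *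
    grind
  all_goals clear * -; tauto

theorem TightPair.isMinorOf (hc : Conn4 G) (h9 : 9 ≤ Fintype.card V)
    {s z p q r w e e' : V} (h : TightPair G s z p q r w)
    (hd : [s, z, p, q, r, w, e, e'].Nodup)
    (hq : Nbr4 G q s z p e) (hr : Nbr4 G r s z w e') (hpe : G.Adj p e) (hwe : G.Adj w e') :
    (wheel 6).IsMinorOf G := by
  have hs := h.left
  have hz := h.right
  obtain ⟨g, hg⟩ := exists_notMem_list [s, z, p, q, r, w, e, e'] (by simp; omega)
  obtain ⟨Y, hYX, hYne, hYc, hYcl⟩ := exists_connected_closed (G := G)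
    (X := Finset.univ.filter (· ∉ [s, z, p, q, r, w, e, e'])) ⟨g, by simpa using hg⟩
  have hY : ∀ v ∈ Y, v ∉ [s, z, p, q, r, w, e, e'] := fun v hv => by simpa using hYX hv
  have hN : ∀ v ∈ Y, ∀ u, G.Adj v u → u ∈ Y ∨ u = p ∨ u = w ∨ u = e ∨ u = e' := by
    intro v hv u huv
    have h1 := hYcl v hv u
    have h2 := hY v hv
    by_cases h3 : u ∈ [s, z, p, q, r, w, e, e']
    · have h4 := (hs v).1
      have h5 := (hz v).1
      have h6 := (hq v).1
      have h7 := (hr v).1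
      simp only [List.mem_cons, List.not_mem_nil, or_false, not_or] at h3 h2
      rcases h3 with rfl | rfl | rfl | rfl | rfl | rfl | rfl | rfl <;> grind [huv.symm]
    · simp only [Finset.mem_filter, Finset.mem_univ, true_and] at h1
      exact Or.inl (h1 h3 huv)
  have hsY : s ∉ Y := fun h => hY s h (by simp)
  have hnb : ∀ a b c d, (∀ u, u = p ∨ u = w ∨ u = e ∨ u = e' → u = a ∨ u = b ∨ u = c ∨ u = d) →
      s ≠ b → s ≠ c → s ≠ d → ∃ v ∈ Y, G.Adj v a := by
    intro a b c d hu hsb hsc hsd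
    by_contra! hna
    have := hc.four_le (A := Y) (C := {b, c, d}) (b := s) hYne (fun v hv u huv => ?_) hsY
      (by simp [*])
    · have := Finset.card_le_three (a := b) (b := c) (c := d)
      omega
    · rcases hN v hv u huv with h | h
      · exact Or.inl h
      · have := hu u h
        have : u ≠ a := by rintro rfl; exact hna v hv huv
        simp; tauto
  simp only [List.nodup_cons, List.mem_cons, List.not_mem_nil, not_or, or_false] at hd
  obtain ⟨v₁, hv₁, hw₁⟩ := hnb w p e e' (by clear * -; tauto) (by grind) (by grind) (by grind)
  obtain ⟨v₂, hv₂, hw₂⟩ := hnb e p w e' (by clear * -; tauto) (by grind) (by grind) (by grind)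
  obtain ⟨v₃, hv₃, hw₃⟩ := hnb e' p w e (by clear * -; tauto) (by grind) (by grind) (by grind)
  refine wheel_isMinorOf (hub := {q, z, w}) (rim := ![{p}, {s}, {r}, {e'}, Y, {e}]) ?_ ?_ ?_ ?_
    ?_ ?_
  · refine induce_insert_connected (u := z) ?_ (by simp) hq.adj.2.1
    exact induce_insert_connected (induce_singleton_connected _) (by simp) hz.adj.2.2.2
  · intro i
    fin_cases i
    on_goal 5 => exact hYc
    all_goals exact induce_singleton_connected _
  · intro i
    have h1 := hY q
    have h2 := hY z
    have h3 := hY w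
    fin_cases i <;> simp at * <;> grind
  · have h1 : ∀ v ∈ Y, v ≠ p ∧ v ≠ s ∧ v ≠ r ∧ v ≠ e' ∧ v ≠ e := fun v hv => by
      have := hY v hv
      simp at this
      tauto
    have hp : p ∉ Y := fun h => (h1 p h).1 rfl
    have hr : r ∉ Y := fun h => (h1 r h).2.2.1 rfl
    have he : e ∉ Y := fun h => (h1 e h).2.2.2.2 rfl
    have he' : e' ∉ Y := fun h => (h1 e' h).2.2.2.1 rfl
    clear hN hnb hYX hYcl h1 hY
    intro i j hij
    fin_cases i <;> fin_cases j <;> simp at * <;> grind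
  · have hq := hq.adj
    have hz := hz.adj
    intro i
    fin_cases i
    · exact ⟨q, by simp, p, by simp, hq.2.2.1⟩
    · exact ⟨q, by simp, s, by simp, hq.1⟩
    · exact ⟨z, by simp, r, by simp, hz.2.2.1⟩
    · exact ⟨w, by simp, e', by simp, hwe⟩
    · exact ⟨w, by simp, v₁, hv₁, hw₁.symm⟩
    · exact ⟨q, by simp, e, by simp, hq.2.2.2⟩
  · have hs := hs.adj
    have hr := hr.adj
    intro i
    fin_cases i
    · exact ⟨p, by simp, s, by simp, hs.2.1.symm⟩
    · exact ⟨s, by simp, r, by simp, hs.2.2.2⟩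
    · exact ⟨r, by simp, e', by simp, hr.2.2.2⟩
    · exact ⟨e', by simp, v₃, hv₃, hw₃.symm⟩
    · exact ⟨v₂, hv₂, e, by simp, hw₂⟩
    · exact ⟨e, by simp, p, by simp, hpe.symm⟩

theorem TightPair.result_aux (hc : Conn4 G) (hcrit : Critical G) (hn : 8 ≤ Fintype.card V)
    {s z p q r w e e' : V} (h : TightPair G s z p q r w) (hd : [s, z, p, q, r, w, e, e'].Nodup)
    (hq : Nbr4 G q s z p e) (hr : Nbr4 G r s z w e') :
    (wheel 6).IsMinorOf G ∨ (Fintype.card V = 8 ∧ Nonempty (G ≃g cycleSq 8)) := by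
  obtain ⟨x, hp, hx⟩ := h.exists_right hc hcrit hn hd hq
  obtain ⟨y, hw, hy⟩ := h.symm.exists_right hc hcrit hn (e := e') (e' := e)
    (by
      clear * - hd
      simp only [List.nodup_cons, List.mem_cons, List.not_mem_nil, not_or, or_false] at *
      grind)
    (hr.congr (by clear * -; tauto))
  by_cases h8 : Fintype.card V = 8
  · exact Or.inr ⟨h8, h.iso_cycleSq hc h8 hd hq hr hp hx hw hy⟩
  · exact Or.inl (h.isMinorOf hc (by omega) hd hq hr hp.adj.2.2.1 hw.adj.2.2.1)

theorem TightPair.result (hc : Conn4 G) (hcrit : Critical G) (hn : 8 ≤ Fintype.card V)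
    {s z p q r w : V} (h : TightPair G s z p q r w) :
    (wheel 6).IsMinorOf G ∨ (Fintype.card V = 8 ∧ Nonempty (G ≃g cycleSq 8)) := by
  obtain ⟨e, e', hd, ⟨h1, h2⟩ | ⟨h1, h2⟩⟩ := h.exists_extra hc hcrit hn
  · exact h.result_aux hc hcrit hn hd h1 h2
  · refine TightPair.result_aux hc hcrit hn (q := r) (r := q) ⟨?_, h.left.congr ?_,
      h.right.congr ?_⟩ ?_ h1 h2
    · have := h.nodup
      clear * - this
      simp only [List.nodup_cons, List.mem_cons, List.not_mem_nil, not_or, or_false] at *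
      grind
    · clear * -; tauto
    · clear * -; tauto
    · clear * - hd
      simp only [List.nodup_cons, List.mem_cons, List.not_mem_nil, not_or, or_false] at *
      grind


end PairLemma

section PairLemma

open scoped Classical

variable {V : Type*} {G : SimpleGraph V} [Fintype V]

theorem IsPair.exists_full_partner (hc : Conn4 G) (hcrit : Critical G) (hn : 8 ≤ Fintype.card V)
    {s z : V} {T : Finset V} (h : IsPair G s z T) (hs : ∀ v ∈ T, G.Adj s v) {t : V} (ht : t ∈ T)
    (hzt : G.Adj z t) : ∃ t₁ ∈ T, t₁ ≠ t ∧ G.Adj z t₁ ∧ (∀ v ∈ T, G.Adj t₁ v ↔ v = t) ∧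
      ∃ e, e ∉ T ∧ e ≠ s ∧ e ≠ z ∧ Nbr4 G t₁ s z t e := by
  obtain ⟨t₁, ht₁, hne, e, he, hez, hes, hN⟩ := h.symm.exists_partner hc hcrit hn ht hzt
    fun v hv _ _ => hs v hv
  have hN' : Nbr4 G t₁ s z t e := hN.congr (by clear * -; tauto)
  refine ⟨t₁, ht₁, hne, hN.adj.1.symm, fun v hv => ?_, e, he, hes, hez, hN'⟩
  have h1 := h.left_notMem
  have h2 := h.right_notMem
  have := hN v
  grind

theorem IsPair.false_of_left_full (hc : Conn4 G) (hcrit : Critical G)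
    (hn : 8 ≤ Fintype.card V) {s z p : V} {T : Finset V} (h : IsPair G s z T)
    (hs : ∀ v ∈ T, G.Adj s v) (hp : p ∈ T) (hzp : ¬ G.Adj z p)
    (hz : ∀ v ∈ T, v ≠ p → G.Adj z v) : False := by
  obtain ⟨q, r, w, hqr, hqw, hrw, hT⟩ := Finset.card_eq_three.1
    (show (T.erase p).card = 3 by rw [Finset.card_erase_of_mem hp, h.card])
  have hmem : ∀ v, (v ≠ p ∧ v ∈ T) ↔ v = q ∨ v = r ∨ v = w := fun v => by
    rw [← Finset.mem_erase, hT]; simp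
  have key : ∀ t, t ≠ p ∧ t ∈ T → ∃ t₁, (t₁ ≠ p ∧ t₁ ∈ T) ∧ t₁ ≠ t ∧
      ∀ v ∈ T, G.Adj t₁ v ↔ v = t := by
    intro t ht
    obtain ⟨t₁, h1, h2, h3, h4, -⟩ := h.exists_full_partner hc hcrit hn hs ht.2 (hz t ht.2 ht.1)
    exact ⟨t₁, ⟨fun e => hzp (e ▸ h3), h1⟩, h2, h4⟩
  obtain ⟨a, ha, haq, ha'⟩ := key q ((hmem q).2 (by simp))
  obtain ⟨b, hb, hbr, hb'⟩ := key r ((hmem r).2 (by simp))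
  obtain ⟨c, hd, hcw, hc'⟩ := key w ((hmem w).2 (by simp))
  have hq := (hmem q).2 (by simp)
  have hr := (hmem r).2 (by simp)
  have hw := (hmem w).2 (by simp)
  have hsymm : ∀ u v, G.Adj u v → G.Adj v u := fun u v h => h.symm
  rw [hmem] at ha hb hd
  grind

theorem IsPair.false_of_full (hc : Conn4 G) (hcrit : Critical G)
    (hn : 8 ≤ Fintype.card V) {s z : V} {T : Finset V} (h : IsPair G s z T)
    (hs : ∀ v ∈ T, G.Adj s v) (hz : ∀ v ∈ T, G.Adj z v) : False := by
  obtain ⟨p, hp⟩ : T.Nonempty := Finset.card_pos.1 (by rw [h.card]; simp)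
  obtain ⟨q, hq, hqp, -, hqT, e, he, hes, hez, hNq⟩ :=
    h.exists_full_partner hc hcrit hn hs hp (hz p hp)
  obtain ⟨p', hp', hpq, -, hpT, e', he', hes', hez', hNp⟩ :=
    h.exists_full_partner hc hcrit hn hs hq (hz q hq)
  obtain rfl : p' = p := (hqT p' hp').1 ((hpT q hq).2 rfl).symm
  have hee : e ≠ e' := by
    rintro rfl
    refine hc.false_of_list [p', q] (by simp) (a := s) (b := z) (c := e) ?_ (by simp; omega)
    intro x hx v hxv
    have h1 := (hNq v).1
    have h2 := (hNp v).1
    simp only [List.mem_cons, List.not_mem_nil, or_false] at hx ⊢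
    rcases hx with rfl | rfl
    · have := h2 hxv
      clear * - this; tauto
    · have := h1 hxv
      clear * - this; tauto
  have h1 := h.ne
  have h2 := h.left_notMem
  have h3 := h.right_notMem
  have hP : TightPair G q p' e s z e' := by
    refine ⟨?_, hNq.congr (by clear * -; tauto), hNp.congr (by clear * -; tauto)⟩
    simp only [List.nodup_cons, List.mem_cons, List.not_mem_nil, not_or, or_false]
    grind
  obtain ⟨x, y, -, ⟨h4, -⟩ | ⟨h4, -⟩⟩ := hP.exists_extra hc hcrit hn
  · rcases h.left_nbr _ h4.adj.2.2.1 with h5 | h5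
    exacts [hez h5, he h5]
  · rcases h.right_nbr _ h4.adj.2.2.1 with h5 | h5
    exacts [hes h5, he h5]

theorem IsPair.not_adj_unique (hc : Conn4 G) {s z : V} {T : Finset V} (h : IsPair G s z T) {a : V}
    (ha : a ∈ T) (hsa : ¬ G.Adj s a) : G.Adj s z ∧ ∀ v ∈ T, v ≠ a → G.Adj s v := by
  have h1 : G.neighborFinset s ⊆ insert z (T.erase a) := fun v hv => by
    rw [mem_neighborFinset] at hv
    have := h.left_nbr v hv
    have : v ≠ a := by rintro rfl; exact hsa hv
    simp; tauto
  have h2 : (insert z (T.erase a)).card = 4 := by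
    rw [Finset.card_insert_of_notMem (fun h' => h.right_notMem (Finset.mem_of_mem_erase h')),
      Finset.card_erase_of_mem ha, h.card]
  have h3 := Finset.eq_of_subset_of_card_le h1 (by
    rw [h2]; simpa using hc.four_le_degree s)
  have h4 : ∀ v, v ∈ insert z (T.erase a) → G.Adj s v := fun v hv => by
    rwa [← h3, mem_neighborFinset] at hv
  exact ⟨h4 z (by simp), fun v hv hva => h4 v (by simp [hv, hva])⟩

/-- A critical 4-connected graph with at least eight vertices, two of which have all their other
neighbours in a common 4-element set. -/
theorem IsPair.result (hc : Conn4 G) (hcrit : Critical G)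
    (hn : 8 ≤ Fintype.card V) {s z : V} {T : Finset V} (h : IsPair G s z T) :
    (wheel 6).IsMinorOf G ∨ (Fintype.card V = 8 ∧ Nonempty (G ≃g cycleSq 8)) := by
  by_cases hs : ∀ v ∈ T, G.Adj s v
  · by_cases hz : ∀ v ∈ T, G.Adj z v
    · exact (h.false_of_full hc hcrit hn hs hz).elim
    · push Not at hz
      obtain ⟨p, hp, hzp⟩ := hz
      exact (h.false_of_left_full hc hcrit hn hs hp hzp (h.symm.not_adj_unique hc hp hzp).2).elim
  push Not at hs
  obtain ⟨p, hp, hsp⟩ := hs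
  have hs' := h.not_adj_unique hc hp hsp
  by_cases hz : ∀ v ∈ T, G.Adj z v
  · exact (h.symm.false_of_left_full hc hcrit hn hz hp hsp hs'.2).elim
  push Not at hz
  obtain ⟨w, hw, hzw⟩ := hz
  have hz' := h.symm.not_adj_unique hc hw hzw
  have hwp : w ≠ p := by
    rintro rfl
    obtain ⟨g, hgs, hgz, hgT⟩ := h.exists_outside hn
    have := hc.four_le (A := {s, z}) (C := T.erase w) (b := w) (by simp) ?_ ?_ (by simp)
    · rw [Finset.card_erase_of_mem hp, h.card] at this
      omega
    · intro a ha v hv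
      have h1 := h.left_nbr v
      have h2 := h.right_nbr v
      simp only [Finset.mem_insert, Finset.mem_singleton, Finset.mem_erase] at ha ⊢
      rcases ha with rfl | rfl <;> grind
    · have h1 := h.left_notMem
      have h2 := h.right_notMem
      simp only [Finset.mem_insert, Finset.mem_singleton]
      grind
  obtain ⟨q, r, hqr, hT⟩ := Finset.card_eq_two.1
    (show ((T.erase p).erase w).card = 2 by
      rw [Finset.card_erase_of_mem (by simp [*]), Finset.card_erase_of_mem hp, h.card])
  have hmem : ∀ v, (v ≠ w ∧ v ≠ p ∧ v ∈ T) ↔ v = q ∨ v = r := fun v => by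
    rw [← Finset.mem_erase, ← Finset.mem_erase, hT]; simp
  have hq := (hmem q).2 (by simp)
  have hr := (hmem r).2 (by simp)
  have h1 := h.ne
  have h2 := h.left_notMem
  have h3 := h.right_notMem
  have hP : TightPair G s z w q r p := by
    refine ⟨?_, hc.nbr4 fun v hv => ?_, hc.nbr4 fun v hv => ?_⟩
    · simp only [List.nodup_cons, List.mem_cons, List.not_mem_nil, not_or, or_false]
      grind
    · have := h.left_nbr v hv
      have := (hmem v).1
      grind
    · have := h.right_nbr v hv
      have := (hmem v).1
      grind
  exact hP.result hc hcrit hn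

end PairLemma

section Fragments

open scoped Classical

variable {V : Type*} {G : SimpleGraph V}

theorem IsSep.of_closed [Fintype V] {A C : Finset V} (hA : A.Nonempty) (hAC : ∀ a ∈ A, a ∉ C)
    (hN : ∀ a ∈ A, ∀ v, G.Adj a v → v ∈ A ∨ v ∈ C) {b : V} (hbA : b ∉ A) (hbC : b ∉ C) :
    IsSep G A C (Finset.univ \ (A ∪ C)) := by
  refine ⟨hA, ⟨b, by simp [hbA, hbC]⟩, ?_, hAC, ?_, ?_, ?_⟩
  · intro v; simp; tauto
  · intro v hv; simp [hv]
  · intro v hv; simp [hv]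
  · intro a ha b hb hab
    have := hN a ha b hab
    simp at hb
    tauto

theorem IsSep.card_inter {A T B : Finset V} (h : IsSep G A T B) (X : Finset V) :
    (X ∩ A).card + (X ∩ T).card + (X ∩ B).card = X.card := by
  rw [← Finset.card_union_of_disjoint, ← Finset.card_union_of_disjoint]
  · congr 1
    ext v
    have := h.cover v
    simp only [Finset.mem_union, Finset.mem_inter]
    tauto
  · rw [Finset.disjoint_left]
    intro v
    have h1 := h.disj v
    have h2 := h.notMem_B v
    simp only [Finset.mem_union, Finset.mem_inter]
    tauto
  · rw [Finset.disjoint_left]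
    intro v
    have h1 := h.notMem_T v
    simp only [Finset.mem_inter]
    tauto

theorem IsSep.mem_of_adj {A T B : Finset V} (h : IsSep G A T B) {a v : V} (ha : a ∈ A)
    (hv : G.Adj a v) : v ∈ A ∨ v ∈ T := by
  have := h.cover v
  have := h.not_adj a ha v
  tauto

/-- The edge `x z` lies in a triangle whose third vertex has degree four. -/
def Covered [Fintype V] (G : SimpleGraph V) (x z : V) : Prop :=
  ∃ s, G.degree s = 4 ∧ G.Adj s x ∧ G.Adj s z

/-- A separation by four vertices with both sides nontrivial. -/
structure IsBigSep (G : SimpleGraph V) (A T B : Finset V) : Prop where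
  sep : IsSep G A T B
  card : T.card = 4
  left : 2 ≤ A.card
  right : 2 ≤ B.card

theorem IsBigSep.symm {A T B : Finset V} (h : IsBigSep G A T B) : IsBigSep G B T A :=
  ⟨h.sep.symm, h.card, h.right, h.left⟩

theorem IsBigSep.three_le (hp : ∀ s z T, ¬ IsPair G s z T) {A T B : Finset V}
    (h : IsBigSep G A T B) : 3 ≤ A.card := by
  by_contra hA
  obtain ⟨s, z, hsz, rfl⟩ := Finset.card_eq_two.1 (show A.card = 2 by have := h.left; omega)
  refine hp s z T ⟨hsz, h.card, h.sep.notMem_T s (by simp), h.sep.notMem_T z (by simp),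
    fun v hv => ?_, fun v hv => ?_⟩
  · have := h.sep.mem_of_adj (a := s) (by simp) hv
    have := hv.ne'
    simp_all
  · have := h.sep.mem_of_adj (a := z) (by simp) hv
    have := hv.ne'
    simp_all

variable [Fintype V]

theorem IsSep.covered (hc : Conn4 G) {A T B : Finset V} (h : IsSep G A T B) (hT : T.card = 4)
    (hA : A.card ≤ 1) {x z : V} (hx : x ∈ T) (hz : z ∈ T) : Covered G x z := by
  obtain ⟨s, hs⟩ := h.left
  have hle : G.neighborFinset s ⊆ T := fun v hv => by
    rw [mem_neighborFinset] at hv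
    refine (h.mem_of_adj hs hv).resolve_left fun hvA => ?_
    exact hv.ne (Finset.card_le_one.1 hA _ hs _ hvA)
  have heq := Finset.eq_of_subset_of_card_le hle (by simpa [hT] using hc.four_le_degree s)
  refine ⟨s, by rw [← card_neighborFinset_eq_degree, heq, hT], ?_, ?_⟩
  · rwa [← heq, mem_neighborFinset] at hx
  · rwa [← heq, mem_neighborFinset] at hz

/-- The part of the union of two separators that bounds the intersection of the left sides. -/
noncomputable def corner (A T A' T' : Finset V) : Finset V := (T ∩ A') ∪ (T ∩ T') ∪ (A ∩ T')

omit [Fintype V] in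
theorem card_corner_le (A T A' T' : Finset V) :
    (corner A T A' T').card ≤ (T ∩ A').card + (T ∩ T').card + (A ∩ T').card := by
  have h1 := Finset.card_union_le (T ∩ A' ∪ T ∩ T') (A ∩ T')
  have h2 := Finset.card_union_le (T ∩ A') (T ∩ T')
  unfold corner
  omega

theorem IsSep.inter {A T B A' T' B' : Finset V} (h : IsSep G A T B)
    (h' : IsSep G A' T' B') (hne : (A ∩ A').Nonempty) :
    IsSep G (A ∩ A') (corner A T A' T') (Finset.univ \ ((A ∩ A') ∪ corner A T A' T')) := by
  obtain ⟨b, hb⟩ := h.right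
  refine IsSep.of_closed hne (fun a ha => ?_) (fun a ha v hv => ?_) (b := b) ?_ ?_
  · rw [Finset.mem_inter] at ha
    have h1 := h.notMem_T a ha.1
    have h2 := h'.notMem_T a ha.2
    simp [corner, h1, h2]
  · rw [Finset.mem_inter] at ha
    have h1 := h.mem_of_adj ha.1 hv
    have h2 := h'.mem_of_adj ha.2 hv
    simp only [corner, Finset.mem_union, Finset.mem_inter]
    tauto
  · have := h.symm.notMem_B b hb
    simp [this]
  · have h1 := h.symm.notMem_B b hb
    have h2 := h.symm.notMem_T b hb
    simp [corner, h1, h2]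

/-- Edges meeting a smallest nontrivial fragment are covered. -/
theorem IsBigSep.covered (hc : Conn4 G) (hcrit : Critical G) (hp : ∀ s z T, ¬ IsPair G s z T)
    {A T B : Finset V} (h : IsBigSep G A T B)
    (hmin : ∀ A' T' B', IsBigSep G A' T' B' → A.card ≤ A'.card) {x z : V} (hz : z ∈ A)
    (hxz : G.Adj x z) : Covered G x z := by
  obtain ⟨A', T', B', h', hT', hx', hz'⟩ := hcrit x z hxz
  by_contra hcov
  have big : ∀ A' B', IsSep G A' T' B' → 2 ≤ A'.card := fun A' B' h' => by
    by_contra hA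
    exact hcov (h'.covered hc hT' (by omega) hx' hz')
  have hA3 := h.three_le hp
  have hB3 := h.symm.three_le hp
  have hT := h.card
  have h1 : ∀ A' B', IsSep G A' T' B' → (A ∩ A').Nonempty →
      5 ≤ (T ∩ A').card + (T ∩ T').card + (A ∩ T').card := by
    intro A' B' h' hne
    have hs := h.sep.inter h' hne
    by_contra hlt
    have h4 : (corner A T A' T').card = 4 :=
      le_antisymm ((card_corner_le _ _ _ _).trans (by omega)) (hc.2 _ _ _ hs)
    by_cases h2 : 2 ≤ (A ∩ A').card
    · have hlt : (A ∩ A').card < A.card := by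
        refine Finset.card_lt_card ⟨Finset.inter_subset_left, fun hle => ?_⟩
        exact h'.notMem_T z (Finset.mem_inter.1 (hle hz)).2 hz'
      refine absurd (hmin _ _ _ ⟨hs, h4, h2, h.right.trans (Finset.card_le_card fun b hb => ?_)⟩)
        (by omega)
      have h1 := h.sep.symm.notMem_B b hb
      have h2 := h.sep.symm.notMem_T b hb
      simp [corner, h1, h2]
    · refine hcov (hs.covered hc h4 (by omega) ?_ ?_)
      · have := h.sep.mem_of_adj hz hxz.symm
        simp only [corner, Finset.mem_union, Finset.mem_inter]
        tauto
      · simp [corner, hz, hz']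
  have h2 : ∀ A' B', IsSep G A' T' B' → (B ∩ A').Nonempty →
      4 ≤ (T ∩ A').card + (T ∩ T').card + (B ∩ T').card := fun A' B' h' hne =>
    (hc.2 _ _ _ (h.sep.symm.inter h' hne)).trans (card_corner_le _ _ _ _)
  have cT := h'.card_inter T
  have cA := h'.card_inter A
  have cB := h'.card_inter B
  have cT' := h.sep.card_inter T'
  have cA' := h.sep.card_inter A'
  have cB' := h.sep.card_inter B'
  have bA' := big A' B' h'
  have bB' := big B' A' h'.symm
  rw [Finset.inter_comm T' A, Finset.inter_comm T' B, Finset.inter_comm T' T] at cT'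
  rw [Finset.inter_comm A' A, Finset.inter_comm A' B, Finset.inter_comm A' T] at cA'
  rw [Finset.inter_comm B' A, Finset.inter_comm B' B, Finset.inter_comm B' T] at cB'
  have i1 := h1 A' B' h'
  have i2 := h1 B' A' h'.symm
  have i3 := h2 A' B' h'
  have i4 := h2 B' A' h'.symm
  have key : ∀ A' B', IsSep G A' T' B' → A ∩ B' = ∅ → B ∩ B' = ∅ → (B ∩ T').Nonempty := by
    intro A' B' h' hA hB
    obtain ⟨b, hb⟩ := h'.right
    have hbT : b ∈ T := by
      have h1 : b ∉ A ∩ B' := by simp [hA]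
      have h2 : b ∉ B ∩ B' := by simp [hB]
      have h3 := h.sep.cover b
      simp only [Finset.mem_inter] at h1 h2
      tauto
    obtain ⟨v, hv, hbv⟩ := h.sep.symm.exists_adj hc hT hbT
    refine ⟨v, Finset.mem_inter.2 ⟨hv, (h'.symm.mem_of_adj hb hbv).resolve_left fun hvB => ?_⟩⟩
    have : v ∈ B ∩ B' := by simp [hv, hvB]
    simp [hB] at this
  have k1 := key A' B' h'
  have k2 := key B' A' h'.symm
  simp only [← Finset.card_pos, ← Finset.card_eq_zero] at i1 i2 i3 i4 k1 k2
  omega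

end Fragments

section Triangles

open scoped Classical

variable {V : Type*} {G : SimpleGraph V} [Fintype V]

theorem length_le_degree {l : List V} {v : V} (hl : l.Nodup) (h : ∀ u ∈ l, G.Adj v u) :
    l.length ≤ G.degree v := by
  rw [← card_neighborFinset_eq_degree, ← List.toFinset_card_of_nodup hl]
  exact Finset.card_le_card fun u hu => by simpa using h u (by simpa using hu)

/-- Without pairs, adjacent vertices of degree four have at most one common neighbour. -/
theorem eq_of_common_neighbors (hp : ∀ s z T, ¬ IsPair G s z T) (hn : 8 ≤ Fintype.card V)
    {s z a b : V} (hs : G.degree s = 4) (hz : G.degree z = 4) (hsz : G.Adj s z) (hsa : G.Adj s a)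
    (hza : G.Adj z a) (hsb : G.Adj s b) (hzb : G.Adj z b) : a = b := by
  by_contra hab
  have h1 : ((G.neighborFinset s).erase z).card = 3 := by
    rw [Finset.card_erase_of_mem (by simpa using hsz), card_neighborFinset_eq_degree, hs]
  have h2 : ((G.neighborFinset z).erase s).card = 3 := by
    rw [Finset.card_erase_of_mem (by simpa using hsz.symm), card_neighborFinset_eq_degree, hz]
  have h3 : 2 ≤ ((G.neighborFinset s).erase z ∩ (G.neighborFinset z).erase s).card := by
    rw [← Finset.card_pair hab]
    refine Finset.card_le_card fun v hv => ?_
    simp only [Finset.mem_insert, Finset.mem_singleton] at hv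
    rcases hv with rfl | rfl
    · simp [hsa, hza, hsa.ne']
    · simp [hsb, hzb, hsb.ne']
  have h4 := Finset.card_union_add_card_inter ((G.neighborFinset s).erase z)
    ((G.neighborFinset z).erase s)
  obtain ⟨T, h5, h6, h7⟩ := Finset.exists_subsuperset_card_eq (n := 4)
    (s := (G.neighborFinset s).erase z ∪ (G.neighborFinset z).erase s)
    (t := Finset.univ \ {s, z}) (fun v hv => by
      simp at hv
      have h1 : G.Adj s v → v ≠ s := fun h => h.ne'
      have h2 : G.Adj z v → v ≠ z := fun h => h.ne'
      simp; tauto) (by omega) (by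
      have : ({s, z} : Finset V).card = 2 := Finset.card_pair hsz.ne
      rw [Finset.card_sdiff_of_subset (Finset.subset_univ _), Finset.card_univ]
      omega)
  refine hp s z T ⟨hsz.ne, h7, fun h => ?_, fun h => ?_, fun v hv => ?_, fun v hv => ?_⟩
  · simpa using h6 h
  · simpa using h6 h
  · by_cases h : v = z
    · exact Or.inl h
    · exact Or.inr (h5 (by simp [h, hv]))
  · by_cases h : v = s
    · exact Or.inl h
    · exact Or.inr (h5 (by simp [h, hv]))

/-- A vertex set `F` with boundary `T` such that all edges meeting `F` are covered. -/
structure IsCore (G : SimpleGraph V) (F T B : Finset V) : Prop where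
  nonempty : F.Nonempty
  disj : ∀ v ∈ F, v ∉ T
  closed : ∀ v ∈ F, ∀ u, G.Adj v u → u ∈ F ∨ u ∈ T
  covered : ∀ z ∈ F, ∀ x, G.Adj x z → Covered G x z
  outside : ∀ t ∈ T, ∃ b, b ∉ F ∧ b ∉ T ∧ G.Adj t b
  two : ∀ t ∈ T, ∀ u, ∃ v ∈ F, v ≠ u ∧ G.Adj t v
  sep : T = ∅ ∨ IsBigSep G F T B

theorem IsBigSep.two (hc : Conn4 G) (hp : ∀ s z T, ¬ IsPair G s z T) {A T B : Finset V}
    (h : IsBigSep G A T B) (hmin : ∀ A' T' B', IsBigSep G A' T' B' → A.card ≤ A'.card)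
    {t : V} (ht : t ∈ T) (u : V) : ∃ v ∈ A, v ≠ u ∧ G.Adj t v := by
  by_contra! hu
  obtain ⟨v, hv, htv⟩ := h.sep.exists_adj hc h.card ht
  obtain rfl : v = u := by_contra fun hne => hu v hv hne htv
  have h1 := h.three_le hp
  have h2 := h.right
  have hvT := h.sep.notMem_T v hv
  have htA : t ∉ A := fun h' => h.sep.notMem_T t h' ht
  have hA : (A.erase v).card = A.card - 1 := Finset.card_erase_of_mem hv
  have hs : IsSep G (A.erase v) (insert v (T.erase t))
      (Finset.univ \ (A.erase v ∪ insert v (T.erase t))) := by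
    refine IsSep.of_closed (b := t) (Finset.card_pos.1 (by omega)) ?_ ?_ (by simp [htA])
      (by simp [htv.ne])
    · intro a ha
      simp only [Finset.mem_erase] at ha
      have := h.sep.notMem_T a ha.2
      simp [ha.1, this]
    · intro a ha w hw
      simp only [Finset.mem_erase] at ha
      have h3 := h.sep.mem_of_adj ha.2 hw
      have h4 : w ≠ t := by
        rintro rfl
        exact hu a ha.2 ha.1 hw.symm
      simp only [Finset.mem_erase, Finset.mem_insert]
      tauto
  have hb : B ⊆ (Finset.univ \ (A.erase v ∪ insert v (T.erase t))) := by
    intro b hb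
    have h3 := h.sep.symm.notMem_B b hb
    have h4 := h.sep.symm.notMem_T b hb
    have h5 : b ≠ v := by rintro rfl; exact h3 hv
    simp [h3, h4, h5]
  have := hmin _ _ _ ⟨hs, ?_, by omega, h2.trans (Finset.card_le_card hb)⟩
  · omega
  · rw [Finset.card_insert_of_notMem (by simp [hvT]), Finset.card_erase_of_mem ht, h.card]

theorem exists_isCore (hc : Conn4 G) (hcrit : Critical G) (hp : ∀ s z T, ¬ IsPair G s z T) :
    ∃ F T B, IsCore G F T B := by
  by_cases h : ∃ A T B, IsBigSep G A T B
  · obtain ⟨⟨A, T, B⟩, h, hmin⟩ := Finset.exists_min_image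
      ((Finset.univ : Finset (Finset V × Finset V × Finset V)).filter
        fun p => IsBigSep G p.1 p.2.1 p.2.2) (fun p => p.1.card)
      (by obtain ⟨A, T, B, h⟩ := h; exact ⟨(A, T, B), by simpa using h⟩)
    simp only [Finset.mem_filter, Finset.mem_univ, true_and, Prod.forall] at h hmin
    refine ⟨A, T, B, h.sep.left, h.sep.notMem_T, fun v hv u hu => h.sep.mem_of_adj hv hu,
      fun z hz x hxz => h.covered hc hcrit hp hmin hz hxz, fun t ht => ?_,
      fun t ht u => h.two hc hp hmin ht u, Or.inr h⟩
    obtain ⟨b, hb, htb⟩ := h.sep.symm.exists_adj hc h.card ht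
    exact ⟨b, h.sep.symm.notMem_B b hb, h.sep.symm.notMem_T b hb, htb⟩
  · have := hc.1
    refine ⟨Finset.univ, ∅, ∅, Finset.card_pos.1 (by rw [Finset.card_univ]; omega), by simp, by simp,
      fun z _ x hxz => ?_, by simp, by simp, Or.inl rfl⟩
    obtain ⟨A, T, B, hs, hT, hx, hz⟩ := hcrit x z hxz
    by_cases hA : 2 ≤ A.card
    · by_cases hB : 2 ≤ B.card
      · exact (h ⟨A, T, B, hs, hT, hA, hB⟩).elim
      · exact hs.symm.covered hc hT (by omega) hx hz
    · exact hs.covered hc hT (by omega) hx hz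

theorem IsCore.exists_degree (hc : Conn4 G) (hp : ∀ s z T, ¬ IsPair G s z T)
    (hn : 8 ≤ Fintype.card V) {F T B : Finset V} (h : IsCore G F T B) :
    ∃ z ∈ F, G.degree z = 4 := by
  by_contra! hd
  have hcov : ∀ z ∈ F, ∀ x, G.Adj x z → ∃ s ∈ T, G.degree s = 4 ∧ G.Adj s x ∧ G.Adj s z := by
    intro z hz x hxz
    obtain ⟨s, hs, hsx, hsz⟩ := h.covered z hz x hxz
    exact ⟨s, (h.closed z hz s hsz.symm).resolve_left fun hsF => hd s hsF hs, hs, hsx, hsz⟩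
  obtain ⟨z, hz⟩ := h.nonempty
  by_cases hx : ∃ x ∈ F, G.Adj x z
  · obtain ⟨x, hx, hxz⟩ := hx
    obtain ⟨s, hsT, hs, hsx, hsz⟩ := hcov z hz x hxz
    obtain ⟨s₁, hsT₁, hs₁, hss₁, hsz₁⟩ := hcov z hz s hsz
    obtain ⟨s₂, hsT₂, hs₂, hss₂, hsx₂⟩ := hcov x hx s hsx
    obtain ⟨b, hbF, hbT, hsb⟩ := h.outside s hsT
    have hzT := h.disj z hz
    have hxT := h.disj x hx
    by_cases h12 : s₁ = s₂
    · subst h12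
      exact hxz.ne (eq_of_common_neighbors hp hn hs hs₁ hss₁.symm hsx hsx₂ hsz hsz₁)
    · have := length_le_degree (G := G) (v := s) (l := [x, z, s₁, s₂, b]) (by
        have := hxz.ne
        simp only [List.nodup_cons, List.mem_cons, List.not_mem_nil, not_or, or_false]
        grind) (by simp [hsx, hsz, hss₁.symm, hss₂.symm, hsb])
      simp [hs] at this
  · push Not at hx
    have hle : G.neighborFinset z ⊆ T := fun v hv => by
      rw [mem_neighborFinset] at hv
      exact (h.closed z hz v hv).resolve_left fun hvF => hx v hvF hv.symm
    have hT : T.card ≤ 4 := by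
      rcases h.sep with rfl | h
      · simp
      · exact h.card.le
    have := Finset.card_le_card hle
    have := hc.four_le_degree z
    have := hd z hz
    rw [card_neighborFinset_eq_degree] at *
    omega

/-- A triangle of vertices of degree four, no two of which have another common neighbour. -/
structure IsTri (G : SimpleGraph V) (x y z : V) : Prop where
  xy : G.Adj x y
  xz : G.Adj x z
  yz : G.Adj y z
  dx : G.degree x = 4
  dy : G.degree y = 4
  dz : G.degree z = 4
  cxy : ∀ v, G.Adj x v → G.Adj y v → v = z
  cxz : ∀ v, G.Adj x v → G.Adj z v → v = y
  cyz : ∀ v, G.Adj y v → G.Adj z v → v = x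

theorem IsTri.rotate {x y z : V} (h : IsTri G x y z) : IsTri G y z x :=
  ⟨h.yz, h.xy.symm, h.xz.symm, h.dy, h.dz, h.dx, h.cyz, fun v hy hx => h.cxy v hx hy,
    fun v hz hx => h.cxz v hx hz⟩

theorem IsTri.swap {x y z : V} (h : IsTri G x y z) : IsTri G x z y :=
  ⟨h.xz, h.xy, h.yz.symm, h.dx, h.dz, h.dy, h.cxz, h.cxy, fun v hz hy => h.cyz v hy hz⟩

/-- The neighbours of `v` other than `u` and `w` are adjacent. -/
def Good (G : SimpleGraph V) (v u w : V) : Prop :=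
  ∀ a b, G.Adj v a → G.Adj v b → a ≠ u → a ≠ w → b ≠ u → b ≠ w → a ≠ b → G.Adj a b

theorem IsTri.good {x y z a : V} (h : IsTri G x y z) (ha : G.Adj x a) (hay : a ≠ y) (haz : a ≠ z)
    (hcov : Covered G x a) : Good G x y z := by
  obtain ⟨s, -, hsx, hsa⟩ := hcov
  have h1 : s ≠ y := by
    rintro rfl
    exact haz (h.cxy a ha hsa)
  have h2 : s ≠ z := by
    rintro rfl
    exact hay (h.cxz a ha hsa)
  intro c d hc hd hcy hcz hdy hdz hcd
  have key : ∀ v, G.Adj x v → v = y ∨ v = z ∨ v = c ∨ v = d := by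
    intro v hv
    by_contra! hne
    have := length_le_degree (G := G) (v := x) (l := [v, y, z, c, d]) (by
        have := h.yz.ne
        simp only [List.nodup_cons, List.mem_cons, List.not_mem_nil, not_or, or_false]
        grind) (by simp [hv, h.xy, h.xz, hc, hd])
    simp [h.dx] at this
  have k1 := key a ha
  have k2 := key s hsx.symm
  have := hsa.ne
  have := hsa.symm
  grind

theorem IsTri.exists_outer {x y z : V} (h : IsTri G x y z) : ∃ a, G.Adj x a ∧ a ≠ y ∧ a ≠ z := by
  by_contra! hn
  have : G.neighborFinset x ⊆ {y, z} := fun v hv => by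
    rw [mem_neighborFinset] at hv
    have := hn v hv
    simp; tauto
  have := (Finset.card_le_card this).trans Finset.card_le_two
  rw [card_neighborFinset_eq_degree, h.dx] at this
  omega

theorem IsCore.degree_eq {F T B : Finset V} (hp : ∀ s z T, ¬ IsPair G s z T)
    (hn : 8 ≤ Fintype.card V) (h : IsCore G F T B) {z x : V} (hz : z ∈ F) (hd : G.degree z = 4)
    (hxz : G.Adj x z) : G.degree x = 4 := by
  obtain ⟨s, hs, hsx, hsz⟩ := h.covered z hz x hxz
  obtain ⟨s', hs', hss', hsz'⟩ := h.covered z hz s hsz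
  rw [eq_of_common_neighbors hp hn hs hd hsz hsx hxz.symm hss'.symm hsz'.symm, hs']

theorem IsCore.exists_tri (hc : Conn4 G) (hp : ∀ s z T, ¬ IsPair G s z T)
    (hn : 8 ≤ Fintype.card V) {F T B : Finset V} (h : IsCore G F T B) :
    ∃ x y z, IsTri G x y z ∧ Good G y z x ∧ Good G z x y ∧ (Good G x y z ∨
      (x ∈ T ∧ y ∈ F ∧ z ∈ F ∧ ∀ v ∈ F, G.Adj x v → v = y ∨ v = z)) := by
  obtain ⟨z, hz, hdz⟩ := h.exists_degree hc hp hn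
  obtain ⟨x, hzx⟩ : ∃ x, G.Adj z x := by
    have := G.degree_pos_iff_exists_adj (v := z)
    exact this.1 (by omega)
  obtain ⟨y, hdy, hyx, hyz⟩ := h.covered z hz x hzx.symm
  have hdx := h.degree_eq hp hn hz hdz hzx.symm
  have htri : IsTri G x y z := ⟨hyx.symm, hzx.symm, hyz, hdx, hdy, hdz,
    fun v h1 h2 => eq_of_common_neighbors hp hn hdx hdy hyx.symm h1 h2 hzx.symm hyz,
    fun v h1 h2 => eq_of_common_neighbors hp hn hdx hdz hzx.symm h1 h2 hyx.symm hyz.symm,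
    fun v h1 h2 => eq_of_common_neighbors hp hn hdy hdz hyz h1 h2 hyx hzx⟩
  have hgood : ∀ {x y z}, IsTri G x y z → x ∈ F → Good G x y z := by
    intro x y z ht hx
    obtain ⟨a, ha, hay, haz⟩ := ht.exists_outer
    obtain ⟨s, hs, hsa, hsx⟩ := h.covered x hx a ha.symm
    exact ht.good ha hay haz ⟨s, hs, hsx, hsa⟩
  have hgood' : ∀ {x y z}, IsTri G x y z → z ∈ F → Good G x y z ∨
      (x ∈ T ∧ y ∈ F ∧ z ∈ F ∧ ∀ v ∈ F, G.Adj x v → v = y ∨ v = z) := by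
    intro x y z ht hz
    rcases h.closed z hz x ht.xz.symm with hx | hx
    · exact Or.inl (hgood ht hx)
    by_cases ha : ∃ a ∈ F, G.Adj x a ∧ a ≠ y ∧ a ≠ z
    · obtain ⟨a, haF, ha, hay, haz⟩ := ha
      exact Or.inl (ht.good ha hay haz (h.covered a haF x ha))
    · push Not at ha
      have hx' : ∀ v ∈ F, G.Adj x v → v = y ∨ v = z := fun v hv hxv => by
        have := ha v hv hxv
        tauto
      obtain ⟨v, hv, hvz, hxv⟩ := h.two x hx z
      obtain rfl := (hx' v hv hxv).resolve_right hvz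
      exact Or.inr ⟨hx, hv, hz, hx'⟩
  have hsw : ∀ {v u w}, Good G v u w → Good G v w u := fun h a b h1 h2 h3 h4 h5 h6 h7 =>
    h a b h1 h2 h4 h3 h6 h5 h7
  rcases hgood' htri hz with hx | hx
  · rcases hgood' htri.rotate.swap hz with hy | hy
    · exact ⟨x, y, z, htri, hsw hy, hgood htri.rotate.rotate hz, Or.inl hx⟩
    · exact ⟨y, x, z, htri.rotate.swap, hsw hx, hsw (hgood htri.rotate.rotate hz), Or.inr hy⟩
  · exact ⟨x, y, z, htri, hgood htri.rotate hx.2.1, hgood htri.rotate.rotate hz, Or.inr hx⟩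

end Triangles

section Triangles

open scoped Classical

variable {V : Type*} {G : SimpleGraph V} [Fintype V]

/-- The exceptional position of a triangle: `x` lies in the boundary `T` of the fragment `F`, and
its only neighbours in `F` are the other vertices `y`, `z` of the triangle. -/
structure IsBad (G : SimpleGraph V) (F T B : Finset V) (x y z : V) : Prop where
  sep : IsBigSep G F T B
  tri : IsTri G x y z
  hx : x ∈ T
  hy : y ∈ F
  hz : z ∈ F
  nbr : ∀ v ∈ F, G.Adj x v → v = y ∨ v = z
  degy : ∀ v, G.Adj v y → G.degree v = 4
  degz : ∀ v, G.Adj v z → G.degree v = 4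
  goody : Good G y x z
  goodz : Good G z x y

theorem IsBad.swap {F T B : Finset V} {x y z : V} (h : IsBad G F T B x y z) :
    IsBad G F T B x z y :=
  ⟨h.sep, h.tri.swap, h.hx, h.hz, h.hy, fun v hv hxv => (h.nbr v hv hxv).symm, h.degz, h.degy,
    h.goodz, h.goody⟩

theorem IsBad.false_of_three (hc : Conn4 G) (hp : ∀ s z T, ¬ IsPair G s z T)
    (hn : 8 ≤ Fintype.card V) {F T B : Finset V} {x y z a : V} (h : IsBad G F T B x y z)
    (ha : a ∈ F) (hay : a ≠ y) (haz : a ≠ z) (hF : ∀ v ∈ F, v = y ∨ v = z ∨ v = a) : False := by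
  wlog hza : ¬ G.Adj a z generalizing y z
  · push Not at hza
    refine this h.swap haz hay (fun v hv => ?_) fun hya => ?_
    · have := hF v hv
      clear * - this; tauto
    · have := h.tri.cyz a hya.symm hza.symm
      exact h.sep.sep.notMem_T a ha (this ▸ h.hx)
  have hax : ¬ G.Adj a x := fun hax => by
    rcases h.nbr a ha hax.symm with e | e
    exacts [hay e, haz e]
  have h1 : G.neighborFinset a ⊆ insert y (T.erase x) := fun v hv => by
    rw [mem_neighborFinset] at hv
    simp only [Finset.mem_insert, Finset.mem_erase]
    rcases h.sep.sep.mem_of_adj ha hv with h' | h'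
    · rcases hF v h' with rfl | rfl | rfl
      · simp
      · exact (hza hv).elim
      · exact (hv.ne rfl).elim
    · refine Or.inr ⟨?_, h'⟩
      rintro rfl
      exact hax hv
  have h2 : (insert y (T.erase x)).card ≤ (G.neighborFinset a).card := by
    have := Finset.card_insert_le y (T.erase x)
    rw [Finset.card_erase_of_mem h.hx, h.sep.card] at this
    rw [card_neighborFinset_eq_degree]
    exact this.trans (hc.four_le_degree a)
  have h3 := Finset.eq_of_subset_of_card_le h1 h2
  have h4 : ∀ v ∈ T, v ≠ x → G.Adj a v := fun v hv hvx => by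
    rw [← mem_neighborFinset, h3]
    simp [hv, hvx]
  have h5 : (((G.neighborFinset z).erase x).erase y).card = 2 := by
    rw [Finset.card_erase_of_mem (by simp [h.tri.yz.symm, h.tri.xy.ne']),
      Finset.card_erase_of_mem (by simp [h.tri.xz.symm]), card_neighborFinset_eq_degree, h.tri.dz]
  obtain ⟨c, d, hcd, h6⟩ := Finset.card_eq_two.1 h5
  have h7 : ∀ v, v = c ∨ v = d → G.Adj z v ∧ v ≠ x ∧ v ≠ y ∧ G.Adj a v := by
    intro v hv
    have : v ∈ ((G.neighborFinset z).erase x).erase y := by simpa [h6] using hv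
    simp only [Finset.mem_erase, mem_neighborFinset] at this
    refine ⟨this.2.2, this.2.1, this.1, h4 v ?_ this.2.1⟩
    refine (h.sep.sep.mem_of_adj h.hz this.2.2).resolve_left fun h' => ?_
    rcases hF v h' with rfl | rfl | rfl
    · exact this.1 rfl
    · exact this.2.2.ne rfl
    · exact hza this.2.2.symm
  obtain ⟨c1, c2, c3, c4⟩ := h7 c (Or.inl rfl)
  obtain ⟨d1, d2, d3, d4⟩ := h7 d (Or.inr rfl)
  exact haz (eq_of_common_neighbors hp hn (h.degz c c1.symm) (h.degz d d1.symm)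
    (h.goodz c d c1 d1 c2 c3 d2 d3 hcd) c4.symm d4.symm c1.symm d1.symm)

/-- A separator of size at most five that contains the triangle. -/
structure IsTriSep (G : SimpleGraph V) (x y z : V) (A S B : Finset V) : Prop where
  sep : IsSep G A S B
  hx : x ∈ S
  hy : y ∈ S
  hz : z ∈ S
  card : S.card ≤ 5

omit [Fintype V] in
theorem IsTriSep.symm {x y z : V} {A S B : Finset V} (h : IsTriSep G x y z A S B) :
    IsTriSep G x y z B S A := ⟨h.sep.symm, h.hx, h.hy, h.hz, h.card⟩

omit [Fintype V] in
theorem IsTriSep.swap {x y z : V} {A S B : Finset V} (h : IsTriSep G x y z A S B) :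
    IsTriSep G x z y A S B := ⟨h.sep, h.hx, h.hz, h.hy, h.card⟩

omit [Fintype V] in
theorem IsTriSep.rotate {x y z : V} {A S B : Finset V} (h : IsTriSep G x y z A S B) :
    IsTriSep G y z x A S B := ⟨h.sep, h.hy, h.hz, h.hx, h.card⟩

theorem IsTriSep.exists_adj (hc : Conn4 G) {x y z : V} {A S B : Finset V}
    (h : IsTriSep G x y z A S B) (hxy : x ≠ y) (hx : ∀ a ∈ A, ¬ G.Adj x a) :
    ∃ a ∈ A, G.Adj y a := by
  by_contra! hy
  obtain ⟨b, hb⟩ := h.sep.right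
  have := hc.four_le (A := A) (C := (S.erase x).erase y) (b := b) h.sep.left ?_
    (h.sep.symm.notMem_B b hb) (by simp [h.sep.symm.notMem_T b hb])
  · rw [Finset.card_erase_of_mem (by simp [h.hy, hxy.symm]), Finset.card_erase_of_mem h.hx] at this
    have := h.card
    omega
  · intro a ha v hv
    have h1 := h.sep.mem_of_adj ha hv
    have h2 : v ≠ x := by rintro rfl; exact hx a ha hv.symm
    have h3 : v ≠ y := by rintro rfl; exact hy a ha hv.symm
    simp; tauto

theorem IsTriSep.not_adj_or {x y z : V} {A S B : Finset V}
    (h : IsTriSep G x y z A S B) (hg : Good G x y z) :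
    (∀ a ∈ A, ¬ G.Adj x a) ∨ (∀ b ∈ B, ¬ G.Adj x b) := by
  by_contra! hn
  obtain ⟨⟨a, ha, hxa⟩, b, hb, hxb⟩ := hn
  have h1 := h.sep.notMem_T a ha
  have h2 := h.sep.symm.notMem_T b hb
  refine h.sep.not_adj a ha b hb (hg a b hxa hxb ?_ ?_ ?_ ?_ ?_)
  · rintro rfl; exact h1 h.hy
  · rintro rfl; exact h1 h.hz
  · rintro rfl; exact h2 h.hy
  · rintro rfl; exact h2 h.hz
  · rintro rfl; exact h.sep.notMem_B a ha hb

theorem IsBad.four_le_inter (hc : Conn4 G) {F T K : Finset V} {x y z : V}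
    (h : IsBad G F T K x y z) {A S B : Finset V} (hs : IsTriSep G x y z A S B)
    (hzA : ∀ a ∈ A, ¬ G.Adj z a) {R : Finset V} (hR : R = ((S.erase x).erase y).erase z)
    (hne : (F ∩ A).Nonempty) :
    4 ≤ (T ∩ A).card + 1 + (R ∩ F).card + (R ∩ T).card := by
  have hmem : ∀ v, v ∈ R ↔ v ≠ z ∧ v ≠ y ∧ v ≠ x ∧ v ∈ S := fun v => by simp [hR]
  refine (hc.four_le (A := F ∩ A) (C := (T ∩ A) ∪ {y} ∪ (R ∩ F) ∪ (R ∩ T)) (b := x) hne ?_ ?_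
    ?_).trans ?_
  · intro a ha v hv
    rw [Finset.mem_inter] at ha
    have h1 := h.sep.sep.mem_of_adj ha.1 hv
    have h2 := hs.sep.mem_of_adj ha.2 hv
    have h3 : v ≠ z := by rintro rfl; exact hzA a ha.2 hv.symm
    have h4 : v ≠ x := by
      rintro rfl
      have := hs.sep.notMem_T a ha.2
      rcases h.nbr a ha.1 hv.symm with rfl | rfl
      exacts [this hs.hy, this hs.hz]
    have := hmem v
    simp only [Finset.mem_union, Finset.mem_inter, Finset.mem_singleton]
    tauto
  · have := h.sep.sep.notMem_T x
    have := h.hx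
    simp; tauto
  · have h1 := hmem x
    have h2 := hs.sep.symm
    have h3 := hs.sep.notMem_T x
    have h4 := hs.hx
    have h5 := h.tri.xy.ne
    simp; tauto
  · have h1 := Finset.card_union_le (T ∩ A ∪ {y} ∪ R ∩ F) (R ∩ T)
    have h2 := Finset.card_union_le (T ∩ A ∪ {y}) (R ∩ F)
    have h3 := Finset.card_union_le (T ∩ A) {y}
    rw [Finset.card_singleton] at h3
    omega

theorem IsBad.four_le_inter_compl (hc : Conn4 G) {F T K : Finset V} {x y z : V}
    (h : IsBad G F T K x y z) {A S B : Finset V} (hs : IsTriSep G x y z A S B)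
    {R : Finset V} (hR : R = ((S.erase x).erase y).erase z)
    (hne : (K ∩ A).Nonempty) :
    4 ≤ (T ∩ A).card + 1 + (R ∩ K).card + (R ∩ T).card := by
  have hmem : ∀ v, v ∈ R ↔ v ≠ z ∧ v ≠ y ∧ v ≠ x ∧ v ∈ S := fun v => by simp [hR]
  have hyT := h.sep.sep.notMem_T y h.hy
  have hyK := h.sep.sep.notMem_B y h.hy
  refine (hc.four_le (A := K ∩ A) (C := (T ∩ A) ∪ {x} ∪ (R ∩ K) ∪ (R ∩ T)) (b := y) hne ?_ ?_
    ?_).trans ?_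
  · intro a ha v hv
    rw [Finset.mem_inter] at ha
    have h1 := h.sep.sep.symm.mem_of_adj ha.1 hv
    have h2 := hs.sep.mem_of_adj ha.2 hv
    have h3 : v ≠ z := by rintro rfl; exact h.sep.sep.not_adj v h.hz a ha.1 hv.symm
    have h4 : v ≠ y := by rintro rfl; exact h.sep.sep.not_adj v h.hy a ha.1 hv.symm
    have := hmem v
    simp only [Finset.mem_union, Finset.mem_inter, Finset.mem_singleton]
    tauto
  · simp [hyK]
  · have h5 := h.tri.xy.ne'
    simp; tauto
  · have h1 := Finset.card_union_le (T ∩ A ∪ {x} ∪ R ∩ K) (R ∩ T)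
    have h2 := Finset.card_union_le (T ∩ A ∪ {x}) (R ∩ K)
    have h3 := Finset.card_union_le (T ∩ A) {x}
    rw [Finset.card_singleton] at h3
    omega

theorem IsBad.two_le (hc : Conn4 G) {F T K : Finset V} {x y z : V}
    (h : IsBad G F T K x y z) {A S B : Finset V} (hs : IsTriSep G x y z A S B)
    (hyB : ∀ b ∈ B, ¬ G.Adj y b) {R : Finset V} (hR : R = ((S.erase x).erase y).erase z)
    (hF : F ∩ B = ∅) (hK : K ∩ B = ∅) :
    2 ≤ (T ∩ B).card ∧ 0 < (R ∩ F).card ∧ 0 < (R ∩ K).card := by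
  have hmem : ∀ v, v ∈ R ↔ v ≠ z ∧ v ≠ y ∧ v ≠ x ∧ v ∈ S := fun v => by simp [hR]
  have hBT : ∀ b ∈ B, b ∈ T := fun b hb => by
    have h1 : b ∉ F ∩ B := by simp [hF]
    have h2 : b ∉ K ∩ B := by simp [hK]
    have h3 := h.sep.sep.cover b
    simp only [Finset.mem_inter] at h1 h2
    tauto
  obtain ⟨c, hc1, hxc⟩ := hs.symm.rotate.rotate.swap.rotate.exists_adj hc h.tri.xy.ne' hyB
  obtain ⟨d, hd1, hzd⟩ := hs.symm.rotate.exists_adj hc h.tri.yz.ne hyB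
  have hzc : ¬ G.Adj z c := fun hzc => by
    have := h.tri.cxz c hxc hzc
    exact hs.sep.symm.notMem_T c hc1 (this ▸ hs.hy)
  have hcd : c ≠ d := by
    rintro rfl
    exact hzc hzd
  have hxT := h.sep.sep.notMem_T x
  refine ⟨?_, ?_, ?_⟩
  · rw [← Finset.card_pair hcd]
    refine Finset.card_le_card fun v hv => ?_
    simp only [Finset.mem_insert, Finset.mem_singleton] at hv
    rcases hv with rfl | rfl
    · simp [hc1, hBT]
    · simp [hd1, hBT]
  · obtain ⟨u, hu, hcu⟩ := h.sep.sep.exists_adj hc h.sep.card (hBT c hc1)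
    refine Finset.card_pos.2 ⟨u, ?_⟩
    rw [Finset.mem_inter, hmem]
    refine ⟨⟨?_, ?_, ?_, ?_⟩, hu⟩
    · rintro rfl; exact hzc hcu.symm
    · rintro rfl; exact hyB c hc1 hcu.symm
    · rintro rfl; exact hxT hu h.hx
    · refine (hs.sep.symm.mem_of_adj hc1 hcu).resolve_left fun huB => ?_
      have : u ∈ F ∩ B := by simp [hu, huB]
      simp [hF] at this
  · obtain ⟨u, hu, hcu⟩ := h.sep.sep.symm.exists_adj hc h.sep.card (hBT c hc1)
    refine Finset.card_pos.2 ⟨u, ?_⟩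
    rw [Finset.mem_inter, hmem]
    refine ⟨⟨?_, ?_, ?_, ?_⟩, hu⟩
    · rintro rfl; exact hzc hcu.symm
    · rintro rfl; exact hyB c hc1 hcu.symm
    · rintro rfl; exact h.sep.sep.symm.notMem_T u hu h.hx
    · refine (hs.sep.symm.mem_of_adj hc1 hcu).resolve_left fun huB => ?_
      have : u ∈ K ∩ B := by simp [hu, huB]
      simp [hK] at this

set_option maxHeartbeats 1000000 in
theorem IsBad.false (hc : Conn4 G) (hp : ∀ s z T, ¬ IsPair G s z T)
    (hn : 8 ≤ Fintype.card V) {F T K : Finset V} {x y z : V}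
    (h : IsBad G F T K x y z) {A S B : Finset V} (hs : IsTriSep G x y z A S B)
    (hzA : ∀ a ∈ A, ¬ G.Adj z a) (hyB : ∀ b ∈ B, ¬ G.Adj y b) : False := by
  obtain ⟨R, hR⟩ : ∃ R, R = ((S.erase x).erase y).erase z := ⟨_, rfl⟩
  have hR' : R = ((S.erase x).erase z).erase y := by rw [hR, Finset.erase_right_comm]
  have hmem : ∀ v, v ∈ R ↔ v ≠ z ∧ v ≠ y ∧ v ≠ x ∧ v ∈ S := fun v => by simp [hR]
  have i1 := h.four_le_inter hc hs hzA hR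
  have i2 := h.swap.four_le_inter hc hs.symm.swap hyB hR'
  have i3 := h.four_le_inter_compl hc hs hR
  have i4 := h.four_le_inter_compl hc hs.symm hR
  have i5 := h.two_le hc hs hyB hR
  have i6 := h.swap.two_le hc hs.symm.swap hzA hR'
  have hF3 := h.sep.three_le hp
  have hK3 := h.sep.symm.three_le hp
  have hT := h.sep.card
  have cR := h.sep.sep.card_inter R
  have cF := hs.sep.card_inter F
  have cT := hs.sep.card_inter T
  have cK := hs.sep.card_inter K
  have cA := h.sep.sep.card_inter A
  have cB := h.sep.sep.card_inter B
  rw [Finset.inter_comm A F, Finset.inter_comm A T, Finset.inter_comm A K] at cA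
  rw [Finset.inter_comm B F, Finset.inter_comm B T, Finset.inter_comm B K] at cB
  have hA := Finset.card_pos.2 hs.sep.left
  have hB := Finset.card_pos.2 hs.sep.right
  have hRc : R.card ≤ 2 := by
    rw [hR, Finset.card_erase_of_mem (by simp [hs.hz, h.tri.yz.ne', h.tri.xz.ne']),
      Finset.card_erase_of_mem (by simp [hs.hy, h.tri.xy.ne']), Finset.card_erase_of_mem hs.hx]
    have := hs.card
    omega
  have hTS : (R ∩ T).card + 1 ≤ (T ∩ S).card := by
    rw [← Finset.card_insert_of_notMem (a := x) (by simp [hmem])]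
    refine Finset.card_le_card fun v hv => ?_
    rw [Finset.mem_insert, Finset.mem_inter, hmem] at hv
    rw [Finset.mem_inter]
    rcases hv with rfl | hv
    · exact ⟨h.hx, hs.hx⟩
    · exact ⟨hv.2, hv.1.2.2.2⟩
  have hKS : (K ∩ S).card ≤ (R ∩ K).card := by
    refine Finset.card_le_card fun v hv => ?_
    rw [Finset.mem_inter] at hv
    rw [Finset.mem_inter, hmem]
    refine ⟨⟨?_, ?_, ?_, hv.2⟩, hv.1⟩
    · rintro rfl; exact h.sep.sep.notMem_B v h.hz hv.1
    · rintro rfl; exact h.sep.sep.notMem_B v h.hy hv.1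
    · rintro rfl; exact h.sep.sep.disj v h.hx hv.1
  have hFS' : ∀ v ∈ F, v ∈ S → v = y ∨ v = z ∨ v ∈ R ∩ F := by
    intro v hv hvS
    have : v ≠ x := by rintro rfl; exact h.sep.sep.notMem_T v hv h.hx
    rw [Finset.mem_inter, hmem]
    clear * - hv hvS this
    tauto
  have hFS : (F ∩ S).card ≤ 2 + (R ∩ F).card := by
    have h1 : F ∩ S ⊆ {y, z} ∪ (R ∩ F) := fun v hv => by
      rw [Finset.mem_inter] at hv
      have := hFS' v hv.1 hv.2
      simp only [Finset.mem_union, Finset.mem_insert, Finset.mem_singleton]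
      clear * - this
      tauto
    have h2 := (Finset.card_le_card h1).trans (Finset.card_union_le _ _)
    have : ({y, z} : Finset V).card ≤ 2 := Finset.card_le_two
    omega
  have i7 : (R ∩ F).card = 1 → (F ∩ A).card = 0 → (F ∩ B).card = 0 → False := by
    intro h1 h2 h3
    obtain ⟨a, ha⟩ := Finset.card_eq_one.1 h1
    have haR : a ∈ R ∩ F := by simp [ha]
    rw [Finset.mem_inter, hmem] at haR
    refine h.false_of_three hc hp hn haR.2 haR.1.2.1 haR.1.1 fun v hv => ?_
    rw [Finset.card_eq_zero] at h2 h3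
    have h4 : v ∉ F ∩ A := by simp [h2]
    have h5 : v ∉ F ∩ B := by simp [h3]
    have h6 := hs.sep.cover v
    simp only [Finset.mem_inter] at h4 h5
    have h7 := hFS' v hv (by clear * - h4 h5 h6 hv; tauto)
    rwa [ha, Finset.mem_singleton] at h7
  simp only [← Finset.card_pos, ← Finset.card_eq_zero] at i1 i2 i3 i4 i5 i6
  omega

theorem IsCore.six_le (hc : Conn4 G) (hp : ∀ s z T, ¬ IsPair G s z T)
    (hn : 8 ≤ Fintype.card V) {F T K : Finset V} (h : IsCore G F T K) :
    ∃ x y z, IsTri G x y z ∧ ∀ A S B, IsSep G A S B → {x, y, z} ⊆ S → 6 ≤ S.card := by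
  obtain ⟨x, y, z, ht, hy, hz, hx⟩ := h.exists_tri hc hp hn
  refine ⟨x, y, z, ht, fun A S B hs hS => ?_⟩
  by_contra hlt
  have hts : IsTriSep G x y z A S B :=
    ⟨hs, hS (by simp), hS (by simp), hS (by simp), by omega⟩
  have key : ∀ {A B}, IsTriSep G x y z A S B → ¬ ((∀ a ∈ A, ¬ G.Adj y a) ∧ ∀ a ∈ A, ¬ G.Adj z a) := by
    intro A B hts ⟨h1, h2⟩
    obtain ⟨a, ha, hza⟩ := hts.rotate.exists_adj hc ht.yz.ne h1
    exact h2 a ha hza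
  have k1 := key hts
  have k2 := key hts.symm
  have g1 := hts.rotate.not_adj_or hy
  have g2 := hts.rotate.rotate.not_adj_or hz
  rcases hx with hx | ⟨hxT, hyF, hzF, hnbr⟩
  · have key' : ∀ {A B}, IsTriSep G x y z A S B → ¬ ((∀ a ∈ A, ¬ G.Adj x a) ∧
        ((∀ a ∈ A, ¬ G.Adj y a) ∨ ∀ a ∈ A, ¬ G.Adj z a)) := by
      rintro A B hts ⟨h1, h2 | h2⟩
      · obtain ⟨a, ha, hza⟩ := hts.exists_adj hc ht.xy.ne h1
        exact h2 a ha hza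
      · obtain ⟨a, ha, hza⟩ := hts.swap.exists_adj hc ht.xz.ne h1
        exact h2 a ha hza
    have k3 := key' hts
    have k4 := key' hts.symm
    have g3 := hts.not_adj_or hx
    tauto
  · have hsw : ∀ {v u w}, Good G v u w → Good G v w u := fun h a b h1 h2 h3 h4 h5 h6 h7 =>
      h a b h1 h2 h4 h3 h6 h5 h7
    have hbad : IsBad G F T K x y z := ⟨h.sep.resolve_left (by rintro rfl; simp at hxT), ht, hxT,
      hyF, hzF, hnbr, fun v hv => h.degree_eq hp hn hyF ht.dy hv,
      fun v hv => h.degree_eq hp hn hzF ht.dz hv, hsw hy, hz⟩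
    have b1 := hbad.false hc hp hn hts
    have b2 := hbad.false hc hp hn hts.symm
    tauto

end Triangles

section Contraction
open scoped Classical
variable {V : Type*} {G : SimpleGraph V} [Fintype V]

omit [Fintype V] in
theorem injOn_getD {l : List V} (hl : l.Nodup) {n : ℕ} (hn : l.length = n) (v : V) :
    Set.InjOn (fun i => l.getD i v) (Set.Iio n) := by
  subst hn
  intro i hi j hj hij
  simp only [List.getD_eq_getElem _ _ (Set.mem_Iio.1 hi),
    List.getD_eq_getElem _ _ (Set.mem_Iio.1 hj)] at hij
  exact (hl.getElem_inj_iff).1 hij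

theorem isMinorOf_of_card_eq_seven (hn : Fintype.card V = 7) (hdeg : ∀ v, 4 ≤ G.degree v) (v : V)
    (hv : ∀ u, u ≠ v → G.Adj v u) : (wheel 6).IsMinorOf G := by
  have hnd : (v :: (Finset.univ.erase v).toList).Nodup := by
    rw [List.nodup_cons]
    exact ⟨by simp, Finset.nodup_toList _⟩
  have hlen : (v :: (Finset.univ.erase v).toList).length = 7 := by
    simp [Finset.card_erase_of_mem, hn]
  have hinj := injOn_getD hnd hlen v
  refine isMinorOf_of_dominating hn hinj hdeg fun i hi h0 => hv _ fun h => h0 ?_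
  exact hinj (Set.mem_Iio.2 hi) (Set.mem_Iio.2 (by omega)) h

theorem isMinorOf_of_six_le_degree (hn : Fintype.card V = 7) (hdeg : ∀ v, 4 ≤ G.degree v) (v : V)
    (hv : 6 ≤ G.degree v) : (wheel 6).IsMinorOf G := by
  refine isMinorOf_of_card_eq_seven hn hdeg v fun u hu => ?_
  have h1 : G.neighborFinset v ⊆ Finset.univ.erase v := fun w hw => by
    simpa using ((G.mem_neighborFinset v w).1 hw).ne'
  have h2 := Finset.eq_of_subset_of_card_le h1 (by
    rw [Finset.card_erase_of_mem (Finset.mem_univ _), Finset.card_univ,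
      G.card_neighborFinset_eq_degree]
    omega)
  rw [← G.mem_neighborFinset, h2]
  simpa using hu

theorem card_le_degree_contract {S N : Finset V}
    (h : ∀ v ∈ N, v ∉ S ∧ ∃ s ∈ S, G.Adj s v) : N.card ≤ (contract G S).degree none := by
  rw [← Finset.card_image_of_injOn (f := proj S), ← card_neighborFinset_eq_degree]
  · refine Finset.card_le_card fun w hw => ?_
    obtain ⟨v, hv, rfl⟩ := Finset.mem_image.1 hw
    rw [mem_neighborFinset, (proj_eq_some (w := ⟨v, (h v hv).1⟩)).2 rfl, contract_adj_none]
    exact (h v hv).2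
  · intro u hu v hv huv
    rw [(proj_eq_some (w := ⟨v, (h v hv).1⟩)).2 rfl] at huv
    exact proj_eq_some.1 huv

theorem IsTri.six_le_degree_contract {x y z : V} (h : IsTri G x y z) :
    6 ≤ (contract G {x, y, z}).degree none := by
  have key : ∀ {x y z}, IsTri G x y z → 2 ≤ (G.neighborFinset x \ {x, y, z}).card := by
    intro x y z h
    have h1 : G.neighborFinset x \ {x, y, z} = G.neighborFinset x \ {y, z} := by
      ext v
      simp only [Finset.mem_sdiff, mem_neighborFinset, Finset.mem_insert]
      exact and_congr_right fun hv => by simp [hv.ne']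
    have h2 := Finset.le_card_sdiff {y, z} (G.neighborFinset x)
    have h3 : ({y, z} : Finset V).card ≤ 2 := Finset.card_le_two
    rw [card_neighborFinset_eq_degree, h.dx] at h2
    rw [h1]
    omega
  have kx := key h
  have ky := key h.rotate
  have kz := key h.rotate.rotate
  have e1 : ({y, z, x} : Finset V) = {x, y, z} := by ext; simp; tauto
  have e2 : ({z, x, y} : Finset V) = {x, y, z} := by ext; simp; tauto
  rw [e1] at ky
  rw [e2] at kz
  have d1 : Disjoint (G.neighborFinset x \ {x, y, z}) (G.neighborFinset y \ {x, y, z}) := by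
    rw [Finset.disjoint_left]
    intro v h1 h2
    simp only [Finset.mem_sdiff, mem_neighborFinset] at h1 h2
    exact h1.2 (by simp [h.cxy v h1.1 h2.1])
  have d2 : Disjoint ((G.neighborFinset x \ {x, y, z}) ∪ (G.neighborFinset y \ {x, y, z}))
      (G.neighborFinset z \ {x, y, z}) := by
    rw [Finset.disjoint_left]
    intro v h1 h2
    simp only [Finset.mem_sdiff, mem_neighborFinset, Finset.mem_union] at h1 h2
    rcases h1 with h1 | h1
    · exact h1.2 (by simp [h.cxz v h1.1 h2.1])
    · exact h1.2 (by simp [h.cyz v h1.1 h2.1])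
  refine le_trans ?_ (card_le_degree_contract (N := ((G.neighborFinset x \ {x, y, z}) ∪
    (G.neighborFinset y \ {x, y, z})) ∪ (G.neighborFinset z \ {x, y, z})) ?_)
  · rw [Finset.card_union_of_disjoint d2, Finset.card_union_of_disjoint d1]
    omega
  · intro v hv
    simp only [Finset.mem_sdiff, mem_neighborFinset, Finset.mem_union] at hv
    rcases hv with (hv | hv) | hv
    · exact ⟨hv.2, x, by simp, hv.1⟩
    · exact ⟨hv.2, y, by simp, hv.1⟩
    · exact ⟨hv.2, z, by simp, hv.1⟩

theorem isMinorOf_of_list_cert {m : ℕ} {pos neg : List (ℕ × ℕ)} (t : Cert)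
    (ht : t.check 8 (contractFew m) (contractOne m) (maskOf pos) (maskOf neg) = true)
    (hm : m ≤ 6) (hcard : Fintype.card V = 8) {x y : V} {l : List V} (hl : (x :: y :: l).Nodup)
    (hlen : l.length = 6) (hdeg : ∀ v, 4 ≤ G.degree v)
    (hboth : ∀ v, G.Adj x v → G.Adj y v → 5 ≤ G.degree v)
    (hor : ∀ i < m, G.Adj x (l.getD i x) ∨ G.Adj y (l.getD i x))
    (hmiss : ∀ v, v ≠ x → v ≠ y → G.Adj x v ∨ G.Adj y v → ∃ w, w ≠ x ∧ w ≠ y ∧ w ≠ v ∧ ¬ G.Adj v w)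
    (hpos : ∀ p ∈ pos, G.Adj ((x :: y :: l).getD p.1 x) ((x :: y :: l).getD p.2 x))
    (hneg : ∀ p ∈ neg, ¬ G.Adj ((x :: y :: l).getD p.1 x) ((x :: y :: l).getD p.2 x)) :
    (wheel 6).IsMinorOf G := by
  have hinj := injOn_getD hl (n := 8) (by simp [hlen]) x
  have hor' : ∀ i, 2 ≤ i → i < 2 + m → G.Adj x ((x :: y :: l).getD i x) ∨
      G.Adj y ((x :: y :: l).getD i x) := fun i h1 h2 => by
    obtain ⟨i, rfl⟩ := Nat.exists_eq_add_of_le' h1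
    simpa using hor i (by omega)
  refine isMinorOf_of_contract_cert t ht hm hcard hinj hdeg hboth hor' ?_ hpos hneg
  intro i h1 h2
  have hx : (x :: y :: l).getD i x ≠ x := fun h => by
    have := hinj (Set.mem_Iio.2 (show i < 8 by omega)) (Set.mem_Iio.2 (show 0 < 8 by omega)) h
    omega
  have hy : (x :: y :: l).getD i x ≠ y := fun h => by
    have := hinj (Set.mem_Iio.2 (show i < 8 by omega)) (Set.mem_Iio.2 (show 1 < 8 by omega)) h
    omega
  obtain ⟨w, hwx, hwy, hwi, hw⟩ := hmiss _ hx hy (hor' i h1 h2)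
  obtain ⟨j, hj, rfl⟩ := List.getElem_of_mem (mem_list_of_nodup hl (by simp [hlen, hcard]) w)
  rw [← List.getD_eq_getElem _ x hj] at hwx hwy hwi hw
  refine ⟨j, ?_, by simpa [hlen] using hj, fun h => hwi (by rw [h]), hw⟩
  by_contra hj2
  obtain rfl | rfl : j = 0 ∨ j = 1 := by omega
  · exact hwx rfl
  · exact hwy rfl

end Contraction

section ContractibleEdge
open scoped Classical
variable {V : Type*} {G : SimpleGraph V} [Fintype V]

theorem length_add_degree_le_card {v : V} {l : List V} (hl : l.Nodup)
    (h : ∀ u ∈ l, ¬ G.Adj v u) : l.length + G.degree v ≤ Fintype.card V := by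
  rw [← List.toFinset_card_of_nodup hl, ← card_neighborFinset_eq_degree,
    ← Finset.card_union_of_disjoint]
  · exact Finset.card_le_univ _
  · rw [Finset.disjoint_left]
    intro u hu hvu
    exact h u (List.mem_toFinset.1 hu) ((mem_neighborFinset _ _ _).1 hvu)

theorem exists_append_nodup {l : List V} (hl : l.Nodup) :
    ∃ l' : List V, (l ++ l').Nodup ∧ l.length + l'.length = Fintype.card V := by
  refine ⟨(Finset.univ \ l.toFinset).toList, ?_, ?_⟩
  · refine List.nodup_append.2 ⟨hl, Finset.nodup_toList _, fun a ha b hb hab => ?_⟩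
    subst hab
    simp at hb
    exact hb ha
  · rw [Finset.length_toList, ← List.toFinset_card_of_nodup hl,
      Finset.card_sdiff_of_subset (Finset.subset_univ _), Finset.card_univ]
    have := Finset.card_le_univ l.toFinset
    omega

theorem five_le_degree (hc : Conn4 G) (hn : 6 ≤ Fintype.card V) {x y : V}
    (hno : ∀ A T B, IsSep G A T B → x ∈ T → y ∈ T → 5 ≤ T.card) {v : V} (hx : G.Adj x v)
    (hy : G.Adj y v) : 5 ≤ G.degree v := by
  by_contra hd
  have h4 := hc.four_le_degree v
  have hins : (insert v (G.neighborFinset v)).card ≤ 5 := by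
    refine (Finset.card_insert_le _ _).trans ?_
    rw [card_neighborFinset_eq_degree]
    omega
  obtain ⟨b, hb⟩ : ∃ b, b ∉ insert v (G.neighborFinset v) := by
    by_contra! h
    rw [Finset.eq_univ_iff_forall.2 h, Finset.card_univ] at hins
    omega
  have := hno {v} (G.neighborFinset v) (Finset.univ \ insert v (G.neighborFinset v))
    ⟨by simp, ⟨b, by simpa using hb⟩, fun u => by simp; tauto, by simp, by simp, by simp; tauto, by simp⟩
    (by simpa using hx.symm) (by simpa using hy.symm)
  rw [card_neighborFinset_eq_degree] at this
  omega

theorem Conn4.contract_edge (hc : Conn4 G) (hn : 6 ≤ Fintype.card V) {x y : V} (hxy : G.Adj x y)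
    (hno : ∀ A T B, IsSep G A T B → x ∈ T → y ∈ T → 5 ≤ T.card) :
    Conn4 (WheelMinor.contract G {x, y}) := by
  have hcard : ({x, y} : Finset V).card = 2 := Finset.card_pair hxy.ne
  refine hc.contract (by simp) (by omega) fun A T B hs hT => ?_
  have := hno A T B hs (hT (by simp)) (hT (by simp))
  omega

omit [Fintype V] in
theorem isMinorOf_of_contract_edge {W : Type*} {H : SimpleGraph W} {x y : V} (hxy : G.Adj x y)
    (h : H.IsMinorOf (contract G {x, y})) : H.IsMinorOf G := by
  refine isMinorOf_of_contract (by simp) ?_ h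
  simp only [Finset.mem_insert, Finset.mem_singleton]
  rintro u (rfl | rfl) v (rfl | rfl) huv
  · exact (huv rfl).elim
  · exact hxy
  · exact hxy.symm
  · exact (huv rfl).elim

omit [Fintype V] in
theorem contract_edge_adj_none {x y : V} {w : {v : V // v ∉ ({x, y} : Finset V)}} :
    (contract G {x, y}).Adj none (some w) ↔ G.Adj x w ∨ G.Adj y w := by
  simp [contract_adj_none]

theorem isMinorOf_of_contractible_edge_eight (hc : Conn4 G) (hn : Fintype.card V = 8) {x y : V}
    (hxy : G.Adj x y) (hno : ∀ A T B, IsSep G A T B → x ∈ T → y ∈ T → 5 ≤ T.card) :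
    (wheel 6).IsMinorOf G := by
  have hC := hc.contract_edge (by omega) hxy hno
  have hCn : Fintype.card (Option {v : V // v ∉ ({x, y} : Finset V)}) = 7 := by
    have := card_contract (S := ({x, y} : Finset V))
    rw [Finset.card_pair hxy.ne] at this
    omega
  by_contra hW
  have hdom : ∀ v, ∃ u, u ≠ v ∧ ¬ (contract G {x, y}).Adj v u := by
    intro v
    by_contra! h
    exact hW (isMinorOf_of_contract_edge hxy
      (isMinorOf_of_card_eq_seven hCn hC.four_le_degree v h))
  have hmiss : ∀ v, v ≠ x → v ≠ y → G.Adj x v ∨ G.Adj y v →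
      ∃ w, w ≠ x ∧ w ≠ y ∧ w ≠ v ∧ ¬ G.Adj v w := by
    intro v hvx hvy hv
    obtain ⟨u | ⟨w, hw⟩, huv, hu⟩ := hdom (some ⟨v, by simp [hvx, hvy]⟩)
    · exact (hu (contract_edge_adj_none.2 hv).symm).elim
    · rw [contract_adj_some] at hu
      simp only [Finset.mem_insert, Finset.mem_singleton, not_or] at hw
      exact ⟨w, hw.1, hw.2, by simpa using huv, hu⟩
  obtain ⟨d, hdx, hdy, hxd, hyd⟩ : ∃ d, d ≠ x ∧ d ≠ y ∧ ¬ G.Adj x d ∧ ¬ G.Adj y d := by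
    obtain ⟨u | ⟨w, hw⟩, huv, hu⟩ := hdom none
    · exact (huv rfl).elim
    · simp only [Finset.mem_insert, Finset.mem_singleton, not_or] at hw
      rw [contract_edge_adj_none, not_or] at hu
      exact ⟨w, hw.1, hw.2, hu.1, hu.2⟩
  have hboth : ∀ v, G.Adj x v → G.Adj y v → 5 ≤ G.degree v := fun v h1 h2 =>
    five_le_degree hc (by omega) hno h1 h2
  have hxyne := hxy.ne
  have hX : 3 ≤ ((G.neighborFinset x).erase y).card := by
    rw [Finset.card_erase_of_mem (by simpa using hxy), card_neighborFinset_eq_degree]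
    have := hc.four_le_degree x
    omega
  have hmemX : ∀ v, v ∈ (G.neighborFinset x).erase y ↔ v ≠ y ∧ G.Adj x v := fun v => by simp
  by_cases h2 : ∃ d', d' ≠ x ∧ d' ≠ y ∧ d' ≠ d ∧ ¬ G.Adj x d' ∧ ¬ G.Adj y d'
  · obtain ⟨d', hdx', hdy', hdd, hxd', hyd'⟩ := h2
    have hP : ∀ v, v ≠ x → v ≠ y → v ≠ d → v ≠ d' → G.Adj x v ∨ G.Adj y v := by
      intro v h1 h2 h3 h4
      by_contra! h5
      have hl : [x, y, d, d', v].Nodup := by simp; grind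
      have := hc.four_le (A := {x, y}) (C := Finset.univ \ [x, y, d, d', v].toFinset) (b := d)
        (by simp) (fun a ha u hu => by
          simp only [Finset.mem_insert, Finset.mem_singleton] at ha
          simp
          grind) (by simp [hdx, hdy]) (by simp)
      rw [Finset.card_sdiff_of_subset (Finset.subset_univ _), List.toFinset_card_of_nodup hl,
        Finset.card_univ, hn] at this
      simp at this
    obtain ⟨a, ha, b, hb, c, hc', hab, hac, hbc⟩ := Finset.two_lt_card.1 hX
    rw [hmemX] at ha hb hc'
    have hl : [x, y, d, d', a, b, c].Nodup := by
      have := ha.2.ne'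
      have := hb.2.ne'
      have := hc'.2.ne'
      simp
      grind
    obtain ⟨l', hl', hlen⟩ := exists_append_nodup hl
    obtain ⟨e, rfl⟩ : ∃ e, l' = [e] := List.length_eq_one_iff.1 (by simp at hlen; omega)
    have hl2 : [x, y, a, b, c, e, d, d'].Nodup := by
      clear * - hl'
      simp at hl' ⊢
      grind
    refine hW (isMinorOf_of_list_cert contractCertTwo contractCertTwo_check (by omega) hn hl2 rfl
      hc.four_le_degree hboth ?_ hmiss ?_ ?_)
    · intro i hi
      have he := hP e
      interval_cases i <;> simp <;> clear * - ha hb hc' he hl2 <;> simp at hl2 <;> grind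
    · simp [hxy, ha, hb, hc']
    · simp [*]
  · push Not at h2
    have hP : ∀ v, v ≠ x → v ≠ y → v ≠ d → G.Adj x v ∨ G.Adj y v := fun v h1 h3 h4 => by
      by_contra! h5
      exact h5.2 (h2 v h1 h3 h4 h5.1)
    have hdeg := hc.four_le_degree d
    by_cases hg : ∃ g, g ≠ x ∧ g ≠ y ∧ g ≠ d ∧ ¬ G.Adj d g
    · obtain ⟨g, hgx, hgy, hgd, hdg⟩ := hg
      have hX2 : 2 ≤ (((G.neighborFinset x).erase y).erase g).card := by
        have := Finset.pred_card_le_card_erase (s := (G.neighborFinset x).erase y) (a := g)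
        omega
      obtain ⟨a, ha, b, hb, hab⟩ := Finset.one_lt_card.1 hX2
      rw [Finset.mem_erase, hmemX] at ha hb
      have hl : [x, y, g, d, a, b].Nodup := by
        have := ha.2.2.ne'
        have := hb.2.2.ne'
        simp
        grind
      obtain ⟨l', hl', hlen⟩ := exists_append_nodup hl
      obtain ⟨c, e, rfl⟩ : ∃ c e, l' = [c, e] := List.length_eq_two.1 (by simp at hlen; omega)
      have hl2 : [x, y, a, b, c, e, g, d].Nodup := by
        clear * - hl'
        simp at hl' ⊢
        grind
      have hd : ∀ v, v ≠ x → v ≠ y → v ≠ g → v ≠ d → G.Adj d v := by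
        intro v h1 h2 h3 h4
        by_contra h5
        have := length_add_degree_le_card (G := G) (v := d) (l := [x, y, g, d, v])
          (by simp; grind) (by
            rw [G.adj_comm] at hxd hyd
            simp [*])
        simp at this
        omega
      refine hW (isMinorOf_of_list_cert contractCertMiss contractCertMiss_check (by omega) hn hl2
        rfl hc.four_le_degree hboth ?_ hmiss ?_ ?_)
      · intro i hi
        have h1 := hP c
        have h2 := hP e
        have h3 := hP g
        interval_cases i <;> simp <;> clear * - ha hb h1 h2 h3 hl2 <;> simp at hl2 <;> grind
      · have h1 := hd a
        have h2 := hd b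
        have h3 := hd c
        have h4 := hd e
        clear * - ha hb h1 h2 h3 h4 hl2 hxy
        simp at hl2 ⊢
        grind
      · simp [*]
    · push Not at hg
      obtain ⟨a, ha, b, hb, c, hc', hab, hac, hbc⟩ := Finset.two_lt_card.1 hX
      rw [hmemX] at ha hb hc'
      have hl : [x, y, d, a, b, c].Nodup := by
        have := ha.2.ne'
        have := hb.2.ne'
        have := hc'.2.ne'
        simp
        grind
      obtain ⟨l', hl', hlen⟩ := exists_append_nodup hl
      obtain ⟨e, g, rfl⟩ : ∃ c e, l' = [c, e] := List.length_eq_two.1 (by simp at hlen; omega)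
      have hl2 : [x, y, a, b, c, e, g, d].Nodup := by
        clear * - hl'
        simp at hl' ⊢
        grind
      refine hW (isMinorOf_of_list_cert contractCertFull contractCertFull_check (by omega) hn hl2
        rfl hc.four_le_degree hboth ?_ hmiss ?_ ?_)
      · intro i hi
        have h1 := hP e
        have h2 := hP g
        interval_cases i <;> simp <;> clear * - ha hb hc' h1 h2 hl2 <;> simp at hl2 <;> grind
      · have h1 := hg a
        have h2 := hg b
        have h3 := hg c
        have h4 := hg e
        have h5 := hg g
        clear * - ha hb hc' h1 h2 h3 h4 h5 hl2 hxy
        simp at hl2 ⊢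
        grind
      · simp [*]

end ContractibleEdge

theorem cycleSq_adj_add {n : ℕ} (a i j : ZMod n) :
    (cycleSq n).Adj (a + i) (a + j) ↔ (cycleSq n).Adj i j := by
  simp [cycleSq, SimpleGraph.fromRel_adj, add_assoc]

theorem cycleSq_eight_adj : ∀ i < 8, ∀ j < 8, i < j → ((cycleSq 8).Adj (i : ℕ) (j : ℕ) ↔
    j = i + 1 ∨ j = i + 2 ∨ j = i + 6 ∨ j = i + 7) := by
  simp only [cycleSq, SimpleGraph.fromRel_adj]
  intro i hi j hj hij
  interval_cases i <;> interval_cases j <;> decide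

theorem cycleSq_degree_le (v : ZMod 8) [Fintype ((cycleSq 8).neighborSet v)] :
    (cycleSq 8).degree v ≤ 4 := by
  have : (cycleSq 8).neighborFinset v ⊆ {v + 1, v + 2, v - 1, v - 2} := fun u hu => by
    rw [mem_neighborFinset, cycleSq, SimpleGraph.fromRel_adj] at hu
    simp only [Finset.mem_insert, Finset.mem_singleton]
    grind
  rw [← card_neighborFinset_eq_degree]
  exact (Finset.card_le_card this).trans Finset.card_le_four

section ContractibleEdge
open scoped Classical
variable {V : Type*} {G : SimpleGraph V} [Fintype V]

theorem isMinorOf_of_contract_iso_cycleSq (hc : Conn4 G) (hn : Fintype.card V = 9) {x y : V}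
    (hxy : G.Adj x y) (e : contract G {x, y} ≃g cycleSq 8) : (wheel 6).IsMinorOf G := by
  have hsome : ∀ i : ℕ, ∃ v : V, i < 8 → 0 < i → ∃ hv : v ∉ ({x, y} : Finset V),
      e.symm (e none + (i : ZMod 8)) = some ⟨v, hv⟩ := by
    intro i
    by_cases hi : i < 8 ∧ 0 < i
    · rcases hu : e.symm (e none + (i : ZMod 8)) with _ | ⟨v, hv⟩
      · replace hu := congrArg e hu
        rw [e.apply_symm_apply, add_eq_left, ZMod.natCast_eq_zero_iff] at hu
        exact absurd (Nat.le_of_dvd hi.2 hu) (by omega)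
      · exact ⟨v, fun _ _ => ⟨hv, rfl⟩⟩
    · exact ⟨x, fun h1 h2 => (hi ⟨h1, h2⟩).elim⟩
  choose c hc' using hsome
  have hcS : ∀ i < 8, 0 < i → c i ≠ x ∧ c i ≠ y := fun i h1 h2 => by
    simpa using (hc' i h1 h2).choose
  have hcinj : ∀ i < 8, ∀ j < 8, 0 < i → 0 < j → c i = c j → i = j := by
    intro i hi j hj hi0 hj0 hij
    obtain ⟨h1, h2⟩ := hc' i hi hi0
    obtain ⟨h3, h4⟩ := hc' j hj hj0
    have : e.symm (e none + (i : ZMod 8)) = e.symm (e none + (j : ZMod 8)) := by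
      rw [h2, h4]
      simp [hij]
    rw [e.symm.injective.eq_iff, add_right_inj, ZMod.natCast_eq_natCast_iff'] at this
    rwa [Nat.mod_eq_of_lt hi, Nat.mod_eq_of_lt hj] at this
  have hadj : ∀ i < 8, ∀ j < 8, 0 < i → i < j →
      (G.Adj (c i) (c j) ↔ j = i + 1 ∨ j = i + 2 ∨ j = i + 6) := by
    intro i hi j hj hi0 hij
    obtain ⟨h1, h2⟩ := hc' i hi hi0
    obtain ⟨h3, h4⟩ := hc' j hj (by omega)
    have := cycleSq_eight_adj i hi j hj hij
    rw [← cycleSq_adj_add (e none), ← e.symm.map_adj_iff, h2, h4, contract_adj_some] at this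
    rw [this]
    omega
  have hnone : ∀ i < 8, 0 < i → ((G.Adj x (c i) ∨ G.Adj y (c i)) ↔ i ≤ 2 ∨ 6 ≤ i) := by
    intro i hi hi0
    obtain ⟨h1, h2⟩ := hc' i hi hi0
    have := cycleSq_eight_adj 0 (by omega) i hi hi0
    rw [← cycleSq_adj_add (e none), ← e.symm.map_adj_iff, h2, Nat.cast_zero, add_zero,
      e.symm_apply_apply, contract_edge_adj_none] at this
    rw [this]
    omega
  have hf0 : ∀ i < 8, 0 < i → (if i = 0 then x else if i = 8 then y else c i) = c i :=
    fun i h1 h2 => by rw [if_neg (by omega), if_neg (by omega)]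
  refine isMinorOf_of_split_cycleSq (f := fun i => if i = 0 then x else if i = 8 then y else c i)
    ?_ (by simpa using hxy) ?_ ?_ ?_ hn hc.four_le_degree
  · intro i hi j hj hij
    rw [Set.mem_Iio] at hi hj
    have h1 := hcS i
    have h2 := hcS j
    have h3 := hcinj i
    have h4 := hxy.ne
    grind
  · intro i hi j hj hi0 hij
    simp only [hf0 i hi hi0, hf0 j hj (by omega)]
    exact hadj i hi j hj hi0 hij
  · intro i h1 h2
    have := hnone i (by omega) (by omega)
    simp only [hf0 i (by omega) (by omega), if_true, if_neg (show (8 : ℕ) ≠ 0 by decide)]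
    rw [← not_or, this]
    omega
  · intro i hi hi0 h
    simp only [hf0 i hi hi0, if_true, if_neg (show (8 : ℕ) ≠ 0 by decide)]
    exact (hnone i hi hi0).2 h

end ContractibleEdge

open scoped Classical in
theorem Conn4.isMinorOf_or_iso (n : ℕ) {V : Type*} [Fintype V] {G : SimpleGraph V} (hc : Conn4 G)
    (hn : Fintype.card V = n + 8) :
    (wheel 6).IsMinorOf G ∨ (Fintype.card V = 8 ∧ Nonempty (G ≃g cycleSq 8)) := by
  induction n using Nat.strong_induction_on generalizing V with
  | _ n ih =>
  by_cases hcrit : Critical G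
  · by_cases hp : ∃ s z T, IsPair G s z T
    · obtain ⟨s, z, T, h⟩ := hp
      exact h.result hc hcrit (by omega)
    · push Not at hp
      obtain ⟨F, T, K, hF⟩ := exists_isCore hc hcrit hp
      obtain ⟨x, y, z, ht, h6⟩ := hF.six_le hc hp (by omega)
      have hS : ({x, y, z} : Finset V).card = 3 :=
        Finset.card_eq_three.2 ⟨x, y, z, ht.xy.ne, ht.xz.ne, ht.yz.ne, rfl⟩
      have hC : Conn4 (WheelMinor.contract G {x, y, z}) := hc.contract (by simp) (by omega)
        fun A S B hs hS' => by have := h6 A S B hs hS'; omega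
      have hcard := card_contract (S := ({x, y, z} : Finset V))
      have hd := ht.six_le_degree_contract
      have hlt := (WheelMinor.contract G {x, y, z}).degree_lt_card_verts none
      left
      refine isMinorOf_of_contract (S := {x, y, z}) (by simp) ?_ ?_
      · have h1 := ht.xy
        have h2 := ht.xz
        have h3 := ht.yz
        have h1' := h1.symm
        have h2' := h2.symm
        have h3' := h3.symm
        simp only [Finset.mem_insert, Finset.mem_singleton]
        grind
      · obtain rfl | h2 : n = 1 ∨ 2 ≤ n := by omega
        · exact isMinorOf_of_six_le_degree (by omega) hC.four_le_degree none hd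
        · refine (ih (n - 2) (by omega) hC (by omega)).resolve_right ?_
          rintro ⟨-, ⟨e⟩⟩
          have := cycleSq_degree_le (e none)
          rw [e.degree_eq] at this
          omega
  · unfold Critical at hcrit
    push Not at hcrit
    obtain ⟨x, y, hxy, h⟩ := hcrit
    have hno : ∀ A T B, IsSep G A T B → x ∈ T → y ∈ T → 5 ≤ T.card := fun A T B hs hx hy => by
      have h4 := hc.2 A T B hs
      by_contra hT
      exact h A T B hs (by omega) hx hy
    left
    obtain rfl | h1 : n = 0 ∨ 1 ≤ n := by omega
    · exact isMinorOf_of_contractible_edge_eight hc (by omega) hxy hno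
    · have hcard := card_contract (S := ({x, y} : Finset V))
      rw [Finset.card_pair hxy.ne] at hcard
      obtain h2 | ⟨h2, ⟨e⟩⟩ := ih (n - 1) (by omega) (hc.contract_edge (by omega) hxy hno) (by omega)
      · exact isMinorOf_of_contract_edge hxy h2
      · exact isMinorOf_of_contract_iso_cycleSq hc (by omega) hxy e

end WheelMinor

theorem stmt1 {V : Type*} (G : SimpleGraph V) (hG : FourConnected G)
    (hfree : ¬ (wheel 6).IsMinorOf G) :
    Nat.card V ≤ 6 ∨
      (Nat.card V = 7 ∧ ∀ v : V, (G.neighborSet v).ncard ≤ 5) ∨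
      Nonempty (G ≃g cycleSq 8) := by
  classical
  have : Finite V := Nat.finite_of_card_ne_zero (by have := hG.1; omega)
  have := Fintype.ofFinite V
  have hc := WheelMinor.Conn4.of_fourConnected hG
  rw [Nat.card_eq_fintype_card]
  obtain h | h | h : Fintype.card V ≤ 6 ∨ Fintype.card V = 7 ∨ 8 ≤ Fintype.card V := by omega
  · exact Or.inl h
  · refine Or.inr (Or.inl ⟨h, fun v => ?_⟩)
    by_contra hv
    refine hfree (WheelMinor.isMinorOf_of_six_le_degree h (fun v => ?_) v ?_)
    · convert hc.four_le_degree v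
    · rw [← card_neighborFinset_eq_degree, ← Set.ncard_coe_finset, coe_neighborFinset]
      omega
  · exact Or.inr (Or.inr (((hc.isMinorOf_or_iso (Fintype.card V - 8)
      (by omega)).resolve_left hfree).2))
end

section
/- Let G be a graph on n ≥ 3 vertices whose degree sequence is d₁ ≤ d₂ ≤ … ≤ dₙ. If for each index i with i < n/2 either dᵢ ≥ i + 1 or d_{n−i} ≥ n − i, then G is Hamiltonian. -/
open SimpleGraph

namespace SimpleGraph

variable {V : Type*} [Fintype V] {G : SimpleGraph V}

/-- Chvátal's degree condition, expressed by counting vertices of small degree. -/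
def ChvatalCondition (G : SimpleGraph V) : Prop :=
  ∀ k, 0 < k → 2 * k < Fintype.card V → k ≤ {w | (G.neighborSet w).ncard ≤ k}.ncard →
    {w | (G.neighborSet w).ncard < Fintype.card V - k}.ncard < Fintype.card V - k

lemma ChvatalCondition.mono {H : SimpleGraph V} (hG : G.ChvatalCondition) (hGH : G ≤ H) :
    H.ChvatalCondition := by
  have hle (w : V) : (G.neighborSet w).ncard ≤ (H.neighborSet w).ncard :=
    Set.ncard_le_ncard fun x hx ↦ hGH hx
  intro k hk hk2 hcard
  refine (Set.ncard_le_ncard fun w hw ↦ (hle w).trans_lt hw).trans_lt (hG k hk hk2 ?_)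
  exact hcard.trans (Set.ncard_le_ncard fun w hw ↦ (hle w).trans hw)

variable [DecidableEq V] {u v : V}

/-- Closing up a Hamiltonian path by an edge between its endpoints. -/
lemma Walk.IsHamiltonian.isHamiltonian_of_adj {p : G.Walk u v} (hp : p.IsHamiltonian)
    (h : G.Adj v u) (hV : 3 ≤ Fintype.card V) : G.IsHamiltonian := by
  intro _
  refine ⟨v, .cons h p, Walk.isHamiltonianCycle_iff_isCycle_and_length_eq.mpr ⟨?_, ?_⟩⟩
  · refine (Walk.cons_isCycle_iff p h).mpr ⟨hp.isPath, fun hmem ↦ ?_⟩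
    have h1 := hp.isPath.length_eq_one_of_mem_edges (Sym2.eq_swap ▸ hmem)
    have h2 := hp.length_eq
    omega
  · rw [Walk.length_cons, hp.length_eq]
    omega

/-- Pósa's crossing argument: a Hamiltonian path `x₀, …, xₘ` with `x₀` adjacent to `xᵢ₊₁` and `xₘ`
adjacent to `xᵢ` yields a Hamiltonian cycle. -/
lemma Walk.IsHamiltonian.isHamiltonian_of_adj_of_adj {p : G.Walk u v} (hp : p.IsHamiltonian)
    (hV : 3 ≤ Fintype.card V) {i : ℕ} (hi : i < p.length) (hu : G.Adj u (p.getVert (i + 1)))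
    (hv : G.Adj v (p.getVert i)) : G.IsHamiltonian := by
  let q : G.Walk u (p.getVert (i + 1)) :=
    (p.take i).append (.cons hv.symm (p.drop (i + 1)).reverse)
  have hq : q.IsHamiltonian := by
    intro a
    refine Eq.trans ?_ (hp a)
    simp only [q, Walk.support_append, Walk.support_cons, List.tail_cons, Walk.support_reverse,
      List.count_append, List.count_reverse, Walk.support_take,
      Walk.drop_support_eq_support_drop_min]
    rw [min_eq_left (by omega), ← List.count_append, List.take_append_drop]
  exact hq.isHamiltonian_of_adj hu.symm hV

lemma isHamiltonian_top (hV : 3 ≤ Fintype.card V) : (⊤ : SimpleGraph V).IsHamiltonian := by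
  have : Nonempty V := Fintype.card_pos_iff.mp (by omega)
  obtain ⟨u, v, p, hp, hmax⟩ :=
    Walk.exists_isPath_forall_isPath_length_le_length (⊤ : SimpleGraph V)
  have hham : p.IsHamiltonian := by
    refine hp.isHamiltonian_of_mem fun w ↦ ?_
    by_contra hw
    have hadj : (⊤ : SimpleGraph V).Adj w u := by
      rintro rfl
      exact hw p.start_mem_support
    have := hmax _ _ _ (hp.cons hw (h := hadj))
    simp at this
  refine hham.isHamiltonian_of_adj ?_ hV
  rintro rfl
  have h1 := hham.length_eq
  rw [Walk.length_eq_zero_iff.mpr (Walk.isPath_iff_nil.mp hp)] at h1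
  omega

/-- If adding the edge `uv` makes a graph Hamiltonian, then the graph already was, or it has a
Hamiltonian path from `u` to `v`. -/
lemma IsHamiltonian.isHamiltonian_or_exists_walk (h : (G ⊔ edge u v).IsHamiltonian)
    (hV : 3 ≤ Fintype.card V) :
    G.IsHamiltonian ∨ ∃ p : G.Walk u v, p.IsHamiltonian := by
  have hedges {e : Sym2 V} (he : e ∈ (G ⊔ edge u v).edgeSet) (hne : e ≠ s(u, v)) :
      e ∈ G.edgeSet := by
    rw [edgeSet_sup] at he
    exact he.resolve_right fun h' ↦ hne (edgeSet_edge_subset h')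
  have : Nontrivial V := Fintype.one_lt_card_iff_nontrivial.mp (by omega)
  obtain ⟨c, hc⟩ := h.exists_isHamiltonianCycle u
  by_cases hmem : s(u, v) ∈ c.edges
  · right
    obtain ⟨c, hc, hsnd⟩ : ∃ c : (G ⊔ edge u v).Walk u u, c.IsHamiltonianCycle ∧ c.snd = v := by
      cases c with
      | nil => simp at hmem
      | @cons _ w _ hadj p =>
        by_cases hw : w = v
        · exact ⟨.cons hadj p, hc, by simpa using hw⟩
        · have hp := ((Walk.cons_isCycle_iff p hadj).mp hc.isCycle).1
          have hmem' : s(u, v) ∈ p.edges := by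
            rw [Walk.edges_cons, List.mem_cons] at hmem
            refine hmem.resolve_left fun h' ↦ ?_
            rw [Sym2.congr_right] at h'
            exact hw h'.symm
          refine ⟨(Walk.cons hadj p).reverse, ?_, ?_⟩
          · rw [Walk.isHamiltonianCycle_iff_isCycle_and_length_eq] at hc ⊢
            exact ⟨hc.1.reverse, (Walk.length_reverse _).trans hc.2⟩
          · rw [Walk.snd_reverse, Walk.penultimate_cons_of_not_nil]
            · exact (hp.eq_penultimate_of_mem_edges hmem').symm
            intro hnil
            rw [Walk.edges_eq_nil.mpr hnil] at hmem'
            simp at hmem'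
    cases c with
    | nil => exact absurd rfl hc.ne_nil
    | @cons _ w _ hadj p =>
      obtain rfl : w = v := by simpa using hsnd
      have hp := (Walk.cons_isCycle_iff p hadj).mp hc.isCycle
      have hpG : ∀ e ∈ p.edges, e ∈ G.edgeSet := fun e he ↦
        hedges (p.edges_subset_edgeSet he) fun h' ↦ hp.2 (h' ▸ he)
      refine ⟨(p.transfer G hpG).reverse, Walk.isHamiltonian_iff_isPath_and_length_eq.mpr
        ⟨(hp.1.transfer hpG).reverse, ?_⟩⟩
      have := hc.length_eq
      rw [Walk.length_cons] at this
      rw [Walk.length_reverse, Walk.length_transfer]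
      omega
  · left
    intro _
    have hcG : ∀ e ∈ c.edges, e ∈ G.edgeSet := fun e he ↦
      hedges (c.edges_subset_edgeSet he) fun h' ↦ hmem (h' ▸ he)
    refine ⟨u, c.transfer G hcG, Walk.isHamiltonianCycle_iff_isCycle_and_length_eq.mpr
      ⟨hc.isCycle.transfer hcG, ?_⟩⟩
    rw [Walk.length_transfer, hc.length_eq]

/-- In a non-Hamiltonian graph, the endpoints `u`, `v` of a Hamiltonian path have degree sum less
than the number of vertices. Moreover at least `deg u` vertices other than `v` are not
adjacent to `v`. -/
lemma Walk.IsHamiltonian.ncard_neighborSet_add_lt {p : G.Walk u v} (hp : p.IsHamiltonian)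
    (hV : 3 ≤ Fintype.card V) (hG : ¬ G.IsHamiltonian) :
    (G.neighborSet u).ncard + (G.neighborSet v).ncard < Fintype.card V ∧
      (G.neighborSet u).ncard ≤ {w | w ≠ v ∧ ¬ G.Adj w v}.ncard := by
  set S : Set V := {w | w ≠ v ∧ ¬ G.Adj w v}
  have hS : S = (insert v (G.neighborSet v))ᶜ := by
    ext w
    simp [S, adj_comm]
  have hScard : S.ncard + ((G.neighborSet v).ncard + 1) = Fintype.card V := by
    rw [hS, ← Set.ncard_insert_of_notMem (s := G.neighborSet v) (a := v) (by simp), add_comm,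
      Set.ncard_add_ncard_compl, Nat.card_eq_fintype_card]
  set A : Set ℕ := {i | i < p.length ∧ G.Adj u (p.getVert (i + 1))}
  have hA : A.Finite := (Set.finite_lt_nat p.length).subset fun i hi ↦ hi.1
  have h1 : (G.neighborSet u).ncard ≤ A.ncard := by
    refine (Set.ncard_le_ncard (t := (fun i ↦ p.getVert (i + 1)) '' A) ?_ (hA.image _)).trans
      (Set.ncard_image_le hA)
    intro w hw
    obtain ⟨j, rfl, hj⟩ := Walk.mem_support_iff_exists_getVert.mp (hp.mem_support w)
    cases j with
    | zero => simp at hw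
    | succ i => exact ⟨i, ⟨by omega, hw⟩, rfl⟩
  have h2 : A.ncard ≤ S.ncard := by
    refine Set.ncard_le_ncard_of_injOn p.getVert ?_ ?_
    · rintro i ⟨hi, hadj⟩
      refine ⟨fun hv ↦ ?_, fun hv ↦ hG (hp.isHamiltonian_of_adj_of_adj hV hi hadj hv.symm)⟩
      exact hi.ne ((hp.isPath.getVert_eq_end_iff hi.le).mp hv)
    · exact hp.isPath.getVert_injOn.mono fun i hi ↦ hi.1.le
  exact ⟨by omega, h1.trans h2⟩

/-- Chvátal's theorem, for the counting form of the degree condition. -/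
theorem ChvatalCondition.isHamiltonian (hG : G.ChvatalCondition) (hV : 3 ≤ Fintype.card V) :
    G.IsHamiltonian := by
  by_contra hnot
  obtain ⟨H, hGH, hH⟩ := Finite.exists_le_maximal (p := fun H ↦ ¬ IsHamiltonian H) hnot
  have hC := hG.mono hGH
  let P : Set (V × V) := {x | x.1 ≠ x.2 ∧ ¬ H.Adj x.1 x.2}
  have hP : P.Nonempty := by
    by_contra hempty
    refine hH.prop ((isHamiltonian_top hV).mono fun a b hab ↦ ?_)
    by_contra hadj
    exact hempty ⟨(a, b), hab, hadj⟩
  obtain ⟨⟨u, v⟩, ⟨hne, hadj⟩, hmax⟩ := P.toFinite.exists_maximalFor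
    (fun x ↦ (H.neighborSet x.1).ncard + (H.neighborSet x.2).ncard) P hP
  dsimp only at hne hadj hmax
  replace hmax (a b : V) (hab : a ≠ b) (hab' : ¬ H.Adj a b) :
      (H.neighborSet a).ncard + (H.neighborSet b).ncard ≤
        (H.neighborSet u).ncard + (H.neighborSet v).ncard := by
    by_contra! hlt
    exact hlt.not_ge (hmax (j := (a, b)) ⟨hab, hab'⟩ hlt.le)
  wlog huv : (H.neighborSet u).ncard ≤ (H.neighborSet v).ncard generalizing u v
  · refine this v u hne.symm (fun h ↦ hadj h.symm) (fun a b hab hab' ↦ ?_) (by omega)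
    have := hmax a b hab hab'
    omega
  have hham : (H ⊔ edge u v).IsHamiltonian := by
    by_contra h
    exact (H.lt_sup_edge _ _ hne hadj).not_ge (hH.le_of_ge h le_sup_left)
  obtain ⟨p, hp⟩ := (hham.isHamiltonian_or_exists_walk hV).resolve_left hH.prop
  obtain ⟨hsum, hcard⟩ := hp.ncard_neighborSet_add_lt hV hH.prop
  set k := (H.neighborSet u).ncard
  have hk : 0 < k := (Set.ncard_pos).mpr ⟨p.snd, p.adj_snd (Walk.not_nil_of_ne hne)⟩
  have hsmall : k ≤ {w | (H.neighborSet w).ncard ≤ k}.ncard := by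
    refine hcard.trans (Set.ncard_le_ncard fun w hw ↦ ?_)
    have := hmax w v hw.1 hw.2
    simp only [Set.mem_ofPred_eq]
    omega
  have hlarge : Fintype.card V - k ≤
      {w | (H.neighborSet w).ncard < Fintype.card V - k}.ncard := by
    have hcompl : (H.neighborSet u)ᶜ.ncard = Fintype.card V - k := by
      rw [Set.ncard_compl, Nat.card_eq_fintype_card]
    rw [← hcompl]
    refine Set.ncard_le_ncard fun w hw ↦ ?_
    rw [Set.mem_ofPred_eq, hcompl]
    obtain rfl | hwu := eq_or_ne w u
    · omega
    · have := hmax u w hwu.symm hw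
      omega
  exact (hC k hk (by omega) hsmall).not_ge hlarge

end SimpleGraph

/-- If a monotone enumeration of the values of `f` is at least `t` from position `m` on, then `f`
takes values below `t` at most `m` times. -/
lemma ncard_lt_le_of_monotone {V : Type*} {n : ℕ} {d : Fin n → ℕ} (hmono : Monotone d)
    (v : Fin n ≃ V) {f : V → ℕ} (hf : ∀ i, f (v i) = d i) {t : ℕ} (m : Fin n) (h : t ≤ d m) :
    {w | f w < t}.ncard ≤ m := by
  have hsub : {w | f w < t} ⊆ v '' Set.Iio m := by
    intro w hw
    obtain ⟨j, rfl⟩ := v.surjective w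
    refine ⟨j, ?_, rfl⟩
    rw [Set.mem_ofPred_eq, hf] at hw
    exact lt_of_not_ge fun hj ↦ (hw.trans_le h).not_ge (hmono hj)
  calc {w | f w < t}.ncard ≤ (v '' Set.Iio m).ncard :=
        Set.ncard_le_ncard hsub (Set.toFinite _)
    _ = m := by rw [Set.ncard_image_of_injective _ v.injective, Set.ncard_eq_toFinset_card']; simp

theorem stmt10 {V : Type*} [Fintype V] [DecidableEq V] (G : SimpleGraph V)
    (n : ℕ) (hn : 3 ≤ n) (hcard : Fintype.card V = n)
    (d : Fin n → ℕ) (v : Fin n ≃ V) (hmono : Monotone d)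
    (hdeg : ∀ i : Fin n, (G.neighborSet (v i)).ncard = d i)
    (hcond : ∀ i : Fin n, ∀ _h : 2 * ((i : ℕ) + 1) < n,
      (i : ℕ) + 2 ≤ d i ∨ n - (i : ℕ) - 1 ≤ d ⟨n - (i : ℕ) - 2, by omega⟩) :
    G.IsHamiltonian := by
  refine ChvatalCondition.isHamiltonian (fun k hk hk2 hle ↦ ?_) (hcard ▸ hn)
  obtain ⟨i, rfl⟩ := Nat.exists_eq_add_of_lt hk
  rw [hcard] at hk2 ⊢
  simp only [zero_add] at hk2 hle ⊢
  obtain h | h := hcond ⟨i, by omega⟩ hk2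
  · have :=
      ncard_lt_le_of_monotone hmono v (f := fun w ↦ (G.neighborSet w).ncard) hdeg _ h
    simp only [Nat.lt_succ_iff] at this
    omega
  · have :=
      ncard_lt_le_of_monotone hmono v (f := fun w ↦ (G.neighborSet w).ncard) hdeg _ h
    simp only [Nat.sub_sub] at this ⊢
    omega
end
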